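/- arXiv:1304.3830 — 2 statements merged into one kernel-verified Lean document; each statement's English description precedes it below -/
import Mathlib

section
/- Suppose I ∈ {1, 2, …, ∞} and {E_i}_{i<I} are countably many (or finitely many) countable Borel equivalence relations on a standard Borel space X that are everywhere non-independent. Then there exists a Borel partition {A_i}_{i<I} of X such that for every i < I, the complement of A_i meets every E_i-class. -/
/-- A family of equivalence relations (restricted to the points join-equivalent to a
given point `z`) is non-independent if there is a cycle `x_0 E_{i_0} x_1 E_{i_1} ⋯
x_n E_{i_n} x_0` of distinct points, with `n ≥ 2` and consecutive indices distinct. -/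
def NonIndependentAt {X ι : Type*} (E : ι → X → X → Prop) (z : X) : Prop :=
  ∃ n : ℕ, 2 ≤ n ∧
    ∃ (x : Fin (n + 1) → X) (idx : Fin (n + 1) → ι),
      Function.Injective x ∧
      (∀ j, Relation.EqvGen (fun a b => ∃ i, E i a b) z (x j)) ∧
      (∀ j : Fin n, idx j.castSucc ≠ idx j.succ) ∧
      (∀ j : Fin n, E (idx j.castSucc) (x j.castSucc) (x j.succ)) ∧
      E (idx (Fin.last n)) (x (Fin.last n)) (x 0)

section LusinNovikov

open Set MeasureTheory Topology PiNat

variable {X Y : Type*}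

/-- A set of pairs that is the graph of a partial function. -/
def IsFunctional (s : Set (X × Y)) : Prop :=
  ∀ ⦃x y z⦄, (x, y) ∈ s → (x, z) ∈ s → y = z

/-- A set of pairs covered by countably many measurable graphs of partial functions. -/
def IsGraphCoverable [MeasurableSpace X] [MeasurableSpace Y] (s : Set (X × Y)) : Prop :=
  ∃ F : ℕ → Set (X × Y), (∀ n, MeasurableSet (F n)) ∧ (∀ n, IsFunctional (F n)) ∧ s ⊆ ⋃ n, F n

section Coverable

variable [MeasurableSpace X] [MeasurableSpace Y]

lemma IsGraphCoverable.mono {s t : Set (X × Y)} (ht : IsGraphCoverable t) (h : s ⊆ t) :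
    IsGraphCoverable s := by
  obtain ⟨F, hF, hF', hs⟩ := ht
  exact ⟨F, hF, hF', h.trans hs⟩

lemma IsGraphCoverable.of_isFunctional {s : Set (X × Y)} (hs : MeasurableSet s)
    (h : IsFunctional s) : IsGraphCoverable s :=
  ⟨fun _ => s, fun _ => hs, fun _ => h, fun _ hx => mem_iUnion.2 ⟨0, hx⟩⟩

lemma isGraphCoverable_empty : IsGraphCoverable (∅ : Set (X × Y)) :=
  .of_isFunctional .empty fun _ _ _ h => h.elim

lemma isGraphCoverable_iUnion {κ : Sort*} [Countable κ] {s : κ → Set (X × Y)}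
    (h : ∀ k, IsGraphCoverable (s k)) : IsGraphCoverable (⋃ k, s k) := by
  rcases isEmpty_or_nonempty κ with _ | _
  · simpa using isGraphCoverable_empty
  choose F hF hF' hs using h
  obtain ⟨e, he⟩ := exists_surjective_nat (PLift κ × ℕ)
  refine ⟨fun n => F (e n).1.down (e n).2, fun n => hF _ _, fun n => hF' _ _, ?_⟩
  refine iUnion_subset fun k p hp => ?_
  obtain ⟨m, hm⟩ := mem_iUnion.1 (hs k hp)
  obtain ⟨n, hn⟩ := he (⟨k⟩, m)
  exact mem_iUnion.2 ⟨n, by simpa [hn] using hm⟩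

lemma IsGraphCoverable.union {s t : Set (X × Y)} (hs : IsGraphCoverable s)
    (ht : IsGraphCoverable t) : IsGraphCoverable (s ∪ t) := by
  rw [union_eq_iUnion]
  exact isGraphCoverable_iUnion fun b => by cases b <;> assumption

end Coverable

section Polish

variable [TopologicalSpace X] [TopologicalSpace Y]

lemma MeasureTheory.AnalyticSet.inter_measurableSet [PolishSpace X] [MeasurableSpace X]
    [BorelSpace X] {s t : Set X} (hs : AnalyticSet s)
    (ht : MeasurableSet t) : AnalyticSet (s ∩ t) := by
  rw [inter_eq_iInter]
  exact AnalyticSet.iInter fun b => by cases b <;> simp [hs, ht.analyticSet]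

/-- An analytic graph of a partial function is contained in a Borel one. -/
lemma MeasureTheory.AnalyticSet.isGraphCoverable [PolishSpace X] [MeasurableSpace X] [BorelSpace X]
    [PolishSpace Y] [MeasurableSpace Y] [BorelSpace Y] {s : Set (X × Y)} (hs : AnalyticSet s)
    (h : IsFunctional s) : IsGraphCoverable s := by
  let b := TopologicalSpace.countableBasis Y
  have hb := TopologicalSpace.isBasis_countableBasis Y
  have key : ∀ U V : b, ∃ D : Set X, MeasurableSet D ∧ (Disjoint U.1 V.1 →
      ∀ p ∈ s, (p.2 ∈ U.1 → p.1 ∈ D) ∧ (p.2 ∈ V.1 → p.1 ∉ D)) := by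
    intro U V
    by_cases hUV : Disjoint U.1 V.1
    · have hA : ∀ W : b, AnalyticSet (Prod.fst '' (s ∩ Prod.snd ⁻¹' W.1)) := fun W =>
        (hs.inter_measurableSet
          ((hb.isOpen W.2).measurableSet.preimage measurable_snd)).image_of_continuous
          continuous_fst
      obtain ⟨D, h1, h2, hD⟩ := (hA U).measurablySeparable (hA V) (by
        rw [disjoint_left]
        rintro _ ⟨⟨x, y⟩, ⟨hp, hy⟩, rfl⟩ ⟨⟨x', y'⟩, ⟨hp', hy'⟩, rfl : x' = x⟩
        obtain rfl := h hp hp'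
        exact disjoint_left.1 hUV hy hy')
      exact ⟨D, hD, fun _ p hp => ⟨fun hU => h1 ⟨p, ⟨hp, hU⟩, rfl⟩,
        fun hV => disjoint_left.1 h2 ⟨p, ⟨hp, hV⟩, rfl⟩⟩⟩
    · exact ⟨∅, .empty, fun h => (hUV h).elim⟩
  choose D hD hsep using key
  have : Countable b := (TopologicalSpace.countable_countableBasis Y).to_subtype
  let B : Set (X × Y) := ⋂ (U : b) (V : b) (_ : Disjoint U.1 V.1),
    ((Prod.snd ⁻¹' U.1)ᶜ ∪ Prod.fst ⁻¹' D U V) ∩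
      ((Prod.snd ⁻¹' V.1)ᶜ ∪ (Prod.fst ⁻¹' D U V)ᶜ)
  have hB : MeasurableSet B := by
    refine .iInter fun U => .iInter fun V => .iInter fun _ => ?_
    have hU : MeasurableSet (Prod.snd ⁻¹' U.1 : Set (X × Y)) :=
      (hb.isOpen U.2).measurableSet.preimage measurable_snd
    have hV : MeasurableSet (Prod.snd ⁻¹' V.1 : Set (X × Y)) :=
      (hb.isOpen V.2).measurableSet.preimage measurable_snd
    have hD' : MeasurableSet (Prod.fst ⁻¹' D U V : Set (X × Y)) :=
      (hD U V).preimage measurable_fst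
    exact (hU.compl.union hD').inter (hV.compl.union hD'.compl)
  refine (IsGraphCoverable.of_isFunctional hB ?_).mono (s := s) ?_
  · intro x y y' hy hy'
    by_contra hne
    obtain ⟨U, V, hU, hV, hyU, hyV, hUV⟩ := t2_separation hne
    obtain ⟨U', hU', hyU', hUU'⟩ := hb.exists_subset_of_mem_open hyU hU
    obtain ⟨V', hV', hyV', hVV'⟩ := hb.exists_subset_of_mem_open hyV hV
    have hd : Disjoint U' V' := hUV.mono hUU' hVV'
    simp only [B, mem_iInter] at hy hy'
    have h1 := (hy ⟨U', hU'⟩ ⟨V', hV'⟩ hd).1.resolve_left (by simpa using hyU')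
    have h2 := (hy' ⟨U', hU'⟩ ⟨V', hV'⟩ hd).2.resolve_left (by simpa using hyV')
    exact h2 h1
  · intro p hp
    simp only [B, mem_iInter]
    intro U V hUV
    obtain ⟨h1, h2⟩ := hsep U V hUV p hp
    exact ⟨or_iff_not_imp_left.2 fun h => h1 (by simpa using h),
      or_iff_not_imp_left.2 fun h => h2 (by simpa using h)⟩

/-- The sequences of natural numbers with (reversed) initial segment `u`. -/
def initialCylinder (u : List ℕ) : Set (ℕ → ℕ) := {z | res z u.length = u}

lemma exists_res_eq_imp_mem {z : ℕ → ℕ} {s : Set (ℕ → ℕ)} (hs : s ∈ 𝓝 z) :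
    ∃ n, ∀ m, n ≤ m → ∀ z', res z' m = res z m → z' ∈ s := by
  obtain ⟨_, ⟨x, n, rfl⟩, hz, hsub⟩ :=
    (isTopologicalBasis_cylinders (fun _ : ℕ => ℕ)).mem_nhds_iff.1 hs
  refine ⟨n, fun m hm z' hz' => hsub ?_⟩
  rw [mem_cylinder_iff] at hz ⊢
  exact fun i hi => (res_eq_res.1 hz' (hi.trans_le hm)).trans (hz i hi)

lemma isOpen_initialCylinder (u : List ℕ) : IsOpen (initialCylinder u) := by
  have : initialCylinder u = ⋃ z ∈ initialCylinder u, cylinder z u.length := by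
    ext z
    simp only [mem_iUnion, cylinder_eq_res]
    exact ⟨fun h => ⟨z, h, rfl⟩, fun ⟨z', h, hz⟩ => Eq.trans hz h⟩
  rw [this]
  exact isOpen_biUnion fun z _ => isOpen_cylinder _ z _

/-- A family of cylinders is large for `f` if the base space cannot be covered by measurable sets
over each of which the image of one of the cylinders is coverable by graphs. -/
def IsLargeFamily [MeasurableSpace X] [MeasurableSpace Y] (f : (ℕ → ℕ) → X × Y) {κ : Type*} (u : κ → List ℕ) : Prop :=
  ∀ B : κ → Set X, (∀ k, MeasurableSet (B k)) →
    (∀ k, IsGraphCoverable (f '' initialCylinder (u k) ∩ Prod.fst ⁻¹' B k)) → ⋃ k, B k ≠ univ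

/-- `v` is a proper extension of `u`. -/
def IsExtension (u v : List ℕ) : Prop :=
  u.length < v.length ∧ initialCylinder v ⊆ initialCylinder u

lemma isExtension_res {u : List ℕ} {z : ℕ → ℕ} (hz : z ∈ initialCylinder u) {m : ℕ}
    (hm : u.length < m) : IsExtension u (res z m) := by
  refine ⟨by simpa using hm, fun z' hz' => ?_⟩
  have hz'' : res z' m = res z m := by simpa [initialCylinder] using hz'
  exact (res_eq_res.2 fun i hi => res_eq_res.1 hz'' (hi.trans hm)).trans hz

variable {f : (ℕ → ℕ) → X × Y}

lemma IsLargeFamily.nonempty_inter [PolishSpace X] [MeasurableSpace X] [BorelSpace X]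
    [MeasurableSpace Y] (hf : Continuous f) {κ : Type*} {u : κ → List ℕ}
    (hu : IsLargeFamily f u) (k l : κ) :
    (Prod.fst '' (f '' initialCylinder (u k)) ∩
      Prod.fst '' (f '' initialCylinder (u l))).Nonempty := by
  by_contra hne
  have hA : ∀ k, AnalyticSet (Prod.fst '' (f '' initialCylinder (u k))) := fun k =>
    ((isOpen_initialCylinder (u k)).analyticSet_image hf).image_of_continuous continuous_fst
  obtain ⟨D, h1, h2, hD⟩ := (hA k).measurablySeparable (hA l)
    (disjoint_iff_inter_eq_empty.2 (not_nonempty_iff_eq_empty.1 hne))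
  refine hu (fun j => {x | (j = k ∧ x ∉ D) ∨ (j = l ∧ x ∈ D)}) (fun j => ?_) (fun j => ?_) ?_
  · exact ((MeasurableSet.const _).inter hD.compl).union ((MeasurableSet.const _).inter hD)
  · convert! isGraphCoverable_empty using 1
    rw [eq_empty_iff_forall_notMem]
    rintro p ⟨hp, ⟨rfl, hpD⟩ | ⟨rfl, hpD⟩⟩
    · exact hpD (h1 ⟨p, hp, rfl⟩)
    · exact disjoint_left.1 h2 ⟨p, hp, rfl⟩ hpD
  · refine eq_univ_of_forall fun x => mem_iUnion.2 ?_
    by_cases hx : x ∈ D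
    · exact ⟨l, .inr ⟨rfl, hx⟩⟩
    · exact ⟨k, .inl ⟨rfl, hx⟩⟩

/-- Two cylinders whose images have disjoint projections to `Y`. -/
def HasDisjointImages (f : (ℕ → ℕ) → X × Y) (v w : List ℕ) : Prop :=
  Disjoint (Prod.snd '' (f '' initialCylinder v)) (Prod.snd '' (f '' initialCylinder w))

lemma exists_disjoint_extensions [T2Space Y] (hf : Continuous f) {u : List ℕ} {z z' : ℕ → ℕ}
    (hz : z ∈ initialCylinder u) (hz' : z' ∈ initialCylinder u) (hne : (f z).2 ≠ (f z').2) :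
    ∃ v w, IsExtension u v ∧ IsExtension u w ∧ HasDisjointImages f v w ∧
      z ∈ initialCylinder v ∧ z' ∈ initialCylinder w := by
  obtain ⟨U, V, hU, hV, hyU, hyV, hUV⟩ := t2_separation hne
  have hc := continuous_snd.comp hf
  obtain ⟨n, hn⟩ := exists_res_eq_imp_mem ((hU.preimage hc).mem_nhds hyU)
  obtain ⟨n', hn'⟩ := exists_res_eq_imp_mem ((hV.preimage hc).mem_nhds hyV)
  let m := max (max n n') (u.length + 1)
  refine ⟨res z m, res z' m, isExtension_res hz (by omega), isExtension_res hz' (by omega),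
    hUV.mono ?_ ?_, by simp [initialCylinder], by simp [initialCylinder]⟩
  · rintro _ ⟨_, ⟨t, ht, rfl⟩, rfl⟩
    exact hn m (by omega) t (by simpa [initialCylinder] using ht)
  · rintro _ ⟨_, ⟨t, ht, rfl⟩, rfl⟩
    exact hn' m (by omega) t (by simpa [initialCylinder] using ht)

/-- All members of a finite large family can be split simultaneously. -/
lemma IsLargeFamily.exists_split [PolishSpace X] [MeasurableSpace X] [BorelSpace X]
    [PolishSpace Y] [MeasurableSpace Y] [BorelSpace Y] (hf : Continuous f) {κ : Type*} [Finite κ] {u : κ → List ℕ}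
    (hu : IsLargeFamily f u) :
    ∃ u' : κ × Bool → List ℕ, IsLargeFamily f u' ∧ (∀ k b, IsExtension (u k) (u' (k, b))) ∧
      ∀ k, HasDisjointImages f (u' (k, false)) (u' (k, true)) := by
  by_contra! hcon
  let C := {c : κ × Bool → List ℕ // (∀ k b, IsExtension (u k) (c (k, b))) ∧
    ∀ k, HasDisjointImages f (c (k, false)) (c (k, true))}
  have hC : ∀ c : C, ∃ B : κ × Bool → Set X, (∀ k, MeasurableSet (B k)) ∧
      (∀ k, IsGraphCoverable (f '' initialCylinder (c.1 k) ∩ Prod.fst ⁻¹' B k)) ∧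
      ⋃ k, B k = univ := by
    intro c
    have hc : ¬ IsLargeFamily f c.1 := fun h => by
      obtain ⟨k, hk⟩ := hcon c.1 h c.2.1
      exact hk (c.2.2 k)
    simpa [IsLargeFamily] using hc
  choose B hBm hBc hBu using hC
  have : Countable (κ × Bool → List ℕ) := inferInstance
  have : Countable C := inferInstance
  let D : List ℕ → Set X := fun v => ⋃ (c : C) (k : κ × Bool) (_ : c.1 k = v), B c k
  have hDm : ∀ v, MeasurableSet (D v) := fun v =>
    .iUnion fun c => .iUnion fun k => .iUnion fun _ => hBm c k
  have hDc : ∀ v, IsGraphCoverable (f '' initialCylinder v ∩ Prod.fst ⁻¹' D v) := by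
    intro v
    simp only [D, preimage_iUnion, inter_iUnion]
    refine isGraphCoverable_iUnion fun c => isGraphCoverable_iUnion fun k =>
      isGraphCoverable_iUnion ?_
    rintro rfl
    exact hBc c k
  let G : κ → Set X := fun k => ⋂ (v : List ℕ) (w : List ℕ) (_ : IsExtension (u k) v ∧
    IsExtension (u k) w ∧ HasDisjointImages f v w), D v ∪ D w
  refine hu G (fun k => .iInter fun v => .iInter fun w => .iInter fun _ =>
    (hDm v).union (hDm w)) (fun k => ?_) (eq_univ_of_forall fun x => ?_)
  · obtain ⟨F, hFm, hFf, hF⟩ := isGraphCoverable_iUnion hDc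
    have hFm' : MeasurableSet (⋃ n, F n) := .iUnion hFm
    have hGm : MeasurableSet (G k) := .iInter fun v => .iInter fun w => .iInter fun _ =>
      (hDm v).union (hDm w)
    have hA : AnalyticSet ((f '' initialCylinder (u k) ∩ Prod.fst ⁻¹' G k) ∩ (⋃ n, F n)ᶜ) :=
      (((isOpen_initialCylinder (u k)).analyticSet_image hf).inter_measurableSet
        (hGm.preimage measurable_fst)).inter_measurableSet hFm'.compl
    have hAc := hA.isGraphCoverable (by
      rintro x y y' ⟨⟨⟨z, hz, hzx⟩, hG⟩, hnF⟩ ⟨⟨⟨z', hz', hzx'⟩, -⟩, hnF'⟩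
      by_contra hne
      obtain ⟨v, w, hv, hw, hvw, hzv, hzw⟩ :=
        exists_disjoint_extensions hf hz hz' (by simpa [hzx, hzx'] using hne)
      have hG' : x ∈ G k := hG
      simp only [G, mem_iInter] at hG'
      rcases hG' v w ⟨hv, hw, hvw⟩ with h | h
      · exact hnF (hF (mem_iUnion.2 ⟨v, ⟨z, hzv, hzx⟩, h⟩))
      · exact hnF' (hF (mem_iUnion.2 ⟨w, ⟨z', hzw, hzx'⟩, h⟩)))
    have hFc : IsGraphCoverable (⋃ n, F n) := ⟨F, hFm, hFf, subset_rfl⟩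
    refine (hAc.union hFc).mono fun p hp => ?_
    by_cases hpF : p ∈ ⋃ n, F n
    · exact .inr hpF
    · exact .inl ⟨hp, hpF⟩
  · by_contra hx
    simp only [G, mem_iUnion, mem_iInter, not_exists, not_forall, mem_union, not_or] at hx
    choose v w hvw hxv hxw using hx
    let c : C := ⟨fun p => bif p.2 then w p.1 else v p.1,
      fun k b => by cases b <;> simp [hvw k], fun k => by simpa using (hvw k).2.2⟩
    have hxB : x ∈ ⋃ k, B c k := by rw [hBu]; trivial
    obtain ⟨⟨k, b⟩, hk⟩ := mem_iUnion.1 hxB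
    have hxD : x ∈ D (c.1 (k, b)) := by
      simp only [D, mem_iUnion]
      exact ⟨c, _, rfl, hk⟩
    cases b
    · exact hxv k hxD
    · exact hxw k hxD

/-- The index types of the levels of a binary tree. -/
def BinaryLevel : ℕ → Type
  | 0 => Unit
  | n + 1 => BinaryLevel n × Bool

instance instFiniteBinaryLevel : ∀ n, Finite (BinaryLevel n)
  | 0 => inferInstanceAs (Finite Unit)
  | n + 1 =>
    have := instFiniteBinaryLevel n
    inferInstanceAs (Finite (BinaryLevel n × Bool))

/-- The node of level `n` on the branch `α`. -/
def branchNode (α : ℕ → Bool) : ∀ n, BinaryLevel n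
  | 0 => ()
  | n + 1 => (branchNode α n, α n)

lemma branchNode_congr {α β : ℕ → Bool} : ∀ {n : ℕ}, (∀ i < n, α i = β i) →
    branchNode α n = branchNode β n
  | 0, _ => rfl
  | n + 1, h => Prod.ext (branchNode_congr fun i hi => h i (by omega)) (h n (by omega))

lemma exists_mem_initialCylinder {u : ℕ → List ℕ} (hu : ∀ n, IsExtension (u n) (u (n + 1)))
    (hne : ∀ n, (initialCylinder (u n)).Nonempty) : ∃ z, ∀ n, z ∈ initialCylinder (u n) := by
  choose t ht using hne
  have hlen : ∀ n, n ≤ (u n).length := by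
    intro n
    induction n with
    | zero => simp
    | succ n ih => have := (hu n).1; omega
  have hanti : Antitone fun n => initialCylinder (u n) := antitone_nat_of_succ_le fun n => (hu n).2
  have hagree : ∀ n m, n ≤ m → ∀ i < (u n).length, t m i = t n i := fun n m hnm i hi =>
    res_eq_res.1 (Eq.trans (hanti hnm (ht m) : res (t m) _ = _)
      (ht n : res (t n) _ = _).symm) hi
  refine ⟨fun i => t (i + 1) i, fun n => ?_⟩
  refine Eq.trans (res_eq_res.2 fun i hi => ?_) (ht n)
  rcases le_total (i + 1) n with h | h
  · exact (hagree _ _ h i (hlen (i + 1))).symm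
  · exact hagree _ _ h i hi

/-- **Lusin–Novikov theorem**: an analytic set with countable sections is covered by countably many
Borel graphs of partial functions. -/
theorem MeasureTheory.AnalyticSet.isGraphCoverable_of_countable [PolishSpace X] [MeasurableSpace X] [BorelSpace X]
    [PolishSpace Y] [MeasurableSpace Y] [BorelSpace Y] {s : Set (X × Y)}
    (hs : AnalyticSet s) (hc : ∀ x, {y | (x, y) ∈ s}.Countable) : IsGraphCoverable s := by
  rw [AnalyticSet] at hs
  rcases hs with rfl | ⟨f, hf, rfl⟩
  · exact isGraphCoverable_empty
  by_contra hcon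
  have hlarge : IsLargeFamily f fun _ : BinaryLevel 0 => [] := by
    intro B _ hB hu
    refine hcon ((hB ()).mono ?_)
    rintro _ ⟨z, rfl⟩
    have hz : (f z).1 ∈ ⋃ k, B k := by rw [hu]; trivial
    obtain ⟨⟨⟩, hk⟩ := mem_iUnion.1 hz
    exact ⟨⟨z, rfl, rfl⟩, hk⟩
  have hstep : ∀ n (u : BinaryLevel n → List ℕ), IsLargeFamily f u →
      ∃ u' : BinaryLevel (n + 1) → List ℕ, IsLargeFamily f u' ∧
        (∀ k b, IsExtension (u k) (u' (k, b))) ∧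
        ∀ k, HasDisjointImages f (u' (k, false)) (u' (k, true)) :=
    fun n u hu => hu.exists_split hf
  choose S hSl hSe hSd using hstep
  let T : ∀ n, {u : BinaryLevel n → List ℕ // IsLargeFamily f u} := fun n =>
    Nat.rec ⟨_, hlarge⟩ (fun n u => ⟨S n u.1 u.2, hSl n u.1 u.2⟩) n
  have hTe : ∀ n k b, IsExtension ((T n).1 k) ((T (n + 1)).1 (k, b)) := fun n => hSe n _ _
  have hTd : ∀ n k, HasDisjointImages f ((T (n + 1)).1 (k, false)) ((T (n + 1)).1 (k, true)) :=
    fun n => hSd n _ _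
  have hz : ∀ α : ℕ → Bool, ∃ z, ∀ n, z ∈ initialCylinder ((T n).1 (branchNode α n)) := fun α => by
    refine exists_mem_initialCylinder (fun n => hTe n _ _) fun n => ?_
    obtain ⟨_, ⟨_, ⟨z, hz, -⟩, -⟩, -⟩ :=
      (T n).2.nonempty_inter hf (branchNode α n) (branchNode α n)
    exact ⟨z, hz⟩
  choose z hz using hz
  have hlen : ∀ α n, n ≤ ((T n).1 (branchNode α n)).length := by
    intro α n
    induction n with
    | zero => simp
    | succ n ih => exact ih.trans_lt (hTe n (branchNode α n) (α n)).1
  have hfst : ∀ α β, (f (z α)).1 = (f (z β)).1 := by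
    intro α β
    by_contra hne
    obtain ⟨U, V, hU, hV, hxU, hxV, hUV⟩ := t2_separation hne
    have hc := continuous_fst.comp hf
    obtain ⟨n, hn⟩ := exists_res_eq_imp_mem ((hU.preimage hc).mem_nhds hxU)
    obtain ⟨n', hn'⟩ := exists_res_eq_imp_mem ((hV.preimage hc).mem_nhds hxV)
    let m := max n n'
    obtain ⟨x, ⟨_, ⟨t, ht, rfl⟩, htx⟩, ⟨_, ⟨t', ht', rfl⟩, htx'⟩⟩ :=
      (T m).2.nonempty_inter hf (branchNode α m) (branchNode β m)
    have h1 : (f t).1 ∈ U := hn _ ((le_max_left n n').trans (hlen α m)) t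
      (Eq.trans ht (hz α m : res _ _ = _).symm)
    have h2 : (f t').1 ∈ V := hn' _ ((le_max_right n n').trans (hlen β m)) t'
      (Eq.trans ht' (hz β m : res _ _ = _).symm)
    exact disjoint_left.1 hUV (htx ▸ h1) (htx' ▸ h2)
  have hsnd : Function.Injective fun α => (f (z α)).2 := by
    intro α β h
    by_contra hne
    let n := firstDiff α β
    have hn : α n ≠ β n := apply_firstDiff_ne hne
    have hnode : branchNode α n = branchNode β n :=
      branchNode_congr fun i hi => apply_eq_of_lt_firstDiff hi
    have hα : z α ∈ initialCylinder ((T (n + 1)).1 (branchNode α n, α n)) := hz α (n + 1)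
    have hβ : z β ∈ initialCylinder ((T (n + 1)).1 (branchNode β n, β n)) := hz β (n + 1)
    rw [← hnode] at hβ
    have hd := disjoint_left.1 (hTd n (branchNode α n))
    cases hαn : α n <;> cases hβn : β n <;> rw [hαn] at hα <;> rw [hβn] at hβ
    · simp [hαn, hβn] at hn
    · exact hd ⟨_, ⟨_, hα, rfl⟩, rfl⟩ ⟨_, ⟨_, hβ, rfl⟩, h.symm⟩
    · exact hd ⟨_, ⟨_, hβ, rfl⟩, rfl⟩ ⟨_, ⟨_, hα, rfl⟩, h⟩
    · simp [hαn, hβn] at hn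
  have hcount := hc (f (z fun _ => false)).1
  have : Countable {y | ((f (z fun _ => false)).1, y) ∈ range f} := hcount.to_subtype
  have : Countable (ℕ → Bool) := Function.Injective.countable
    (f := fun α => (⟨(f (z α)).2, z α, Prod.ext (hfst α _) rfl⟩ :
      {y | ((f (z fun _ => false)).1, y) ∈ range f}))
    fun α β h => hsnd (congrArg Subtype.val h)
  obtain ⟨e, he⟩ := exists_surjective_nat (ℕ → Bool)
  obtain ⟨n, hn⟩ := he fun n => !e n n
  exact Bool.not_ne_self _ (congrFun hn n).symm

end Polish

/-- A countable reflexive Borel relation is enumerated by countably many Borel functions. -/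
theorem exists_measurable_enumeration {X : Type*} [MeasurableSpace X] [StandardBorelSpace X]
    {r : X → X → Prop} (hr : MeasurableSet {p : X × X | r p.1 p.2})
    (hc : ∀ x, {y | r x y}.Countable) (hrefl : ∀ x, r x x) :
    ∃ g : ℕ → X → X, (∀ n, Measurable (g n)) ∧ ∀ x y, r x y ↔ ∃ n, g n x = y := by
  classical
  let := upgradeStandardBorel X
  obtain ⟨F, hFm, hFf, hF⟩ := hr.analyticSet.isGraphCoverable_of_countable hc
  let R : ℕ → Set (X × X) := fun n => F n ∩ {p | r p.1 p.2}
  have hRm : ∀ n, MeasurableSet (R n) := fun n => (hFm n).inter hr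
  have hRf : ∀ n, IsFunctional (R n) := fun n x y y' h h' => hFf n h.1 h'.1
  let g : ℕ → X → X := fun n x => if h : ∃ y, (x, y) ∈ R n then h.choose else x
  have hg : ∀ n x y, (x, y) ∈ R n → g n x = y := fun n x y h => by
    have hex : ∃ y, (x, y) ∈ R n := ⟨y, h⟩
    simp only [g, dif_pos hex]
    exact hRf n hex.choose_spec h
  have hdom : ∀ n (t : Set X), MeasurableSet t →
      MeasurableSet (Prod.fst '' (R n ∩ Prod.snd ⁻¹' t)) := fun n t ht => by
    refine ((hRm n).inter (ht.preimage measurable_snd)).image_of_measurable_injOn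
      measurable_fst ?_
    rintro ⟨x, y⟩ h ⟨x', y'⟩ h' (rfl : x = x')
    rw [hRf n h.1 h'.1]
  refine ⟨g, fun n t ht => ?_, fun x y => ⟨fun h => ?_, ?_⟩⟩
  · have : g n ⁻¹' t = Prod.fst '' (R n ∩ Prod.snd ⁻¹' t) ∪
        (t \ Prod.fst '' (R n ∩ Prod.snd ⁻¹' univ)) := by
      ext x
      by_cases h : ∃ y, (x, y) ∈ R n
      · obtain ⟨y, hy⟩ := h
        have hx : x ∈ Prod.fst '' (R n ∩ Prod.snd ⁻¹' univ) := ⟨(x, y), ⟨hy, trivial⟩, rfl⟩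
        simp only [mem_preimage, hg n x y hy, mem_union, mem_sdiff, hx, not_true_eq_false, and_false,
          or_false]
        refine ⟨fun h => ⟨(x, y), ⟨hy, h⟩, rfl⟩, ?_⟩
        rintro ⟨⟨x', y'⟩, ⟨hy', h⟩, rfl : x' = x⟩
        exact hRf n hy hy' ▸ h
      · have hx : ∀ t : Set X, x ∉ Prod.fst '' (R n ∩ Prod.snd ⁻¹' t) := by
          rintro t ⟨⟨x', y⟩, ⟨hy, -⟩, rfl⟩
          exact h ⟨y, hy⟩
        have hgx : g n x = x := dif_neg h
        simp only [mem_preimage, hgx, mem_union, mem_sdiff, hx, not_false_eq_true, and_true,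
          false_or]
    rw [this]
    exact (hdom n t ht).union (ht.diff (hdom n univ .univ))
  · obtain ⟨n, hn⟩ := mem_iUnion.1 (hF (show (x, y) ∈ {p : X × X | r p.1 p.2} from h))
    exact ⟨n, hg n x y ⟨hn, h⟩⟩
  · rintro ⟨n, rfl⟩
    by_cases h : ∃ y, (x, y) ∈ R n
    · obtain ⟨y, hy⟩ := h
      rw [hg n x y hy]
      exact hy.2
    · simp only [g, dif_neg h]
      exact hrefl x

end LusinNovikov

section Partition

open Set MeasureTheory

variable {X ι : Type*} {E : ι → X → X → Prop}

/-- The cycle in the definition of non-independence can be chosen with all cyclically consecutive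
indices distinct. -/
lemma NonIndependentAt.exists_cycle {z : X} (hE : ∀ i, Equivalence (E i))
    (h : NonIndependentAt E z) :
    ∃ (m : ℕ) (t : Fin (m + 1) → X) (idx : Fin (m + 1) → ι), Function.Injective t ∧
      (∀ a, Relation.EqvGen (fun a b => ∃ i, E i a b) z (t a)) ∧
      (∀ a, E (idx a) (t a) (t (a + 1))) ∧ ∀ a, idx a ≠ idx (a + 1) := by
  obtain ⟨n, hn, x, idx, hx, hz, hne, hstep, hlast⟩ := h
  by_cases h0 : idx (Fin.last n) = idx 0
  · obtain ⟨m, rfl⟩ : ∃ m, n = m + 1 := ⟨n - 1, by omega⟩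
    refine ⟨m, fun a => x a.succ, fun a => idx a.succ, fun a b hab => Fin.succ_injective _ (hx hab),
      fun a => hz _, fun a => ?_, fun a => ?_⟩
    · induction a using Fin.lastCases with
      | last =>
        have h01 := hstep 0
        rw [Fin.castSucc_zero, ← h0] at h01
        rw [Fin.last_add_one]
        dsimp only
        rw [Fin.succ_last]
        exact (hE _).trans hlast h01
      | cast j =>
        rw [Fin.coeSucc_eq_succ]
        dsimp only
        rw [Fin.succ_castSucc]
        exact hstep j.succ
    · induction a using Fin.lastCases with
      | last =>
        have h01 := hne 0
        rw [Fin.castSucc_zero, ← h0] at h01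
        rw [Fin.last_add_one]
        dsimp only
        rwa [Fin.succ_last]
      | cast j =>
        rw [Fin.coeSucc_eq_succ]
        dsimp only
        rw [Fin.succ_castSucc]
        exact hne j.succ
  · refine ⟨n, x, idx, hx, hz, fun a => ?_, fun a => ?_⟩
    · induction a using Fin.lastCases with
      | last => rwa [Fin.last_add_one]
      | cast j => rw [Fin.coeSucc_eq_succ]; exact hstep j
    · induction a using Fin.lastCases with
      | last => rwa [Fin.last_add_one]
      | cast j => rw [Fin.coeSucc_eq_succ]; exact hne j

/-- The composition of the functions `g i k` along a word. -/
def wordMap (g : ι → ℕ → X → X) : List (ι × ℕ) → X → X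
  | [], x => x
  | p :: w, x => wordMap g w (g p.1 p.2 x)

lemma wordMap_append (g : ι → ℕ → X → X) (v w : List (ι × ℕ)) (x : X) :
    wordMap g (v ++ w) x = wordMap g w (wordMap g v x) := by
  induction v generalizing x with
  | nil => rfl
  | cons p v ih => exact ih _

lemma measurable_wordMap [MeasurableSpace X] {g : ι → ℕ → X → X}
    (hg : ∀ i k, Measurable (g i k)) : ∀ w, Measurable (wordMap g w)
  | [] => measurable_id
  | p :: w => (measurable_wordMap hg w).comp (hg p.1 p.2)

lemma eqvGen_iff_exists_wordMap (hE : ∀ i, Equivalence (E i)) {g : ι → ℕ → X → X}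
    (hg : ∀ i x y, E i x y ↔ ∃ k, g i k x = y) {x y : X} :
    Relation.EqvGen (fun a b => ∃ i, E i a b) x y ↔ ∃ w, wordMap g w x = y := by
  have hsymm : ∀ w x, ∃ v, wordMap g v (wordMap g w x) = x := by
    intro w
    induction w with
    | nil => exact fun x => ⟨[], rfl⟩
    | cons p w ih =>
      intro x
      obtain ⟨v, hv⟩ := ih (g p.1 p.2 x)
      obtain ⟨k, hk⟩ := (hg p.1 _ _).1 ((hE p.1).symm ((hg p.1 x _).2 ⟨p.2, rfl⟩))
      refine ⟨v ++ [(p.1, k)], ?_⟩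
      rw [wordMap_append]
      simpa [wordMap, hv] using hk
  constructor
  · intro h
    induction h with
    | rel x y h =>
      obtain ⟨i, hi⟩ := h
      obtain ⟨k, hk⟩ := (hg i x y).1 hi
      exact ⟨[(i, k)], hk⟩
    | refl x => exact ⟨[], rfl⟩
    | symm x y _ ih =>
      obtain ⟨w, rfl⟩ := ih
      exact hsymm w x
    | trans x y z _ _ ih₁ ih₂ =>
      obtain ⟨v, rfl⟩ := ih₁
      obtain ⟨w, rfl⟩ := ih₂
      exact ⟨v ++ w, wordMap_append g v w x⟩
  · rintro ⟨w, rfl⟩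
    induction w generalizing x with
    | nil => exact .refl _
    | cons p w ih => exact .trans _ _ _ (.rel _ _ ⟨p.1, (hg _ _ _).2 ⟨p.2, rfl⟩⟩) ih

/-- A partial Borel colouring, defined on a set meeting every class of the join and such that every
class meeting its domain has a point of the domain of the wrong colour, extends to a partition. -/
lemma exists_partition_of_partial [MeasurableSpace X] [Countable ι] [Nonempty ι]
    (hE : ∀ i, Equivalence (E i)) {g : ι → ℕ → X → X} (hgm : ∀ i k, Measurable (g i k))
    (hg : ∀ i x y, E i x y ↔ ∃ k, g i k x = y) {P : ι → Set X}
    (hPm : ∀ i, MeasurableSet (P i)) (hPd : Pairwise fun i j => Disjoint (P i) (P j))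
    (hP : ∀ i, ∀ x ∈ ⋃ j, P j, ∃ y ∈ ⋃ j, P j, E i x y ∧ y ∉ P i)
    (hreach : ∀ x, ∃ w, wordMap g w x ∈ ⋃ j, P j) :
    ∃ A : ι → Set X, (∀ i, MeasurableSet (A i)) ∧ Pairwise (fun i j => Disjoint (A i) (A j)) ∧
      (⋃ i, A i) = univ ∧ ∀ i x, ∃ y, E i x y ∧ y ∉ A i := by
  obtain ⟨Z, hZ0, hZs'⟩ : ∃ Z : ℕ → Set X, Z 0 = ⋃ j, P j ∧
      ∀ n, Z (n + 1) = ⋃ (i) (k), g i k ⁻¹' Z n :=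
    ⟨fun n => Nat.rec (⋃ j, P j) (fun _ S => ⋃ (i) (k), g i k ⁻¹' S) n, rfl, fun _ => rfl⟩
  have hZs : ∀ n x, x ∈ Z (n + 1) ↔ ∃ i k, g i k x ∈ Z n := fun n x => by simp [hZs']
  have hZm : ∀ n, MeasurableSet (Z n) := by
    intro n
    induction n with
    | zero => exact hZ0 ▸ .iUnion hPm
    | succ n ih => exact hZs' n ▸ .iUnion fun i => .iUnion fun k => hgm i k ih
  have hmono : Monotone Z := monotone_nat_of_le_succ fun n x hx => by
    obtain ⟨i⟩ := ‹Nonempty ι›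
    obtain ⟨k, hk⟩ := (hg i x x).1 ((hE i).refl x)
    exact (hZs n x).2 ⟨i, k, by rwa [hk]⟩
  have hlevel : ∀ {n m x}, x ∈ Z (n + 1) → x ∉ Z n → x ∈ Z (m + 1) → x ∉ Z m → n = m := by
    intro n m x h1 h2 h3 h4
    by_contra hne
    rcases Nat.lt_or_gt_of_ne hne with h | h
    · exact h4 (hmono h h1)
    · exact h2 (hmono h h3)
  have hZu : ∀ x, ∃ n, x ∈ Z n := by
    intro x
    obtain ⟨w, hw⟩ := hreach x
    refine ⟨w.length, ?_⟩
    induction w generalizing x with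
    | nil => exact hZ0 ▸ hw
    | cons p w ih => exact (hZs _ _).2 ⟨p.1, p.2, ih _ hw⟩
  obtain ⟨enc, henc⟩ := exists_injective_nat ι
  let T : ℕ → ι → Set X := fun n i => ⋃ k, g i k ⁻¹' Z n
  have hT : ∀ n i x, x ∈ T n i ↔ ∃ k, g i k x ∈ Z n := fun n i x => by simp [T]
  have hTm : ∀ n i, MeasurableSet (T n i) := fun n i => .iUnion fun k => hgm i k (hZm n)
  let R : ℕ → ι → Set X := fun n i =>
    ((Z n)ᶜ ∩ T n i) ∩ ⋂ (j) (_ : enc j < enc i), (T n j)ᶜ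
  have hRZ : ∀ {n i x}, x ∈ R n i → x ∉ Z n ∧ x ∈ Z (n + 1) := fun {n i x} hx =>
    ⟨hx.1.1, (hZs n x).2 ⟨i, (hT n i x).1 hx.1.2⟩⟩
  have hPR : ∀ {n i x}, x ∈ ⋃ j, P j → x ∉ R n i := fun hx hR =>
    (hRZ hR).1 (hmono (Nat.zero_le _) (hZ0 ▸ hx))
  have hRd : ∀ {n i j x}, x ∈ R n i → x ∈ R n j → enc i ≤ enc j := by
    intro n i j x hi hj
    by_contra! hlt
    have := hi.2
    simp only [mem_iInter] at this
    exact this j hlt hj.1.2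
  refine ⟨fun i => P i ∪ ⋃ n, R n i, fun i => ?_, fun i j hij => ?_, ?_, ?_⟩
  · exact (hPm i).union (.iUnion fun n => ((hZm n).compl.inter (hTm n i)).inter
      (.iInter fun j => .iInter fun _ => (hTm n j).compl))
  · refine disjoint_left.2 ?_
    rintro x (hi | hi) (hj | hj)
    · exact disjoint_left.1 (hPd hij) hi hj
    · obtain ⟨n, hn⟩ := mem_iUnion.1 hj
      exact hPR (mem_iUnion.2 ⟨i, hi⟩) hn
    · obtain ⟨n, hn⟩ := mem_iUnion.1 hi
      exact hPR (mem_iUnion.2 ⟨j, hj⟩) hn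
    · obtain ⟨n, hn⟩ := mem_iUnion.1 hi
      obtain ⟨m, hm⟩ := mem_iUnion.1 hj
      obtain rfl := hlevel (hRZ hn).2 (hRZ hn).1 (hRZ hm).2 (hRZ hm).1
      exact hij (henc (le_antisymm (hRd hn hm) (hRd hm hn)))
  · refine eq_univ_of_forall fun x => ?_
    obtain ⟨n, hn⟩ := hZu x
    induction n with
    | zero =>
      obtain ⟨i, hi⟩ := mem_iUnion.1 (hZ0 ▸ hn)
      exact mem_iUnion.2 ⟨i, .inl hi⟩
    | succ n ih =>
      by_cases hx : x ∈ Z n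
      · exact ih hx
      obtain ⟨i, hi, himin⟩ := (InvImage.wf enc wellFounded_lt).has_min {i | x ∈ T n i} (by
        obtain ⟨i, hi⟩ := (hZs n x).1 hn
        exact ⟨i, (hT n i x).2 hi⟩)
      refine mem_iUnion.2 ⟨i, .inr (mem_iUnion.2 ⟨n, ⟨hx, hi⟩, ?_⟩)⟩
      simp only [mem_iInter]
      exact fun j hj hjT => himin j hjT hj
  · intro i x
    obtain ⟨n, hn⟩ := hZu x
    induction n generalizing x with
    | zero =>
      obtain ⟨y, hy, hxy, hyi⟩ := hP i x (hZ0 ▸ hn)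
      refine ⟨y, hxy, ?_⟩
      rintro (h | h)
      · exact hyi h
      · obtain ⟨m, hm⟩ := mem_iUnion.1 h
        exact hPR hy hm
    | succ n ih =>
      by_cases hx : x ∈ Z n
      · exact ih x hx
      by_cases hxT : x ∈ T n i
      · obtain ⟨k, hk⟩ := (hT n i x).1 hxT
        obtain ⟨y, hy, hyA⟩ := ih _ hk
        exact ⟨y, (hE i).trans ((hg i x _).2 ⟨k, rfl⟩) hy, hyA⟩
      · refine ⟨x, (hE i).refl x, ?_⟩
        rintro (h | h)
        · exact hx (hmono (Nat.zero_le n) (hZ0 ▸ mem_iUnion.2 ⟨i, h⟩))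
        · obtain ⟨m, hm⟩ := mem_iUnion.1 h
          obtain rfl := hlevel hn hx (hRZ hm).2 (hRZ hm).1
          exact hxT hm.1.2

/-- Combinatorial data of a labelled cycle: words moving each point to each other one, sets
separating the points, and the labels of the points. -/
abbrev CyclePattern (ι W : Type*) {X : Type*} (b : Set (Set X)) : Type _ :=
  Σ m : ℕ, (Fin (m + 1) → Fin (m + 1) → W × b) × (Fin (m + 1) → ι)

namespace CyclePattern

variable {W : Type*} {b : Set (Set X)}

/-- The tuple `t` is a cycle for `E` with the given pattern. -/
def Realizes (E : ι → X → X → Prop) (h : W → X → X) (κ : CyclePattern ι W b)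
    (t : Fin (κ.1 + 1) → X) : Prop :=
  (∀ a c, h (κ.2.1 a c).1 (t a) = t c) ∧
  (∀ a c, a ≠ c → t a ∈ (κ.2.1 a c).2.1 ∧ t c ∉ (κ.2.1 a c).2.1) ∧
  (∀ a, E (κ.2.2 a) (t a) (t (a + 1))) ∧ ∀ a, κ.2.2 a ≠ κ.2.2 (a + 1)

/-- The tuple with the given pattern whose entry in position `a` is supposed to be `y`. -/
def tupleAt (h : W → X → X) (κ : CyclePattern ι W b) (a : Fin (κ.1 + 1)) (y : X) :
    Fin (κ.1 + 1) → X :=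
  fun c => h (κ.2.1 a c).1 y

/-- The points occurring in position `a` of a cycle with the given pattern. -/
def position (E : ι → X → X → Prop) (h : W → X → X) (κ : CyclePattern ι W b)
    (a : Fin (κ.1 + 1)) : Set X :=
  {y | κ.Realizes E h (κ.tupleAt h a y) ∧ κ.tupleAt h a y a = y}

variable {h : W → X → X} {κ : CyclePattern ι W b}

lemma Realizes.tupleAt_eq {t : Fin (κ.1 + 1) → X} (ht : κ.Realizes E h t) (a : Fin (κ.1 + 1)) :
    κ.tupleAt h a (t a) = t :=
  funext fun c => ht.1 a c

lemma Realizes.mem_position {t : Fin (κ.1 + 1) → X} (ht : κ.Realizes E h t)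
    (a : Fin (κ.1 + 1)) : t a ∈ κ.position E h a := by
  simp only [position, mem_ofPred_eq, ht.tupleAt_eq a, and_true]
  exact ht

lemma eq_of_mem_position {a c : Fin (κ.1 + 1)} {y : X} (ha : y ∈ κ.position E h a)
    (hc : y ∈ κ.position E h c) : a = c := by
  by_contra hne
  have h1 := (ha.1.2.1 a c hne).1
  have h2 := (hc.1.2.1 a c hne).2
  rw [ha.2] at h1
  rw [hc.2] at h2
  exact h2 h1

/-- The points with label `i` in a cycle with the given pattern. -/
def labelled (E : ι → X → X → Prop) (h : W → X → X) (κ : CyclePattern ι W b) (i : ι) : Set X :=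
  ⋃ (a) (_ : κ.2.2 a = i), κ.position E h a

lemma mem_labelled {i : ι} {y : X} :
    y ∈ κ.labelled E h i ↔ ∃ a, κ.2.2 a = i ∧ y ∈ κ.position E h a := by
  simp [labelled]

lemma eq_of_mem_labelled {i j : ι} {y : X} (hi : y ∈ κ.labelled E h i)
    (hj : y ∈ κ.labelled E h j) : i = j := by
  obtain ⟨a, rfl, ha⟩ := mem_labelled.1 hi
  obtain ⟨c, rfl, hc⟩ := mem_labelled.1 hj
  rw [eq_of_mem_position ha hc]

lemma exists_related_notMem_labelled (hE : ∀ i, Equivalence (E i)) (i : ι) {x : X}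
    (hx : x ∈ ⋃ j, κ.labelled E h j) :
    ∃ y ∈ ⋃ j, κ.labelled E h j, E i x y ∧ y ∉ κ.labelled E h i := by
  obtain ⟨j, hj⟩ := mem_iUnion.1 hx
  by_cases hij : i = j
  · subst hij
    obtain ⟨a, rfl, ha⟩ := mem_labelled.1 hj
    have hy : κ.tupleAt h a x (a + 1) ∈ κ.labelled E h (κ.2.2 (a + 1)) :=
      mem_labelled.2 ⟨a + 1, rfl, ha.1.mem_position (a + 1)⟩
    refine ⟨_, mem_iUnion.2 ⟨_, hy⟩, ?_, fun h' => ha.1.2.2.2 a (eq_of_mem_labelled h' hy)⟩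
    have hstep := ha.1.2.2.1 a
    rwa [ha.2] at hstep
  · exact ⟨x, hx, (hE i).refl x, fun h' => hij (eq_of_mem_labelled h' hj)⟩

lemma measurableSet_labelled [MeasurableSpace X] [MeasurableEq X]
    (hEm : ∀ i, MeasurableSet {p : X × X | E i p.1 p.2}) (hh : ∀ w, Measurable (h w))
    (hb : ∀ U ∈ b, MeasurableSet U) (i : ι) : MeasurableSet (κ.labelled E h i) := by
  refine .iUnion fun a => .iUnion fun _ => ?_
  have ht : ∀ c, Measurable fun y => κ.tupleAt h a y c := fun c => hh _
  have hpos : κ.position E h a =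
      ((⋂ (c) (d), {y | h (κ.2.1 c d).1 (κ.tupleAt h a y c) = κ.tupleAt h a y d}) ∩
        (⋂ (c) (d) (_ : c ≠ d), {y | κ.tupleAt h a y c ∈ (κ.2.1 c d).2.1} ∩
          {y | κ.tupleAt h a y d ∈ (κ.2.1 c d).2.1}ᶜ) ∩
        (⋂ c, {y | E (κ.2.2 c) (κ.tupleAt h a y c) (κ.tupleAt h a y (c + 1))}) ∩
        (⋂ c, {_y | κ.2.2 c ≠ κ.2.2 (c + 1)})) ∩ {y | κ.tupleAt h a y a = y} := by
    ext y
    simp only [position, Realizes, mem_ofPred_eq, mem_inter_iff, mem_iInter, mem_compl_iff,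
      and_assoc]
  rw [hpos]
  refine ((((MeasurableSet.iInter fun c => .iInter fun d => ?_).inter
    (.iInter fun c => .iInter fun d => .iInter fun _ => ?_)).inter (.iInter fun c => ?_)).inter
    (.iInter fun c => .const _)).inter ?_
  · exact measurableSet_eq_fun ((hh _).comp (ht c)) (ht d)
  · exact (ht c (hb _ (κ.2.1 c d).2.2)).inter (ht d (hb _ (κ.2.1 c d).2.2)).compl
  · exact (hEm _).preimage ((ht c).prodMk (ht (c + 1)))
  · exact measurableSet_eq_fun (ht a) measurable_id

end CyclePattern

/-- In every class of the join one can choose, in a Borel way, labelled pairwise disjoint cycles. -/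
lemma exists_partial_of_nonIndependent [MeasurableSpace X] [StandardBorelSpace X] [Countable ι]
    (hE : ∀ i, Equivalence (E i)) (hEm : ∀ i, MeasurableSet {p : X × X | E i p.1 p.2})
    (hN : ∀ z, NonIndependentAt E z) {g : ι → ℕ → X → X} (hgm : ∀ i k, Measurable (g i k))
    (hg : ∀ i x y, E i x y ↔ ∃ k, g i k x = y) :
    ∃ P : ι → Set X, (∀ i, MeasurableSet (P i)) ∧ Pairwise (fun i j => Disjoint (P i) (P j)) ∧
      (∀ i, ∀ x ∈ ⋃ j, P j, ∃ y ∈ ⋃ j, P j, E i x y ∧ y ∉ P i) ∧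
      ∀ x, ∃ w, wordMap g w x ∈ ⋃ j, P j := by
  let := upgradeStandardBorel X
  let b := TopologicalSpace.countableBasis X
  have hb := TopologicalSpace.isBasis_countableBasis X
  have : Countable b := (TopologicalSpace.countable_countableBasis X).to_subtype
  let h := wordMap g
  have hh : ∀ w, Measurable (h w) := measurable_wordMap hgm
  have hrel {x y : X} := eqvGen_iff_exists_wordMap hE hg (x := x) (y := y)
  let K := CyclePattern ι (List (ι × ℕ)) b
  let Q : K → ι → Set X := fun κ i => κ.labelled E h i
  have hQm : ∀ κ i, MeasurableSet (Q κ i) := fun κ i =>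
    CyclePattern.measurableSet_labelled hEm hh (fun U hU => (hb.isOpen hU).measurableSet) i
  let M : K → Set X := fun κ => ⋃ w, h w ⁻¹' ⋃ i, Q κ i
  have hMm : ∀ κ, MeasurableSet (M κ) := fun κ => .iUnion fun w => hh w (.iUnion (hQm κ))
  have hM : ∀ {κ x y}, Relation.EqvGen (fun a b => ∃ i, E i a b) x y → y ∈ M κ → x ∈ M κ := by
    intro κ x y hxy hy
    obtain ⟨w, hw⟩ := mem_iUnion.1 hy
    obtain ⟨v, hv⟩ := hrel.1 (hxy.trans _ _ _ (hrel.2 ⟨w, rfl⟩))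
    exact mem_iUnion.2 ⟨v, by simpa only [h, mem_preimage, hv] using hw⟩
  have hMu : ∀ z, ∃ κ, z ∈ M κ := by
    intro z
    obtain ⟨m, t, idx, ht, hz, hstep, hne⟩ := (hN z).exists_cycle hE
    have hw : ∀ a c, ∃ w, h w (t a) = t c := fun a c =>
      hrel.1 (((hz a).symm _ _).trans _ _ _ (hz c))
    have hs : ∀ a c, ∃ U : b, a ≠ c → t a ∈ U.1 ∧ t c ∉ U.1 := by
      intro a c
      by_cases hac : a = c
      · obtain ⟨U, hU, -⟩ := hb.exists_subset_of_mem_open (mem_univ (t a)) isOpen_univ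
        exact ⟨⟨U, hU⟩, fun h => (h hac).elim⟩
      · obtain ⟨U, hU, haU, hUs⟩ := hb.exists_subset_of_mem_open
          (show t a ∈ ({t c}ᶜ : Set X) from fun h => hac (ht h)) isOpen_compl_singleton
        exact ⟨⟨U, hU⟩, fun _ => ⟨haU, fun hc => hUs hc rfl⟩⟩
    choose w hw using hw
    choose U hU using hs
    let κ : K := ⟨m, fun a c => (w a c, U a c), idx⟩
    have hκ : κ.Realizes E h t := ⟨hw, hU, hstep, hne⟩
    obtain ⟨v, hv⟩ := hrel.1 (hz 0)
    refine ⟨κ, mem_iUnion.2 ⟨v, mem_iUnion.2 ⟨idx 0, CyclePattern.mem_labelled.2 ⟨0, rfl, ?_⟩⟩⟩⟩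
    change wordMap g v z ∈ _
    rw [hv]
    exact hκ.mem_position 0
  obtain ⟨enc, henc⟩ := exists_injective_nat K
  let L : K → Set X := fun κ => M κ ∩ ⋂ (κ') (_ : enc κ' < enc κ), (M κ')ᶜ
  have hLm : ∀ κ, MeasurableSet (L κ) := fun κ =>
    (hMm κ).inter (.iInter fun κ' => .iInter fun _ => (hMm κ').compl)
  have hLmin : ∀ {κ κ' x}, x ∈ L κ → x ∈ M κ' → enc κ ≤ enc κ' := by
    intro κ κ' x hx hx'
    by_contra! hlt
    have := hx.2
    simp only [mem_iInter] at this
    exact this κ' hlt hx'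
  have hL : ∀ {κ x y}, Relation.EqvGen (fun a b => ∃ i, E i a b) x y → x ∈ L κ → y ∈ L κ := by
    intro κ x y hxy hx
    refine ⟨hM (hxy.symm _ _) hx.1, ?_⟩
    simp only [mem_iInter]
    exact fun κ' hlt hy => hlt.not_ge (hLmin hx (hM hxy hy))
  have hLu : ∀ {κ κ' x}, x ∈ L κ → x ∈ L κ' → κ = κ' := fun hx hx' =>
    henc (le_antisymm (hLmin hx hx'.1) (hLmin hx' hx.1))
  have hP : ∀ {i x}, x ∈ ⋃ κ, Q κ i ∩ L κ ↔ ∃ κ, x ∈ Q κ i ∧ x ∈ L κ := by simp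
  refine ⟨fun i => ⋃ κ, Q κ i ∩ L κ, fun i => .iUnion fun κ => (hQm κ i).inter (hLm κ),
    fun i j hij => ?_, fun i x hx => ?_, fun x => ?_⟩
  · refine disjoint_left.2 fun x => ?_
    intro hi hj
    obtain ⟨κ, hκ, hκL⟩ := hP.1 hi
    obtain ⟨κ', hκ', hκL'⟩ := hP.1 hj
    obtain rfl := hLu hκL hκL'
    exact hij (CyclePattern.eq_of_mem_labelled hκ hκ')
  · obtain ⟨j, hj⟩ := mem_iUnion.1 hx
    obtain ⟨κ, hκ, hκL⟩ := hP.1 hj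
    obtain ⟨y, hy, hxy, hyi⟩ := CyclePattern.exists_related_notMem_labelled hE i
      (mem_iUnion.2 ⟨j, hκ⟩)
    obtain ⟨l, hl⟩ := mem_iUnion.1 hy
    have hyL : y ∈ L κ := hL (.rel _ _ ⟨i, hxy⟩) hκL
    refine ⟨y, mem_iUnion.2 ⟨l, hP.2 ⟨κ, hl, hyL⟩⟩, hxy, fun hyP => ?_⟩
    obtain ⟨κ', hκ', hκL'⟩ := hP.1 hyP
    obtain rfl := hLu hyL hκL'
    exact hyi hκ'
  · obtain ⟨κ, hκ, hmin⟩ := (InvImage.wf enc wellFounded_lt).has_min {κ | x ∈ M κ} (hMu x)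
    have hxL : x ∈ L κ := ⟨hκ, by
      simp only [mem_iInter]
      exact fun κ' hlt hx => hmin κ' hx hlt⟩
    obtain ⟨w, hw⟩ := mem_iUnion.1 hκ
    obtain ⟨i, hi⟩ := mem_iUnion.1 hw
    exact ⟨w, mem_iUnion.2 ⟨i, hP.2 ⟨κ, hi, hL (hrel.2 ⟨w, rfl⟩) hxL⟩⟩⟩

end Partition

/-- If `{E_i}` is a finite or countable family of countable Borel equivalence relations on
a standard Borel space `X` that are everywhere non-independent, then there is a Borel
partition `{A_i}` of `X` such that the complement of each `A_i` meets every `E_i`-class. -/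
theorem stmt_1 (X : Type) [MeasurableSpace X] [StandardBorelSpace X]
    (ι : Type) [Countable ι] [Nonempty ι]
    (E : ι → X → X → Prop)
    (hEquiv : ∀ i, Equivalence (E i))
    (hBorel : ∀ i, MeasurableSet {p : X × X | E i p.1 p.2})
    (hCtble : ∀ i x, {y | E i x y}.Countable)
    (hNonInd : ∀ z : X, NonIndependentAt E z) :
    ∃ A : ι → Set X,
      (∀ i, MeasurableSet (A i)) ∧
      Pairwise (fun i j => Disjoint (A i) (A j)) ∧
      (⋃ i, A i) = Set.univ ∧
      ∀ i x, ∃ y, E i x y ∧ y ∉ A i := by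
  choose g hgm hg using fun i =>
    exists_measurable_enumeration (hBorel i) (hCtble i) (hEquiv i).refl
  obtain ⟨P, hPm, hPd, hP, hreach⟩ :=
    exists_partial_of_nonIndependent hEquiv hBorel hNonInd hgm hg
  exact exists_partition_of_partial hEquiv hgm hg hPm hPd hP hreach
end

section
/- If Γ and Δ are finitely generated marked groups, then χ_B(G(Γ*Δ, ℕ)) ≥ χ_B(G(Γ, ℕ)) + χ_B(G(Δ, ℕ)) − 1. -/
/-- The left shift action of a group `G` on the product space `G → X`:
`(γ • y) β = y (γ⁻¹ * β)`. -/
def shift {G : Type*} [Group G] {X : Type*} (γ : G) (y : G → X) : G → X :=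
  fun β => y (γ⁻¹ * β)

/-- The free part `Free(X^G)` of the left shift action of `G` on `G → X`. -/
def freePart (G : Type*) [Group G] (X : Type*) : Set (G → X) :=
  {y | ∀ γ : G, γ ≠ 1 → shift γ y ≠ y}

/-- The Borel chromatic number of a (graph given by a) relation `G` on a measurable
space `X`: the least cardinality of a standard Borel space `Y` admitting a Borel
(measurable) coloring `c : X → Y` with `c x ≠ c y` whenever `G x y`. -/
noncomputable def borelChromaticNumber {X : Type} [mX : MeasurableSpace X]
    (G : X → X → Prop) : Cardinal :=
  sInf {κ : Cardinal | ∃ (Y : Type) (mY : MeasurableSpace Y),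
    @StandardBorelSpace Y mY ∧ Cardinal.mk Y = κ ∧
    ∃ c : X → Y, @Measurable X Y mX mY c ∧ ∀ x y, G x y → c x ≠ c y}

/-- The adjacency relation of the graph `G(Γ, X)` on the free part `Free(X^Γ)` determined
by a set `S` of generators of `Γ`: `x` and `y` are adjacent iff some `γ ∈ S` shifts `x`
to `y` or `y` to `x`. -/
def cayleyAdj {Γ : Type} [Group Γ] (S : Set Γ) (X : Type) :
    ↥(freePart Γ X) → ↥(freePart Γ X) → Prop :=
  fun x y => ∃ γ ∈ S,
    shift γ (x : Γ → X) = (y : Γ → X) ∨ shift γ (y : Γ → X) = (x : Γ → X)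

namespace GaleStewart

/-- A tree of finite positions, graded by length, in which every position has a successor. -/
structure GTree where
  Pos : Type
  len : Pos → ℕ
  pred : Pos → Pos
  len_pred : ∀ s, len (pred s) = len s - 1
  exists_child : ∀ s, ∃ t, pred t = s ∧ len t = len s + 1

namespace GTree

variable (T : GTree)

/-- `t` is reached from `s` by one move. -/
def IsChild (s t : T.Pos) : Prop := T.pred t = s ∧ T.len t = T.len s + 1

/-- The initial segment of length `m` of a position. -/
def res (m : ℕ) (s : T.Pos) : T.Pos := T.pred^[T.len s - m] s

/-- The infinite plays. -/
def Play : Type := {x : ℕ → T.Pos // ∀ n, T.len (x n) = n ∧ T.pred (x (n + 1)) = x n}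

/-- A choice of a move at every position. -/
def Strat : Type := {f : T.Pos → T.Pos // ∀ s, T.IsChild s (f s)}

variable {T}

instance : CoeFun T.Play (fun _ => ℕ → T.Pos) := ⟨Subtype.val⟩
instance : CoeFun T.Strat (fun _ => T.Pos → T.Pos) := ⟨Subtype.val⟩

noncomputable instance : Inhabited T.Strat :=
  ⟨⟨fun s => (T.exists_child s).choose, fun s => (T.exists_child s).choose_spec⟩⟩

lemma len_iterate_pred (j : ℕ) (s : T.Pos) : T.len (T.pred^[j] s) = T.len s - j := by
  induction j generalizing s with
  | zero => simp
  | succ j ih => rw [Function.iterate_succ_apply, ih, T.len_pred]; omega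

lemma len_res (m : ℕ) (s : T.Pos) : T.len (T.res m s) = min m (T.len s) := by
  unfold res; rw [len_iterate_pred]; omega

lemma res_of_le {m : ℕ} {s : T.Pos} (h : T.len s ≤ m) : T.res m s = s := by
  unfold res; rw [Nat.sub_eq_zero_of_le h]; rfl

lemma res_pred {m : ℕ} {s : T.Pos} (h : m < T.len s) : T.res m (T.pred s) = T.res m s := by
  unfold res
  rw [T.len_pred, ← Function.iterate_succ_apply]
  congr 1; omega

lemma IsChild.res {m : ℕ} {s t : T.Pos} (h : T.IsChild s t) (hm : m ≤ T.len s) :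
    T.res m t = T.res m s := by
  rw [← h.1, res_pred (by have := h.2; omega)]

lemma res_res {m n : ℕ} (h : m ≤ n) (s : T.Pos) : T.res m (T.res n s) = T.res m s := by
  rcases le_total (T.len s) n with h' | h'
  · rw [res_of_le h']
  · unfold GTree.res
    rw [len_iterate_pred, ← Function.iterate_add_apply]
    congr 1; omega

lemma pred_eq_res (s : T.Pos) (h : 0 < T.len s) : T.pred s = T.res (T.len s - 1) s := by
  unfold GTree.res
  rw [show T.len s - (T.len s - 1) = 1 by omega]; rfl

namespace Play

variable (x : T.Play)

@[simp] lemma len (n : ℕ) : T.len (x n) = n := (x.2 n).1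

lemma pred (n : ℕ) : T.pred (x (n + 1)) = x n := (x.2 n).2

lemma isChild (n : ℕ) : T.IsChild (x n) (x (n + 1)) := ⟨x.pred n, by simp⟩

lemma res {m n : ℕ} (h : m ≤ n) : T.res m (x n) = x m := by
  induction n, h using Nat.le_induction with
  | base => exact res_of_le (by simp)
  | succ n h ih => rw [← ih, (x.isChild n).res (by simpa using h)]

end Play

end GTree

/-- Whether the given player moves at positions of length `n`: the player `false` moves first. -/
def Turn (ε : Bool) (n : ℕ) : Prop := n % 2 = 1 ↔ ε = true

lemma turn_not {ε : Bool} {n : ℕ} : Turn (!ε) n ↔ ¬ Turn ε n := by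
  cases ε <;> simp [Turn]

namespace GTree

variable {T : GTree}

/-- `x` is played by `ε` according to `τ` from length `n` on. -/
def FollowsFrom (n : ℕ) (ε : Bool) (τ : T.Strat) (x : T.Play) : Prop :=
  ∀ m, n ≤ m → Turn ε m → x (m + 1) = τ (x m)

/-- The player `ε` can force the play to reach `U` from `s` on. -/
def Win (ε : Bool) (U : Set T.Pos) (s : T.Pos) : Prop :=
  ∃ τ : T.Strat, ∀ x : T.Play, x (T.len s) = s → FollowsFrom (T.len s) ε τ x →
    ∃ m, T.len s ≤ m ∧ x m ∈ U

lemma win_of_mem {ε : Bool} {U : Set T.Pos} {s : T.Pos} (h : s ∈ U) : Win ε U s :=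
  ⟨default, fun x hx _ => ⟨T.len s, le_rfl, by rwa [hx]⟩⟩

lemma win_of_child {ε : Bool} {U : Set T.Pos} {s t : T.Pos} (h : Turn ε (T.len s))
    (hst : T.IsChild s t) (ht : Win ε U t) : Win ε U s := by
  classical
  obtain ⟨τ, hτ⟩ := ht
  refine ⟨⟨fun p => if p = s then t else τ p, fun p => ?_⟩, fun x hx hf => ?_⟩
  · dsimp only
    split_ifs with hp
    · rwa [hp]
    · exact τ.2 p
  · have h1 : x (T.len s + 1) = t := by
      have := hf _ le_rfl h
      simpa [hx] using this
    obtain ⟨m, hm, hU⟩ := hτ x (by rw [hst.2, h1]) (fun m hm ht => by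
      have h2 := hst.2
      have := hf m (by omega) ht
      have hne : x m ≠ s := fun h' => by
        have := congrArg T.len h'
        rw [x.len] at this; omega
      simpa [hne] using this)
    exact ⟨m, by have := hst.2; omega, hU⟩

open Classical in
/-- A strategy witnessing `Win`. -/
noncomputable def winStrat (ε : Bool) (U : Set T.Pos) (s : T.Pos) : T.Strat :=
  if h : Win ε U s then h.choose else default

lemma winStrat_spec {ε : Bool} {U : Set T.Pos} {s : T.Pos} (h : Win ε U s) (x : T.Play)
    (hx : x (T.len s) = s) (hf : FollowsFrom (T.len s) ε (winStrat ε U s) x) :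
    ∃ m, T.len s ≤ m ∧ x m ∈ U := by
  unfold winStrat at hf
  rw [dif_pos h] at hf
  exact h.choose_spec x hx hf

lemma win_of_forall_child {ε : Bool} {U : Set T.Pos} {s : T.Pos}
    (hs : ∀ t, T.IsChild s t → Win ε U t) : Win ε U s := by
  refine ⟨⟨fun p => winStrat ε U (T.res (T.len s + 1) p) p, fun p => (winStrat _ _ _).2 p⟩,
    fun x hx hf => ?_⟩
  have hc : T.IsChild s (x (T.len s + 1)) := by
    have := x.isChild (T.len s); rwa [hx] at this
  obtain ⟨m, hm, hU⟩ := winStrat_spec (hs _ hc) x (by simp) (fun m hm ht => by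
    rw [x.len] at hm
    have := hf m (by omega) ht
    simp only [x.res hm] at this
    exact this)
  exact ⟨m, by rw [x.len] at hm; omega, hU⟩

/-- Determinacy of open games. -/
theorem open_determinacy (ε : Bool) (U : Set T.Pos) (s : T.Pos) (hs : T.len s = 0) :
    (∃ τ : T.Strat, ∀ x : T.Play, x 0 = s → FollowsFrom 0 ε τ x → ∃ n, x n ∈ U) ∨
    (∃ τ : T.Strat, ∀ x : T.Play, x 0 = s → FollowsFrom 0 (!ε) τ x → ∀ n, x n ∉ U) := by
  classical
  by_cases h : Win ε U s
  · left
    refine ⟨winStrat ε U s, fun x hx hf => ?_⟩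
    obtain ⟨m, -, hm⟩ := winStrat_spec h x (by rw [hs, hx]) (by rwa [hs])
    exact ⟨m, hm⟩
  · right
    have key : ∀ p : T.Pos, ∃ t, T.IsChild p t ∧ (¬ Win ε U p → ¬ Win ε U t) := by
      intro p
      by_cases hp : Win ε U p
      · exact ⟨_, (default : T.Strat).2 p, fun h => absurd hp h⟩
      · by_contra hcon
        push Not at hcon
        exact hp (win_of_forall_child fun t ht => (hcon t ht).2)
    choose f hf1 hf2 using key
    refine ⟨⟨f, hf1⟩, fun x hx hf n hn => ?_⟩
    have : ∀ n, ¬ Win ε U (x n) := by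
      intro n
      induction n with
      | zero => rwa [hx]
      | succ n ih =>
        by_cases ht : Turn ε n
        · exact fun hw => ih (win_of_child (by simpa using ht) (x.isChild n) hw)
        · rw [hf n (Nat.zero_le _) (turn_not.2 ht)]
          exact hf2 _ ih
    exact this n (win_of_mem hn)

open Classical in
/-- The strategy that plays `d` until the position can be forced into `U`, then forces it there,
and after reaching `u ∈ U` plays `F u`. Only positions of length at least `L` are taken into
account. -/
noncomputable def switch (ε : Bool) (U : Set T.Pos) (L : ℕ) (d : T.Strat) (F : T.Pos → T.Strat) :
    T.Strat :=
  ⟨fun p =>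
    if h : ∃ m, L ≤ m ∧ m ≤ T.len p ∧ T.res m p ∈ U then F (T.res (Nat.find h) p) p
    else if h : ∃ m, L ≤ m ∧ m ≤ T.len p ∧ Win ε U (T.res m p) then
      winStrat ε U (T.res (Nat.find h) p) p
    else d p, fun p => by
      dsimp only
      split_ifs
      exacts [(F _).2 p, (winStrat _ _ _).2 p, d.2 p]⟩

lemma switch_of_lt {ε : Bool} {U : Set T.Pos} {L : ℕ} {d : T.Strat} {F : T.Pos → T.Strat}
    {p : T.Pos} (hp : T.len p < L) : switch ε U L d F p = d p := by
  unfold switch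
  dsimp only
  rw [dif_neg (by rintro ⟨m, h1, h2, -⟩; omega), dif_neg (by rintro ⟨m, h1, h2, -⟩; omega)]

lemma switch_congr {ε : Bool} {U : Set T.Pos} {L : ℕ} {d d' : T.Strat} {F F' : T.Pos → T.Strat}
    {p : T.Pos} (hd : d p = d' p) (hF : ∀ u, F u p = F' u p) :
    switch ε U L d F p = switch ε U L d' F' p := by
  unfold switch
  simp only [hd, hF]

lemma switch_spec {ε : Bool} {U : Set T.Pos} {L : ℕ} {d : T.Strat} {F : T.Pos → T.Strat}
    {x : T.Play} (hx : FollowsFrom L ε (switch ε U L d F) x) :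
    ((∀ n, L ≤ n → ¬ Win ε U (x n)) ∧ FollowsFrom L ε d x) ∨
    ∃ n, L ≤ n ∧ x n ∈ U ∧ FollowsFrom n ε (F (x n)) x := by
  classical
  have hfind : ∀ (V : Set T.Pos) (m n : ℕ) (_ : L ≤ n) (_ : x n ∈ V)
      (_ : ∀ j, j < n → ¬ (L ≤ j ∧ x j ∈ V)) (_ : n ≤ m)
      (h : ∃ j, L ≤ j ∧ j ≤ T.len (x m) ∧ T.res j (x m) ∈ V), Nat.find h = n := by
    intro V m n h1 h2 h3 h4 h
    rw [Nat.find_eq_iff]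
    refine ⟨⟨h1, by simpa using h4, by rwa [x.res h4]⟩, ?_⟩
    rintro j hj ⟨h5, h6, h7⟩
    rw [x.res (by omega)] at h7
    exact h3 j hj ⟨h5, h7⟩
  by_cases hU : ∃ n, L ≤ n ∧ x n ∈ U
  · right
    refine ⟨Nat.find hU, (Nat.find_spec hU).1, (Nat.find_spec hU).2, fun m hm ht => ?_⟩
    obtain ⟨h1, h2⟩ := Nat.find_spec hU
    rw [hx m (h1.trans hm) ht]
    have hex : ∃ j, L ≤ j ∧ j ≤ T.len (x m) ∧ T.res j (x m) ∈ U :=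
      ⟨_, h1, by simpa using hm, by rwa [x.res hm]⟩
    unfold switch
    dsimp only
    rw [dif_pos hex, hfind U m _ h1 h2 (fun j hj => Nat.find_min hU hj) hm, x.res hm]
  have hnU : ∀ m, ¬ ∃ j, L ≤ j ∧ j ≤ T.len (x m) ∧ T.res j (x m) ∈ U := by
    rintro m ⟨j, h1, h2, h3⟩
    rw [x.len] at h2
    rw [x.res h2] at h3
    exact hU ⟨j, h1, h3⟩
  by_cases hW : ∃ n, L ≤ n ∧ Win ε U (x n)
  · exfalso
    obtain ⟨h1, h2⟩ := Nat.find_spec hW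
    obtain ⟨m, h3, h4⟩ := winStrat_spec h2 x (by simp) (fun m hm ht => by
      rw [x.len] at hm
      rw [hx m (h1.trans hm) ht]
      have hex : ∃ j, L ≤ j ∧ j ≤ T.len (x m) ∧ Win ε U (T.res j (x m)) :=
        ⟨_, h1, by simpa using hm, by rwa [x.res hm]⟩
      unfold switch
      dsimp only
      rw [dif_neg (hnU m), dif_pos hex,
        hfind {s | Win ε U s} m _ h1 h2 (fun j hj => Nat.find_min hW hj) hm hex, x.res hm])
    rw [x.len] at h3
    exact hU ⟨m, h1.trans h3, h4⟩
  · left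
    push Not at hW
    refine ⟨hW, fun m hm ht => ?_⟩
    rw [hx m hm ht]
    unfold switch
    dsimp only
    rw [dif_neg (hnU m), dif_neg]
    rintro ⟨j, h1, h2, h3⟩
    rw [x.len] at h2
    rw [x.res h2] at h3
    exact hW j h1 h3

/-- A length-preserving map of trees. -/
structure Hom (T' T : GTree) where
  toFun : T'.Pos → T.Pos
  len_map : ∀ s, T.len (toFun s) = T'.len s
  pred_map : ∀ s, T.pred (toFun s) = toFun (T'.pred s)

instance {T' T : GTree} : CoeFun (Hom T' T) (fun _ => T'.Pos → T.Pos) := ⟨Hom.toFun⟩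

namespace Hom

variable {T'' T' T : GTree}

/-- The identity. -/
def id (T : GTree) : Hom T T := ⟨fun s => s, fun _ => rfl, fun _ => rfl⟩

/-- Composition. -/
def comp (f : Hom T' T) (g : Hom T'' T') : Hom T'' T :=
  ⟨fun s => f (g s), fun s => by rw [f.len_map, g.len_map],
    fun s => by rw [f.pred_map, g.pred_map]⟩

lemma isChild (f : Hom T' T) {s t : T'.Pos} (h : T'.IsChild s t) : T.IsChild (f s) (f t) :=
  ⟨by rw [f.pred_map, h.1], by rw [f.len_map, f.len_map, h.2]⟩

/-- The map induced on plays. -/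
def map (f : Hom T' T) (x : T'.Play) : T.Play :=
  ⟨fun n => f (x n), fun n => ⟨by rw [f.len_map, x.len], by rw [f.pred_map, x.pred]⟩⟩

@[simp] lemma map_apply (f : Hom T' T) (x : T'.Play) (n : ℕ) : f.map x n = f (x n) := rfl

end Hom

/-- A `k`-covering: plays consistent with (images of) strategies can be lifted, and nothing
changes up to length `k`. -/
structure IsCov (k : ℕ) {T' T : GTree} (π : Hom T' T) : Prop where
  bij : ∀ s : T.Pos, T.len s ≤ k → ∃! s', π s' = s
  lift : ∀ ε : Bool, ∃ φ : T'.Strat → T.Strat,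
    (∀ (τ τ' : T'.Strat) (n : ℕ), (∀ s, T'.len s ≤ n → τ s = τ' s) →
      ∀ s, T.len s ≤ n → φ τ s = φ τ' s) ∧
    (∀ (τ : T'.Strat) (s : T'.Pos), T'.len s < k → φ τ (π s) = π (τ s)) ∧
    (∀ (τ : T'.Strat) (x : T.Play), FollowsFrom 0 ε (φ τ) x →
      ∃ x' : T'.Play, FollowsFrom 0 ε τ x' ∧ π.map x' = x)

lemma IsCov.mono {k l : ℕ} (h : l ≤ k) {T' T : GTree} {π : Hom T' T} (hπ : IsCov k π) :
    IsCov l π := by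
  refine ⟨fun s hs => hπ.bij s (hs.trans h), fun ε => ?_⟩
  obtain ⟨φ, h1, h2, h3⟩ := hπ.lift ε
  exact ⟨φ, h1, fun τ s hs => h2 τ s (hs.trans_le h), h3⟩

lemma IsCov.comp {k : ℕ} {T'' T' T : GTree} {π : Hom T' T} {ρ : Hom T'' T'}
    (hπ : IsCov k π) (hρ : IsCov k ρ) : IsCov k (π.comp ρ) := by
  refine ⟨fun s hs => ?_, fun ε => ?_⟩
  · obtain ⟨s', h1, h2⟩ := hπ.bij s hs
    obtain ⟨s'', h3, h4⟩ := hρ.bij s' (by rw [← π.len_map, h1]; exact hs)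
    refine ⟨s'', by change π (ρ s'') = s; rw [h3, h1], fun r hr => h4 r (h2 _ hr)⟩
  · obtain ⟨φ, h1, h2, h3⟩ := hπ.lift ε
    obtain ⟨ψ, h4, h5, h6⟩ := hρ.lift ε
    refine ⟨fun τ => φ (ψ τ), fun τ τ' n h => h1 _ _ n (h4 _ _ n h), fun τ s hs => ?_,
      fun τ x hx => ?_⟩
    · change φ (ψ τ) (π (ρ s)) = π (ρ (τ s))
      rw [h2 _ _ (by rwa [ρ.len_map]), h5 _ _ hs]
    · obtain ⟨x', h7, h8⟩ := h3 _ _ hx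
      obtain ⟨x'', h9, h10⟩ := h6 _ _ h7
      exact ⟨x'', h9, by rw [← h8, ← h10]; rfl⟩

end GTree

end GaleStewart

namespace GaleStewart

namespace GTree

section Limit

variable {T : ℕ → GTree} (π : ∀ i, Hom (T (i + 1)) (T i))

/-- Coherent sequences of positions. -/
def Thread : Type := {s : ∀ i, (T i).Pos // ∀ i, π i (s (i + 1)) = s i}

variable {π}

lemma Thread.len_eq (s : Thread π) (i : ℕ) : (T i).len (s.1 i) = (T 0).len (s.1 0) := by
  induction i with
  | zero => rfl
  | succ i ih => rw [← ih, ← s.2 i, (π i).len_map]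

lemma Thread.ext_of_le {k : ℕ} (hπ : ∀ i (s : (T i).Pos), (T i).len s ≤ k + i → ∃! s', π i s' = s)
    {s s' : Thread π} {j : ℕ} (hs : (T 0).len (s.1 0) ≤ k + j) (h : s.1 j = s'.1 j) : s = s' := by
  have hdown : ∀ d i, i + d = j → s.1 i = s'.1 i := by
    intro d
    induction d with
    | zero => intro i hi; rw [show i = j by omega]; exact h
    | succ d ih => intro i hi; rw [← s.2, ← s'.2, ih (i + 1) (by omega)]
  have hup : ∀ i, j ≤ i → s.1 i = s'.1 i := by
    intro i hi
    induction i, hi using Nat.le_induction with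
    | base => exact h
    | succ i hi ih =>
      exact (hπ i (s.1 i) (by rw [s.len_eq]; omega)).unique (s.2 i) ((s'.2 i).trans ih.symm)
  refine Subtype.ext (funext fun i => ?_)
  rcases le_total j i with hi | hi
  · exact hup i hi
  · exact hdown (j - i) i (by omega)

lemma Thread.exists_of_le {T : ℕ → GTree} {π : ∀ i, Hom (T (i + 1)) (T i)} {k : ℕ}
    (hπ : ∀ i (s : (T i).Pos), (T i).len s ≤ k + i → ∃! s', π i s' = s) (j : ℕ)
    (a : (T j).Pos) (ha : (T j).len a ≤ k + j) : ∃ s : Thread π, s.1 j = a := by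
  induction j generalizing T k with
  | zero =>
    choose f hf using fun i (s : {s : (T i).Pos // (T i).len s ≤ k + i}) =>
      (hπ i s.1 s.2).exists
    let F : ∀ i, {s : (T i).Pos // (T i).len s ≤ k + i} := fun i =>
      Nat.rec ⟨a, ha⟩ (fun i s => ⟨f i s, by
        have h1 := (π i).len_map (f i s)
        rw [hf i s] at h1
        have h2 := s.2
        change (T (i + 1)).len (f i s) ≤ k + (i + 1)
        omega⟩) i
    exact ⟨⟨fun i => (F i).1, fun i => hf i (F i)⟩, rfl⟩
  | succ j ih =>
    obtain ⟨s, hs⟩ := ih (T := fun i => T (i + 1)) (π := fun i => π (i + 1)) (k := k + 1)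
      (fun i s hs => hπ (i + 1) s (by omega)) a (by omega)
    refine ⟨⟨fun i => Nat.casesOn i (π 0 (s.1 0)) s.1, fun i => ?_⟩, hs⟩
    cases i with
    | zero => rfl
    | succ i => exact s.2 i

/-- The inverse limit of a sequence of trees with growing bijective initial parts. -/
def limit (π : ∀ i, Hom (T (i + 1)) (T i)) (k : ℕ)
    (hπ : ∀ i (s : (T i).Pos), (T i).len s ≤ k + i → ∃! s', π i s' = s) : GTree where
  Pos := Thread π
  len s := (T 0).len (s.1 0)
  pred s := ⟨fun i => (T i).pred (s.1 i), fun i => by rw [← (π i).pred_map, s.2]⟩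
  len_pred s := (T 0).len_pred _
  exists_child s := by
    obtain ⟨t, ht1, ht2⟩ := (T ((T 0).len (s.1 0) + 1)).exists_child (s.1 _)
    have hl2 := s.len_eq ((T 0).len (s.1 0) + 1)
    rw [hl2] at ht2
    obtain ⟨u, hu⟩ := Thread.exists_of_le hπ _ t (by omega)
    have hl : (T 0).len (u.1 0) = (T 0).len (s.1 0) + 1 := by
      rw [← u.len_eq ((T 0).len (s.1 0) + 1), hu, ht2]
    refine ⟨u, Thread.ext_of_le hπ (j := (T 0).len (s.1 0) + 1) ?_ (by dsimp only; rw [hu, ht1]),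
      hl⟩
    change (T 0).len ((T 0).pred (u.1 0)) ≤ _
    rw [(T 0).len_pred]; omega

variable {k : ℕ} {hπ : ∀ i (s : (T i).Pos), (T i).len s ≤ k + i → ∃! s', π i s' = s}

/-- The projections of the inverse limit. -/
def limit.proj (hπ : ∀ i (s : (T i).Pos), (T i).len s ≤ k + i → ∃! s', π i s' = s) (i : ℕ) :
    Hom (limit π k hπ) (T i) :=
  ⟨fun s => s.1 i, fun s => s.len_eq i, fun _ => rfl⟩

open Classical in
/-- The part of a strategy on the limit that is visible in `T i`. -/
noncomputable def limit.trunc (σ : (limit π k hπ).Strat) (i : ℕ) : (T i).Strat :=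
  ⟨fun p => if h : (T i).len p < k + i then
      (σ (Thread.exists_of_le hπ i p h.le).choose).1 i
    else (default : (T i).Strat) p, fun p => by
      dsimp only
      split_ifs with h
      · have h1 := (Thread.exists_of_le hπ i p h.le).choose_spec
        have h2 := (limit.proj hπ i).isChild (σ.2 (Thread.exists_of_le hπ i p h.le).choose)
        have h3 : (limit.proj hπ i) (Thread.exists_of_le hπ i p h.le).choose = p := h1
        rw [h3] at h2
        exact h2
      · exact (default : (T i).Strat).2 p⟩

lemma limit.trunc_apply (σ : (limit π k hπ).Strat) (i : ℕ) (s : Thread π)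
    (h : (T i).len (s.1 i) < k + i) : limit.trunc σ i (s.1 i) = (σ s).1 i := by
  have h1 := (Thread.exists_of_le hπ i _ h.le).choose_spec
  have h2 : (Thread.exists_of_le hπ i _ h.le).choose = s :=
    Thread.ext_of_le hπ (j := i) (by rw [← Thread.len_eq _ i, h1]; exact h.le) h1
  unfold limit.trunc
  dsimp only
  rw [dif_pos h, h2]

/-- A strategy on the limit is carried to `T i` by truncating it at `T (i + d)` and mapping it
down. -/
noncomputable def limit.down (φ : ∀ i, (T (i + 1)).Strat → (T i).Strat)
    (σ : (limit π k hπ).Strat) : ℕ → ∀ i, (T i).Strat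
  | 0, i => limit.trunc σ i
  | d + 1, i => φ i (limit.down φ σ d (i + 1))

/-- The strategies that the maps `limit.down` converge to. -/
noncomputable def limit.downLim (φ : ∀ i, (T (i + 1)).Strat → (T i).Strat)
    (σ : (limit π k hπ).Strat) (i : ℕ) : (T i).Strat :=
  ⟨fun p => limit.down φ σ ((T i).len p + 1) i p, fun p => (limit.down φ σ _ i).2 p⟩

theorem limit.isCov (hc : ∀ i, IsCov (k + i) (π i)) :
    IsCov k (limit.proj (fun i => (hc i).bij) 0) := by
  set hπ : ∀ i (s : (T i).Pos), (T i).len s ≤ k + i → ∃! s', π i s' = s := fun i => (hc i).bij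
  refine ⟨fun s hs => ?_, fun ε => ?_⟩
  · obtain ⟨t, ht⟩ := Thread.exists_of_le hπ 0 s hs
    refine ⟨t, ht, fun t' ht' => Thread.ext_of_le hπ (j := 0) ?_ (ht'.trans ht.symm)⟩
    change t'.1 0 = s at ht'
    rw [ht']; exact hs
  choose φ hloc htr hlift using fun i => (hc i).lift ε
  have hA : ∀ (σ : (limit π k hπ).Strat) i (p : (T i).Pos), (T i).len p < k + i →
      φ i (limit.trunc σ (i + 1)) p = limit.trunc σ i p := by
    intro σ i p hp
    obtain ⟨s, rfl⟩ := Thread.exists_of_le hπ i p hp.le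
    rw [limit.trunc_apply σ i s hp]
    have hl : (T (i + 1)).len (s.1 (i + 1)) = (T i).len (s.1 i) := by
      exact (s.len_eq (i + 1)).trans (s.len_eq i).symm
    have h1 := htr i (limit.trunc σ (i + 1)) (s.1 (i + 1)) (by omega)
    rw [s.2, limit.trunc_apply σ (i + 1) s (by omega), (σ s).2] at h1
    exact h1
  have hB : ∀ (σ : (limit π k hπ).Strat) d i (p : (T i).Pos), (T i).len p < k + i + d →
      limit.down φ σ d i p = limit.down φ σ (d + 1) i p := by
    intro σ d
    induction d with
    | zero => exact fun i p hp => (hA σ i p hp).symm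
    | succ d ih =>
      exact fun i p hp => hloc i _ _ _ (fun s hs => ih (i + 1) s (by omega)) p le_rfl
  have hC : ∀ (σ : (limit π k hπ).Strat) d e i (p : (T i).Pos), (T i).len p < k + i + d →
      limit.down φ σ d i p = limit.down φ σ (d + e) i p := by
    intro σ d e i p hp
    induction e with
    | zero => rfl
    | succ e ih => rw [ih, hB σ (d + e) i p (by omega)]; rfl
  have hlim : ∀ (σ : (limit π k hπ).Strat) d i (p : (T i).Pos), (T i).len p < k + i + d →
      limit.downLim φ σ i p = limit.down φ σ d i p := by
    intro σ d i p hp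
    change limit.down φ σ ((T i).len p + 1) i p = _
    rw [hC σ d ((T i).len p + 1) i p hp, hC σ ((T i).len p + 1) d i p (by omega), add_comm]
  have hD : ∀ (σ : (limit π k hπ).Strat) i,
      φ i (limit.downLim φ σ (i + 1)) = limit.downLim φ σ i := by
    intro σ i
    refine Subtype.ext (funext fun p => ?_)
    rw [hlim σ ((T i).len p + 2) i p (by omega)]
    exact hloc i _ _ _ (fun s hs => hlim σ ((T i).len p + 1) (i + 1) s (by omega)) p le_rfl
  refine ⟨fun σ => limit.downLim φ σ 0, fun σ σ' n h => ?_, fun σ s hs => ?_, fun σ x hx => ?_⟩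
  · have h1 : ∀ i (s : (T i).Pos), (T i).len s ≤ n → limit.trunc σ i s = limit.trunc σ' i s := by
      intro i s hs
      unfold limit.trunc
      dsimp only
      split_ifs with hlt
      · have h1 := (Thread.exists_of_le hπ i s hlt.le).choose_spec
        refine congrArg (fun u : Thread π => u.1 i) (h (Thread.exists_of_le hπ i s hlt.le).choose ?_)
        refine le_of_eq_of_le (Thread.len_eq _ i).symm ?_
        rw [h1]; exact hs
      · rfl
    have h2 : ∀ d i (s : (T i).Pos), (T i).len s ≤ n →
        limit.down φ σ d i s = limit.down φ σ' d i s := by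
      intro d
      induction d with
      | zero => exact h1
      | succ d ih => exact fun i s hs => hloc i _ _ _ (fun s hs => ih (i + 1) s hs) s hs
    exact fun s hs => h2 _ 0 s hs
  · change (T 0).len (s.1 0) < k at hs
    change limit.downLim φ σ 0 (s.1 0) = (σ s).1 0
    rw [hlim σ 0 0 _ (by omega)]
    exact limit.trunc_apply σ 0 s (by omega)
  · choose g hg1 hg2 using fun i
      (x : {x : (T i).Play // FollowsFrom 0 ε (limit.downLim φ σ i) x}) =>
      hlift i (limit.downLim φ σ (i + 1)) x.1 (by rw [hD]; exact x.2)
    let Y : ∀ i, {x : (T i).Play // FollowsFrom 0 ε (limit.downLim φ σ i) x} := fun i =>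
      Nat.rec ⟨x, hx⟩ (fun i x => ⟨g i x, hg1 i x⟩) i
    let y : ∀ i, (T i).Play := fun i => (Y i).1
    have hy : ∀ i, FollowsFrom 0 ε (limit.downLim φ σ i) (y i) := fun i => (Y i).2
    have hy' : ∀ i, (π i).map (y (i + 1)) = y i := fun i => hg2 i (Y i)
    let z : (limit π k hπ).Play := ⟨fun n => ⟨fun i => y i n, fun i =>
        congrArg (fun w : (T i).Play => w n) (hy' i)⟩, fun n => ⟨(y 0).len n,
          Subtype.ext (funext fun i => (y i).pred n)⟩⟩
    refine ⟨z, fun n hn ht => ?_, rfl⟩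
    refine Thread.ext_of_le hπ (j := n + 1) ?_ ?_
    · change (T 0).len (y 0 (n + 1)) ≤ _
      rw [(y 0).len]; omega
    · change y (n + 1) (n + 1) = _
      rw [hy (n + 1) n hn ht, hlim σ 0 (n + 1) _ (by simp; omega)]
      exact limit.trunc_apply σ (n + 1) (z n) (by
        change (T (n + 1)).len (y (n + 1) n) < _
        rw [Play.len]; omega)

end Limit

end GTree

end GaleStewart

namespace GaleStewart

namespace GTree

section Unravel

variable {T : GTree}

/-- The set `Q` of positions allows all moves of the second player and some move of the first. -/
def IsQuasi (K : ℕ) (Q : Set T.Pos) : Prop :=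
  ∀ s ∈ Q, K + 1 ≤ T.len s → (T.len s % 2 = 1 → ∀ t, T.IsChild s t → t ∈ Q) ∧
    (T.len s % 2 = 0 → ∃ t, T.IsChild s t ∧ t ∈ Q)

/-- The set `R` of positions avoids `N`, and allows all moves of the first player inside `Q` and
some move of the second. -/
def IsAvoiding (K : ℕ) (N Q R : Set T.Pos) : Prop :=
  ∀ s ∈ R, s ∈ Q ∧ s ∉ N ∧ (K + 2 ≤ T.len s → (T.len s % 2 = 1 → ∃ t, T.IsChild s t ∧ t ∈ R) ∧
    (T.len s % 2 = 0 → ∀ t, T.IsChild s t → t ∈ Q → t ∈ R))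

/-- The positions comparable with `u`. -/
def cone (u : T.Pos) : Set T.Pos :=
  {s | T.res (T.len s) u = s ∨ T.res (T.len u) s = u}

/-- The set `R` of positions consists of those comparable with a given member of `Q ∩ N`. -/
def IsReaching (K : ℕ) (N Q R : Set T.Pos) : Prop :=
  ∃ u, u ∈ Q ∧ u ∈ N ∧ K + 2 ≤ T.len u ∧ R = cone u

/-- The legal positions of the unravelled game. -/
structure Legal (K : ℕ) (N : Set T.Pos) (s : T.Pos) (Q R : Set T.Pos) : Prop where
  q_eq : T.len s ≤ K → Q = ∅
  r_eq : T.len s ≤ K + 1 → R = ∅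
  q_quasi : K + 1 ≤ T.len s → IsQuasi K Q
  q_mem : K + 1 ≤ T.len s → T.res (K + 1) s ∈ Q
  r_or : K + 2 ≤ T.len s → IsReaching K N Q R ∨ IsAvoiding K N Q R
  r_mem : ∀ m, K + 2 ≤ m → m ≤ T.len s → T.res m s ∈ R

/-- The positions of the unravelled game. -/
@[ext] structure UPos (K : ℕ) (N : Set T.Pos) where
  pos : T.Pos
  q : Set T.Pos
  r : Set T.Pos
  legal : Legal K N pos q r

variable {K : ℕ} {N : Set T.Pos}

lemma Play.mem_cone (x : T.Play) (m n : ℕ) : x m ∈ cone (x n) := by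
  rcases le_total m n with h | h
  · left; rw [x.len, x.res h]
  · right; rw [x.len, x.res h]

lemma eq_res_of_mem_cone {u s : T.Pos} (h : s ∈ cone u) (hl : T.len s ≤ T.len u) :
    s = T.res (T.len s) u := by
  rcases h with h | h
  · exact h.symm
  · have h1 := congrArg T.len h
    rw [len_res] at h1
    have h2 : T.len s = T.len u := by omega
    rw [res_of_le h2.le] at h
    rw [h, res_of_le le_rfl]

lemma isChild_res {u : T.Pos} {n : ℕ} (h : n + 1 ≤ T.len u) :
    T.IsChild (T.res n u) (T.res (n + 1) u) := by
  have h1 : T.len (T.res (n + 1) u) = n + 1 := by rw [len_res]; omega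
  refine ⟨?_, by rw [h1, len_res]; omega⟩
  rw [pred_eq_res _ (by omega), h1, Nat.add_sub_cancel, res_res (by omega)]

lemma Legal.pred {s : T.Pos} {Q R : Set T.Pos} (h : Legal K N s Q R) :
    Legal K N (T.pred s) (open Classical in if K + 1 < T.len s then Q else ∅)
      (open Classical in if K + 2 < T.len s then R else ∅) := by
  have hl := T.len_pred s
  constructor
  · intro h1; rw [if_neg (by omega)]
  · intro h1; rw [if_neg (by omega)]
  · intro h1; rw [if_pos (by omega)]; exact h.q_quasi (by omega)
  · intro h1
    rw [if_pos (by omega), res_pred (by omega)]; exact h.q_mem (by omega)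
  · intro h1; rw [if_pos (by omega), if_pos (by omega)]; exact h.r_or (by omega)
  · intro m h1 h2
    rw [if_pos (by omega), res_pred (by omega)]; exact h.r_mem m h1 (by omega)

/-- Legality of an extension of a position of length at least `K + 2`. -/
lemma Legal.child {s t : T.Pos} {Q R : Set T.Pos} (h : Legal K N s Q R) (hst : T.IsChild s t)
    (hs : K + 2 ≤ T.len s) (ht : t ∈ R) : Legal K N t Q R := by
  have hl := hst.2
  constructor
  · intro; omega
  · intro; omega
  · intro _; exact h.q_quasi (by omega)
  · intro _; rw [hst.res (by omega)]; exact h.q_mem (by omega)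
  · intro _; exact h.r_or hs
  · intro m h1 h2
    rcases h2.lt_or_eq with h3 | h3
    · rw [hst.res (by omega)]; exact h.r_mem m h1 (by omega)
    · rw [res_of_le h3.ge]; exact ht

lemma Legal.exists_child {s : T.Pos} {Q R : Set T.Pos} (hK : K % 2 = 0) (h : Legal K N s Q R) :
    ∃ t Q' R', T.IsChild s t ∧ Legal K N t Q' R' ∧ (K + 1 ≤ T.len s → Q' = Q) ∧
      (K + 2 ≤ T.len s → R' = R) := by
  rcases lt_or_ge (T.len s) K with h1 | h1
  · obtain ⟨t, ht⟩ := T.exists_child s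
    have := ht.2
    exact ⟨t, ∅, ∅, ht, by constructor <;> intros <;> first | rfl | omega, by omega, by omega⟩
  rcases h1.eq_or_lt with h1 | h1
  · obtain ⟨t, ht⟩ := T.exists_child s
    have := ht.2
    refine ⟨t, Set.univ, ∅, ht, ?_, by omega, by omega⟩
    constructor
    · intro; omega
    · simp
    · exact fun _ s _ _ => ⟨fun _ _ _ => trivial, fun _ =>
        (T.exists_child s).imp fun t ht => ⟨ht, trivial⟩⟩
    · simp
    · intro; omega
    · intros; omega
  have hq := h.q_mem (by omega)
  rcases Nat.eq_or_lt_of_le (Nat.succ_le_of_lt h1) with h2 | h2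
  · replace h2 : T.len s = K + 1 := h2.symm
    rw [res_of_le (by omega)] at hq
    by_cases hu : ∃ u ∈ Q, u ∈ N ∧ K + 2 ≤ T.len u ∧ T.res (K + 1) u = s
    · obtain ⟨u, hu1, hu2, hu3, rfl⟩ := hu
      have hc := isChild_res (u := u) (n := K + 1) (by omega)
      have hl := hc.2
      refine ⟨_, Q, cone u, hc, ?_, fun _ => rfl, fun _ => by omega⟩
      constructor
      · intro; omega
      · intro; omega
      · intro; exact h.q_quasi (by omega)
      · intro; rw [hc.res (by omega), res_of_le (by omega)]; exact hq
      · exact fun _ => .inl ⟨u, hu1, hu2, hu3, rfl⟩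
      · intro m h3 h4
        rw [res_of_le (by omega)]
        left
        rw [hl, h2]
    · obtain ⟨t, ht⟩ := T.exists_child s
      have hl := ht.2
      have hQ := h.q_quasi (by omega)
      refine ⟨t, Q, {v | v ∈ Q ∧ K + 2 ≤ T.len v ∧ T.res (K + 1) v = s}, ht, ?_, fun _ => rfl,
        fun _ => by omega⟩
      constructor
      · intro; omega
      · intro; omega
      · intro; exact hQ
      · intro; rw [IsChild.res ht (by omega), res_of_le (by omega)]; exact hq
      · refine fun _ => .inr ?_
        rintro v ⟨hv1, hv2, hv3⟩
        refine ⟨hv1, fun hv => hu ⟨v, hv1, hv, hv2, hv3⟩, fun _ => ⟨fun h4 => ?_, ?_⟩⟩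
        · obtain ⟨w, hw⟩ := T.exists_child v
          have := hw.2
          exact ⟨w, hw, (hQ v hv1 (by omega)).1 h4 w hw, by omega, by
            rw [IsChild.res hw (by omega), hv3]⟩
        · intro _ w hw hw1
          have := hw.2
          exact ⟨hw1, by omega, by rw [hw.res (by omega), hv3]⟩
      · intro m h3 h4
        rw [res_of_le (by omega)]
        exact ⟨(hQ s hq (by omega)).1 (by omega) t ht, by omega, by
          rw [IsChild.res ht (by omega), res_of_le (by omega)]⟩
  · have hr := h.r_mem _ h2 le_rfl
    rw [res_of_le le_rfl] at hr
    suffices ∃ t, T.IsChild s t ∧ t ∈ R by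
      obtain ⟨t, ht, htR⟩ := this
      exact ⟨t, Q, R, ht, h.child ht h2 htR, fun _ => rfl, fun _ => rfl⟩
    rcases h.r_or h2 with ⟨u, hu1, hu2, hu3, rfl⟩ | hA
    · rcases lt_or_ge (T.len s) (T.len u) with h3 | h3
      · refine ⟨T.res (T.len s + 1) u, ?_, ?_⟩
        · have := isChild_res (u := u) (n := T.len s) h3
          rwa [← eq_res_of_mem_cone hr h3.le] at this
        · left; rw [len_res, min_eq_left h3]
      · obtain ⟨t, ht⟩ := T.exists_child s
        refine ⟨t, ht, .inr ?_⟩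
        rw [IsChild.res ht h3]
        rcases hr with hr | hr
        · rw [← hr, res_of_le (by rw [len_res]; omega)]
          rw [res_of_le h3]
        · exact hr
    · obtain ⟨h3, h4, h5⟩ := hA s hr
      rcases Nat.mod_two_eq_zero_or_one (T.len s) with h6 | h6
      · obtain ⟨t, ht, htQ⟩ := (h.q_quasi (by omega) s h3 (by omega)).2 h6
        exact ⟨t, ht, (h5 h2).2 h6 t ht htQ⟩
      · exact (h5 h2).1 h6

open Classical in
/-- The unravelled game: the first player, moving from length `K`, additionally commits to a
quasi-strategy, and the second player answers by committing to reach or to avoid `N`. -/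
def unravel (hK : K % 2 = 0) (N : Set T.Pos) : GTree where
  Pos := UPos K N
  len p := T.len p.pos
  pred p := ⟨T.pred p.pos, _, _, p.legal.pred⟩
  len_pred p := T.len_pred _
  exists_child p := by
    obtain ⟨t, Q, R, ht, hl, hQ, hR⟩ := p.legal.exists_child hK
    refine ⟨⟨t, Q, R, hl⟩, ?_, ht.2⟩
    have h2 := ht.2
    refine UPos.ext ht.1 ?_ ?_
    · dsimp only
      split_ifs with h
      · exact hQ (by omega)
      · exact (p.legal.q_eq (by omega)).symm
    · dsimp only
      split_ifs with h
      · exact hR (by omega)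
      · exact (p.legal.r_eq (by omega)).symm

/-- Forgetting the commitments. -/
def unravel.proj (hK : K % 2 = 0) (N : Set T.Pos) : Hom (unravel hK N) T :=
  ⟨UPos.pos, fun _ => rfl, fun _ => rfl⟩

variable {hK : K % 2 = 0}

lemma unravel.child_q {p p' : UPos K N} (h : (unravel hK N).IsChild p p')
    (hl : K + 1 ≤ T.len p.pos) : p'.q = p.q := by
  have h1 : T.len p'.pos = T.len p.pos + 1 := h.2
  have h2 := congrArg UPos.q h.1
  change (if _ then _ else _) = _ at h2
  rwa [if_pos (by omega)] at h2

lemma unravel.child_r {p p' : UPos K N} (h : (unravel hK N).IsChild p p')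
    (hl : K + 2 ≤ T.len p.pos) : p'.r = p.r := by
  have h1 : T.len p'.pos = T.len p.pos + 1 := h.2
  have h2 := congrArg UPos.r h.1
  change (if _ then _ else _) = _ at h2
  rwa [if_pos (by omega)] at h2

lemma unravel.child_pos {p p' : UPos K N} (h : (unravel hK N).IsChild p p') :
    T.IsChild p.pos p'.pos :=
  (unravel.proj hK N).isChild h

lemma unravel.child_ext {p a b : UPos K N} (ha : (unravel hK N).IsChild p a)
    (hb : (unravel hK N).IsChild p b) (h : a.pos = b.pos) (hq : T.len p.pos = K → a.q = b.q)
    (hr : T.len p.pos = K + 1 → a.r = b.r) : a = b := by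
  have h1 : T.len a.pos = T.len p.pos + 1 := ha.2
  have h2 : T.len b.pos = T.len p.pos + 1 := hb.2
  refine UPos.ext h ?_ ?_
  · rcases lt_trichotomy (T.len p.pos) K with h3 | h3 | h3
    · rw [a.legal.q_eq (by omega), b.legal.q_eq (by omega)]
    · exact hq h3
    · rw [unravel.child_q ha h3, unravel.child_q hb h3]
  · rcases lt_trichotomy (T.len p.pos) (K + 1) with h3 | h3 | h3
    · rw [a.legal.r_eq (by omega), b.legal.r_eq (by omega)]
    · exact hr h3
    · rw [unravel.child_r ha h3, unravel.child_r hb h3]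

open Classical in
lemma legal_play {x : T.Play} {Q R : Set T.Pos} (hQ : IsQuasi K Q) (hxQ : x (K + 1) ∈ Q)
    (hR : IsReaching K N Q R ∨ IsAvoiding K N Q R) (hxR : ∀ n, K + 2 ≤ n → x n ∈ R) (n : ℕ) :
    Legal K N (x n) (if n ≤ K then ∅ else Q) (if n ≤ K + 1 then ∅ else R) := by
  constructor
  · intro h; rw [x.len] at h; rw [if_pos h]
  · intro h; rw [x.len] at h; rw [if_pos h]
  · intro h; rw [x.len] at h; rw [if_neg (by omega)]; exact hQ
  · intro h; rw [x.len] at h; rw [if_neg (by omega), x.res h]; exact hxQ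
  · intro h; rw [x.len] at h; rw [if_neg (by omega), if_neg (by omega)]; exact hR
  · intro m h1 h2; rw [x.len] at h2; rw [if_neg (by omega), x.res h2]; exact hxR m h1

lemma unravel.exists_lift {x : T.Play} {Q R : Set T.Pos} (hQ : IsQuasi K Q) (hxQ : x (K + 1) ∈ Q)
    (hR : IsReaching K N Q R ∨ IsAvoiding K N Q R) (hxR : ∀ n, K + 2 ≤ n → x n ∈ R)
    {ε : Bool} {τ : (unravel hK N).Strat}
    (h : ∀ n, Turn ε n → ∀ p : UPos K N, p.pos = x n → (K + 1 ≤ n → p.q = Q) →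
      (K + 2 ≤ n → p.r = R) → UPos.pos (τ p) = x (n + 1) ∧ (n = K → UPos.q (τ p) = Q) ∧
        (n = K + 1 → UPos.r (τ p) = R)) :
    ∃ x' : (unravel hK N).Play, FollowsFrom 0 ε τ x' ∧ (unravel.proj hK N).map x' = x := by
  classical
  let y : ℕ → UPos K N := fun n => ⟨x n, _, _, legal_play hQ hxQ hR hxR n⟩
  have hy : ∀ n, (unravel hK N).pred (y (n + 1)) = y n := by
    intro n
    refine UPos.ext (x.pred n) ?_ ?_
    · change (if K + 1 < T.len (x (n + 1)) then (if n + 1 ≤ K then ∅ else Q) else ∅) =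
        if n ≤ K then ∅ else Q
      rw [x.len]
      split_ifs <;> first | rfl | omega
    · change (if K + 2 < T.len (x (n + 1)) then (if n + 1 ≤ K + 1 then ∅ else R) else ∅) =
        if n ≤ K + 1 then ∅ else R
      rw [x.len]
      split_ifs <;> first | rfl | omega
  let x' : (unravel hK N).Play := ⟨y, fun n => ⟨x.len n, hy n⟩⟩
  refine ⟨x', fun n _ ht => ?_, rfl⟩
  obtain ⟨h1, h2, h3⟩ := h n ht (y n) rfl (fun h => if_neg (by omega)) (fun h => if_neg (by omega))
  refine unravel.child_ext (x'.isChild n) (τ.2 _) h1.symm (fun h => ?_) (fun h => ?_)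
  · have hn : n = K := by rwa [show (x' n) = y n from rfl, x.len] at h
    refine Eq.trans ?_ (h2 hn).symm
    exact if_neg (by omega)
  · have hn : n = K + 1 := by rwa [show (x' n) = y n from rfl, x.len] at h
    refine Eq.trans ?_ (h3 hn).symm
    exact if_neg (by omega)

open Classical in
/-- Simulation of a strategy of the unravelled game with given commitments. -/
noncomputable def simulate (τ : (unravel hK N).Strat) (ℓ : T.Pos → Set T.Pos × Set T.Pos) :
    T.Strat :=
  ⟨fun p => if h : Legal K N p (ℓ p).1 (ℓ p).2 then UPos.pos (τ ⟨p, _, _, h⟩)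
    else (default : T.Strat) p, fun p => by
      dsimp only
      split_ifs with h
      · exact unravel.child_pos (τ.2 ⟨p, _, _, h⟩)
      · exact (default : T.Strat).2 p⟩

lemma simulate_apply (τ : (unravel hK N).Strat) (ℓ : T.Pos → Set T.Pos × Set T.Pos)
    (p : UPos K N) (hp : ℓ p.pos = (p.q, p.r)) : simulate τ ℓ p.pos = UPos.pos (τ p) := by
  have h : Legal K N p.pos (ℓ p.pos).1 (ℓ p.pos).2 := by rw [hp]; exact p.legal
  unfold simulate
  dsimp only
  rw [dif_pos h]
  exact congrArg (fun q => UPos.pos (τ q)) (UPos.ext rfl (by simp [hp]) (by simp [hp]))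

open Classical in
lemma simulate_congr {τ τ' : (unravel hK N).Strat} {ℓ ℓ' : T.Pos → Set T.Pos × Set T.Pos}
    {p : T.Pos} (h : ∀ s : UPos K N, T.len s.pos ≤ T.len p → τ s = τ' s) (hp : ℓ p = ℓ' p) :
    simulate τ ℓ p = simulate τ' ℓ' p := by
  have key : ∀ a b : Set T.Pos × Set T.Pos, a = b →
      (if h : Legal K N p a.1 a.2 then UPos.pos (τ ⟨p, _, _, h⟩) else (default : T.Strat) p) =
      if h : Legal K N p b.1 b.2 then UPos.pos (τ' ⟨p, _, _, h⟩) else (default : T.Strat) p := by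
    rintro a _ rfl
    split_ifs
    · rw [h _ le_rfl]
    · rfl
  exact key _ _ hp

end Unravel

end GTree

end GaleStewart

namespace GaleStewart

namespace GTree

section Unravel

variable {T : GTree} {K : ℕ} {N : Set T.Pos}

/-- The initial segment of length `K`, as a position of the unravelled game. -/
def UPos.base (K : ℕ) (N : Set T.Pos) (p : T.Pos) : UPos K N :=
  ⟨T.res K p, ∅, ∅, by
    have h := T.len_res K p
    constructor <;> intros <;> first | rfl | omega⟩

lemma UPos.eq_base {p : UPos K N} {s : T.Pos} (h : p.pos = T.res K s) : p = UPos.base K N s := by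
  have h1 := T.len_res K s
  exact UPos.ext h (p.legal.q_eq (by rw [h]; omega)) (p.legal.r_eq (by rw [h]; omega))

lemma UPos.base_congr {s t : T.Pos} (h : T.res K s = T.res K t) :
    UPos.base K N s = UPos.base K N t := UPos.eq_base h

variable {hK : K % 2 = 0}

/-- The commitment of the first player. -/
def firstQ (τ : (unravel hK N).Strat) (p : T.Pos) : Set T.Pos := UPos.q (τ (UPos.base K N p))

lemma firstQ_congr {τ : (unravel hK N).Strat} {s t : T.Pos} (h : T.res K s = T.res K t) :
    firstQ τ s = firstQ τ t := by unfold firstQ; rw [UPos.base_congr h]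

/-- The positions in `N` that may be reached after the first player's commitment. -/
def firstU (τ : (unravel hK N).Strat) : Set T.Pos := {u | u ∈ N ∧ u ∈ firstQ τ u ∧ K + 2 ≤ T.len u}

/-- The positions from which the first player cannot force the play to reach `N`. -/
def firstR (τ : (unravel hK N).Strat) (p : T.Pos) : Set T.Pos :=
  {s | s ∈ firstQ τ p ∧ K + 2 ≤ T.len s ∧ T.res K s = T.res K p ∧
    ∀ m, K + 2 ≤ m → m ≤ T.len s → ¬ Win false (firstU τ) (T.res m s)}

open Classical in
/-- The transfer of strategies for the first player. -/
noncomputable def firstStrat (τ : (unravel hK N).Strat) : T.Strat :=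
  switch false (firstU τ) (K + 2)
    (simulate τ fun p => if T.len p ≤ K then (∅, ∅) else (firstQ τ p, firstR τ p))
    (fun u => simulate τ fun p => (firstQ τ p, cone u))

lemma firstStrat_congr {τ τ' : (unravel hK N).Strat} {n : ℕ}
    (h : ∀ s : UPos K N, T.len s.pos ≤ n → τ s = τ' s) (s : T.Pos) (hs : T.len s ≤ n) :
    firstStrat τ s = firstStrat τ' s := by
  unfold firstStrat
  rcases lt_or_ge K (T.len s) with h1 | h1
  · have hQ : firstQ τ = firstQ τ' := funext fun p => by
      unfold firstQ
      rw [h]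
      exact (T.len_res K p).le.trans (by omega)
    have hU : firstU τ = firstU τ' := by unfold firstU; rw [hQ]
    have hR : firstR τ = firstR τ' := by unfold firstR; rw [hQ, hU]
    rw [hU, hQ, hR]
    exact switch_congr (simulate_congr (fun p hp => h p (hp.trans hs)) rfl)
      fun u => simulate_congr (fun p hp => h p (hp.trans hs)) rfl
  · rw [switch_of_lt (by omega), switch_of_lt (by omega)]
    exact simulate_congr (fun p hp => h p (hp.trans hs)) (by rw [if_pos h1, if_pos h1])

lemma firstStrat_transport {τ : (unravel hK N).Strat} {s : UPos K N} (hs : T.len s.pos < K) :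
    firstStrat τ s.pos = UPos.pos (τ s) := by
  unfold firstStrat
  rw [switch_of_lt (by omega)]
  refine simulate_apply _ _ _ ?_
  rw [if_pos hs.le, s.legal.q_eq hs.le, s.legal.r_eq (by omega)]

lemma even_of_turn {n : ℕ} (h : Turn false n) : n % 2 = 0 := by
  simp [Turn] at h; omega

lemma odd_of_turn {n : ℕ} (h : Turn true n) : n % 2 = 1 := by simpa [Turn] using h

lemma turn_false {n : ℕ} : Turn false n ↔ n % 2 = 0 := by simp [Turn]

lemma turn_true {n : ℕ} : Turn true n ↔ n % 2 = 1 := by simp [Turn]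

theorem firstStrat_lift {τ : (unravel hK N).Strat} {x : T.Play}
    (hx : FollowsFrom 0 false (firstStrat τ) x) :
    ∃ x' : (unravel hK N).Play, FollowsFrom 0 false τ x' ∧ (unravel.proj hK N).map x' = x := by
  have hlow : ∀ n, Turn false n → n ≤ K → ∀ p : UPos K N, p.pos = x n →
      UPos.pos (τ p) = x (n + 1) := by
    intro n ht hn p hp
    rw [hx n (Nat.zero_le _) ht]
    unfold firstStrat
    rw [switch_of_lt (by rw [x.len]; omega), ← hp]
    refine (simulate_apply _ _ _ ?_).symm
    have hl : T.len p.pos ≤ K := by rw [hp, x.len]; exact hn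
    rw [if_pos hl, p.legal.q_eq hl, p.legal.r_eq (by omega)]
  have hKp : ∀ p : UPos K N, p.pos = x K → p = UPos.base K N (x K) := fun p hp =>
    UPos.eq_base (by rw [hp, x.res le_rfl])
  have hbase : (UPos.base K N (x K)).pos = x K := x.res le_rfl
  have hK1 := hlow K (turn_false.2 hK) le_rfl _ hbase
  have hQx : ∀ m, K ≤ m → firstQ τ (x m) = firstQ τ (x K) := fun m hm =>
    firstQ_congr (by rw [x.res hm, x.res le_rfl])
  set Q := firstQ τ (x K) with hQdef
  have hleg := (τ (UPos.base K N (x K)) : UPos K N).legal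
  have hQ : IsQuasi K Q := hleg.q_quasi (by rw [hK1, x.len])
  have hxQ : x (K + 1) ∈ Q := by
    have := hleg.q_mem (by rw [hK1, x.len])
    rw [hK1, x.res le_rfl] at this
    exact this
  rcases switch_spec (fun m hm ht => hx m (Nat.zero_le _) ht) with ⟨hW, hd⟩ | ⟨n, hn, hU, hF⟩
  · set R := firstR τ (x K) with hRdef
    have hRx : ∀ m, K ≤ m → firstR τ (x m) = R := fun m hm => by
      unfold R firstR
      rw [hQx m hm, x.res hm, x.res le_rfl]
    have hA : IsAvoiding K N Q R := by
      rintro s ⟨h1, h2, h3, h4⟩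
      refine ⟨h1, fun h5 => ?_, fun _ => ⟨fun h5 => ?_, fun h5 t ht htQ => ?_⟩⟩
      · refine h4 (T.len s) h2 le_rfl (win_of_mem ?_)
        rw [res_of_le le_rfl]
        exact ⟨h5, by rw [firstQ_congr h3]; exact h1, h2⟩
      · have hs := h4 (T.len s) h2 le_rfl
        rw [res_of_le le_rfl] at hs
        by_contra hcon
        refine hs (win_of_forall_child fun t ht => ?_)
        by_contra ht'
        refine hcon ⟨t, ht, (hQ s h1 (by omega)).1 h5 t ht, by rw [ht.2]; omega,
          by rw [ht.res (by omega), h3], fun m hm hm' => ?_⟩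
        rcases hm'.lt_or_eq with h6 | h6
        · rw [ht.2] at h6
          rw [ht.res (by omega)]; exact h4 m hm (by omega)
        · rw [res_of_le h6.ge]; exact ht'
      · have hs := h4 (T.len s) h2 le_rfl
        rw [res_of_le le_rfl] at hs
        refine ⟨htQ, by rw [ht.2]; omega, by rw [ht.res (by omega), h3], fun m hm hm' => ?_⟩
        rcases hm'.lt_or_eq with h6 | h6
        · rw [ht.2] at h6
          rw [ht.res (by omega)]; exact h4 m hm (by omega)
        · rw [res_of_le h6.ge]
          exact fun hw => hs (win_of_child (turn_false.2 h5) ht hw)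
    have hmem : ∀ n, K + 2 ≤ n → x n ∈ Q → x n ∈ R := fun n hn h =>
      ⟨h, by rw [x.len]; exact hn, by rw [x.res (by omega), x.res le_rfl], fun m h1 h2 => by
        rw [x.len] at h2
        rw [x.res h2]; exact hW m h1⟩
    have hdn : ∀ n, K + 2 ≤ n → Turn false n → ∀ p : UPos K N, p.pos = x n → p.q = Q → p.r = R →
        UPos.pos (τ p) = x (n + 1) := by
      intro n hn ht p hp hq hr
      rw [hd n hn ht, ← hp]
      refine (simulate_apply _ _ _ ?_).symm
      rw [if_neg (by rw [hp, x.len]; omega), hp, hQx n (by omega), hRx n (by omega), hq, hr]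
    have hxR : ∀ n, K + 2 ≤ n → x n ∈ R := by
      intro n hn
      induction n using Nat.strong_induction_on with
      | _ n ih =>
      refine hmem n hn ?_
      rcases hn.eq_or_lt with h1 | h1
      · rw [← h1]
        exact (hQ _ hxQ (by rw [x.len])).1 (by rw [x.len]; omega) _ (x.isChild _)
      obtain ⟨n, rfl⟩ : ∃ m, n = m + 1 := ⟨n - 1, by omega⟩
      rcases Nat.mod_two_eq_zero_or_one n with h2 | h2
      · have hl : Legal K N (x n) Q R := by
          constructor
          · intro h; rw [x.len] at h; omega
          · intro h; rw [x.len] at h; omega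
          · exact fun _ => hQ
          · intro _; rw [x.res (by omega)]; exact hxQ
          · exact fun _ => .inr hA
          · intro m h3 h4
            rw [x.len] at h4
            rw [x.res h4]; exact ih m (by omega) h3
        let p : UPos K N := ⟨x n, Q, R, hl⟩
        have h3 := hdn n (by omega) (turn_false.2 h2) p rfl rfl rfl
        have h4 : UPos.r (τ p) = R := unravel.child_r (τ.2 p) (by
          change _ ≤ T.len (x n); rw [x.len]; omega)
        have h5 := (τ p : UPos K N).legal.r_mem (n + 1) hn (by rw [h3, x.len])
        rw [h4, h3, x.res le_rfl] at h5
        exact h5.1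
      · exact (hQ _ (ih n (by omega) (by omega)).1 (by rw [x.len]; omega)).1
          (by rw [x.len]; exact h2) _ (x.isChild n)
    refine unravel.exists_lift hQ hxQ (.inr hA) hxR fun n ht p hp hq hr => ?_
    have he := even_of_turn ht
    rcases le_or_gt n K with h1 | h1
    · refine ⟨hlow n ht h1 p hp, fun h => ?_, by omega⟩
      subst h
      rw [hKp p hp]; rfl
    · exact ⟨hdn n (by omega) ht p hp (hq (by omega)) (hr (by omega)), by omega, by omega⟩
  · obtain ⟨hU1, hU2, hU3⟩ := hU
    rw [hQx n (by omega)] at hU2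
    refine unravel.exists_lift (R := cone (x n)) hQ hxQ (.inl ⟨x n, hU2, hU1, hU3, rfl⟩)
      (fun m _ => x.mem_cone m n) fun m ht p hp hq hr => ?_
    have he := even_of_turn ht
    rcases le_or_gt m K with h1 | h1
    · refine ⟨hlow m ht h1 p hp, fun h => ?_, by omega⟩
      subst h
      rw [hKp p hp]; rfl
    refine ⟨?_, by omega, by omega⟩
    have hc := unravel.child_pos (τ.2 p)
    have hlp : T.len p.pos = m := by rw [hp, x.len]
    rcases le_or_gt n m with h2 | h2
    · rw [hF m h2 ht, ← hp]
      refine (simulate_apply _ _ _ ?_).symm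
      rw [hp, hQx m (by omega), hq (by omega), hr (by omega)]
    · have h4 : UPos.r (τ p) = cone (x n) := by
        rw [unravel.child_r (τ.2 p) (by omega), hr (by omega)]
      have hl : T.len (UPos.pos (τ p)) = m + 1 := by rw [hc.2, hlp]
      have h5 := (τ p : UPos K N).legal.r_mem (m + 1) (by omega) hl.ge
      rw [h4, res_of_le hl.le] at h5
      rw [eq_res_of_mem_cone h5 (by rw [hl, x.len]; omega), hl, x.res (by omega)]

end Unravel

end GTree

end GaleStewart

namespace GaleStewart

namespace GTree

section Unravel

variable {T : GTree} {K : ℕ} {N : Set T.Pos} {hK : K % 2 = 0}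

open Classical in
/-- The answer of the second player to the commitment `Q`. -/
noncomputable def secondR (τ : (unravel hK N).Strat) (p : T.Pos) (Q : Set T.Pos) : Set T.Pos :=
  if h : Legal K N (T.res (K + 1) p) Q ∅ then UPos.r (τ ⟨_, _, _, h⟩) else ∅

lemma secondR_eq {τ : (unravel hK N).Strat} {p : UPos K N} {s : T.Pos}
    (hp : p.pos = T.res (K + 1) s) : secondR τ s p.q = UPos.r (τ p) := by
  have hr : p.r = ∅ := p.legal.r_eq (by rw [hp, T.len_res]; omega)
  have h : Legal K N (T.res (K + 1) s) p.q ∅ := by rw [← hp, ← hr]; exact p.legal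
  unfold secondR
  rw [dif_pos h]
  exact congrArg (fun q => UPos.r (τ q)) (UPos.ext hp.symm rfl hr.symm)

/-- The first player's commitment `Q` makes the second player aim at `u`. -/
def Aims (τ : (unravel hK N).Strat) (u : T.Pos) (Q : Set T.Pos) : Prop :=
  Legal K N (T.res (K + 1) u) Q ∅ ∧ secondR τ u Q = cone u ∧ u ∈ N ∧ u ∈ Q

/-- The positions that the second player aims at after some commitment of the first. -/
def secondU (τ : (unravel hK N).Strat) : Set T.Pos := {u | K + 2 ≤ T.len u ∧ ∃ Q, Aims τ u Q}

/-- The positions from which the second player cannot force the play into `secondU τ`. -/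
def secondQ (τ : (unravel hK N).Strat) : Set T.Pos :=
  {v | ∀ m, K + 1 ≤ m → m ≤ T.len v → ¬ Win true (secondU τ) (T.res m v)}

open Classical in
/-- A commitment making the second player aim at `u`. -/
noncomputable def aimQ (τ : (unravel hK N).Strat) (u : T.Pos) : Set T.Pos :=
  if h : ∃ Q, Aims τ u Q then h.choose else ∅

lemma aimQ_spec {τ : (unravel hK N).Strat} {u : T.Pos} (h : ∃ Q, Aims τ u Q) :
    Aims τ u (aimQ τ u) := by
  unfold aimQ
  rw [dif_pos h]
  exact h.choose_spec

open Classical in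
/-- The transfer of strategies for the second player. -/
noncomputable def secondStrat (τ : (unravel hK N).Strat) : T.Strat :=
  switch true (secondU τ) (K + 1)
    (simulate τ fun p => if T.len p ≤ K then (∅, ∅) else
      if T.len p = K + 1 then (secondQ τ, ∅) else (secondQ τ, secondR τ p (secondQ τ)))
    (fun u => simulate τ fun _ => (aimQ τ u, cone u))

lemma secondStrat_congr {τ τ' : (unravel hK N).Strat} {n : ℕ}
    (h : ∀ s : UPos K N, T.len s.pos ≤ n → τ s = τ' s) (s : T.Pos) (hs : T.len s ≤ n) :
    secondStrat τ s = secondStrat τ' s := by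
  unfold secondStrat
  rcases lt_or_ge K (T.len s) with h1 | h1
  · have hR : secondR τ = secondR τ' := funext fun p => funext fun Q => by
      unfold secondR
      split_ifs with hl
      · rw [h _ ((T.len_res (K + 1) p).le.trans (by omega))]
      · rfl
    have hA : Aims τ = Aims τ' := by unfold Aims; rw [hR]
    have hU : secondU τ = secondU τ' := by unfold secondU; rw [hA]
    have hQ : secondQ τ = secondQ τ' := by unfold secondQ; rw [hU]
    have haQ : aimQ τ = aimQ τ' := by unfold aimQ; rw [hA]
    rw [hU, hQ, hR, haQ]
    exact switch_congr (simulate_congr (fun p hp => h p (hp.trans hs)) rfl)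
      fun u => simulate_congr (fun p hp => h p (hp.trans hs)) rfl
  · rw [switch_of_lt (by omega), switch_of_lt (by omega)]
    exact simulate_congr (fun p hp => h p (hp.trans hs)) (by rw [if_pos h1, if_pos h1])

lemma secondStrat_transport {τ : (unravel hK N).Strat} {s : UPos K N} (hs : T.len s.pos < K) :
    secondStrat τ s.pos = UPos.pos (τ s) := by
  unfold secondStrat
  rw [switch_of_lt (by omega)]
  refine simulate_apply _ _ _ ?_
  rw [if_pos hs.le, s.legal.q_eq hs.le, s.legal.r_eq (by omega)]

lemma isQuasi_secondQ (τ : (unravel hK N).Strat) : IsQuasi K (secondQ τ) := by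
  intro s h1 h2
  have hs := h1 (T.len s) h2 le_rfl
  rw [res_of_le le_rfl] at hs
  have key : ∀ t, T.IsChild s t → ¬ Win true (secondU τ) t → t ∈ secondQ τ := by
    intro t ht hw m hm hm'
    rcases hm'.lt_or_eq with h6 | h6
    · rw [ht.2] at h6
      rw [ht.res (by omega)]; exact h1 m hm (by omega)
    · rw [res_of_le h6.ge]; exact hw
  refine ⟨fun h5 t ht => key t ht fun hw => hs (win_of_child (turn_true.2 h5) ht hw), fun h5 => ?_⟩
  by_contra hcon
  refine hs (win_of_forall_child fun t ht => ?_)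
  by_contra ht'
  exact hcon ⟨t, ht, key t ht ht'⟩

lemma legal_succ {x : T.Play} {Q : Set T.Pos} (hQ : IsQuasi K Q) (hxQ : x (K + 1) ∈ Q) :
    Legal K N (x (K + 1)) Q ∅ := by
  constructor
  · intro h; rw [x.len] at h; omega
  · exact fun _ => rfl
  · exact fun _ => hQ
  · intro _; rw [x.res le_rfl]; exact hxQ
  · intro h; rw [x.len] at h; omega
  · intro m h1 h2; rw [x.len] at h2; omega

theorem secondStrat_lift {τ : (unravel hK N).Strat} {x : T.Play}
    (hx : FollowsFrom 0 true (secondStrat τ) x) :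
    ∃ x' : (unravel hK N).Play, FollowsFrom 0 true τ x' ∧ (unravel.proj hK N).map x' = x := by
  have hlow : ∀ n, Turn true n → n < K → ∀ p : UPos K N, p.pos = x n →
      UPos.pos (τ p) = x (n + 1) := by
    intro n ht hn p hp
    rw [hx n (Nat.zero_le _) ht]
    unfold secondStrat
    rw [switch_of_lt (by rw [x.len]; omega), ← hp]
    refine (simulate_apply _ _ _ ?_).symm
    have hl : T.len p.pos ≤ K := by rw [hp, x.len]; exact hn.le
    rw [if_pos hl, p.legal.q_eq hl, p.legal.r_eq (by omega)]
  rcases switch_spec (fun m hm ht => hx m (Nat.zero_le _) ht) with ⟨hW, hd⟩ | ⟨n, hn, hU, hF⟩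
  · set Q := secondQ τ with hQdef
    have hQ : IsQuasi K Q := isQuasi_secondQ τ
    have hxQ : ∀ n, x n ∈ Q := fun n m h1 h2 => by
      rw [x.len] at h2
      rw [x.res h2]; exact hW m h1
    let p₁ : UPos K N := ⟨x (K + 1), Q, ∅, legal_succ hQ (hxQ _)⟩
    set R := UPos.r (τ p₁) with hRdef
    have hRx : ∀ m, K + 1 ≤ m → secondR τ (x m) Q = R := fun m hm =>
      secondR_eq (p := p₁) (by rw [x.res hm])
    have hdn : ∀ n, K + 1 ≤ n → Turn true n → ∀ p : UPos K N, p.pos = x n → p.q = Q →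
        (K + 2 ≤ n → p.r = R) → UPos.pos (τ p) = x (n + 1) := by
      intro n hn ht p hp hq hr
      rw [hd n hn ht, ← hp]
      refine (simulate_apply _ _ _ ?_).symm
      have hl : T.len p.pos = n := by rw [hp, x.len]
      rw [if_neg (by omega)]
      split_ifs with h
      · rw [hq, p.legal.r_eq (by omega)]
      · rw [hp, hRx n (by omega), hq, hr (by omega)]
    have hp1 : UPos.pos (τ p₁) = x (K + 2) :=
      hdn (K + 1) le_rfl (turn_true.2 (by omega)) p₁ rfl rfl (by omega)
    have hq1 : UPos.q (τ p₁) = Q :=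
      unravel.child_q (τ.2 p₁) (by change _ ≤ T.len (x _); rw [x.len])
    have hleg := (τ p₁ : UPos K N).legal
    rw [hp1, hq1] at hleg
    have hxR2 : x (K + 2) ∈ R := by
      have := hleg.r_mem (K + 2) le_rfl (by rw [x.len])
      rwa [x.res le_rfl] at this
    have hA : IsAvoiding K N Q R := by
      refine (hleg.r_or (by rw [x.len])).resolve_left ?_
      rintro ⟨u, hu1, hu2, hu3, hu4⟩
      change R = cone u at hu4
      have h1 : x (K + 1) = T.res (K + 1) u := by
        have h2 := hxR2
        rw [hu4] at h2
        have h3 := eq_res_of_mem_cone h2 (by rw [x.len]; exact hu3)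
        rw [x.len] at h3
        rw [← x.res (Nat.le_succ (K + 1)), h3, res_res (by omega)]
      refine hW (K + 1) le_rfl ?_
      have h2 := hu1 (K + 1) le_rfl (by omega)
      refine absurd (win_of_mem (T := T) ?_) (by
        have := hu1 (T.len u) (by omega) le_rfl
        rwa [res_of_le le_rfl] at this)
      refine ⟨hu3, Q, ?_, ?_, hu2, hu1⟩
      · rw [← h1]; exact legal_succ hQ (hxQ _)
      · exact (secondR_eq (p := p₁) h1).trans hu4
    have hxR : ∀ n, K + 2 ≤ n → x n ∈ R := by
      intro n hn
      induction n using Nat.strong_induction_on with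
      | _ n ih =>
      rcases hn.eq_or_lt with h1 | h1
      · rwa [← h1]
      obtain ⟨n, rfl⟩ : ∃ m, n = m + 1 := ⟨n - 1, by omega⟩
      rcases Nat.mod_two_eq_zero_or_one n with h2 | h2
      · exact ((hA _ (ih n (by omega) (by omega))).2.2 (by rw [x.len]; omega)).2
          (by rw [x.len]; exact h2) _ (x.isChild n) (hxQ _)
      · have hl : Legal K N (x n) Q R := by
          constructor
          · intro h; rw [x.len] at h; omega
          · intro h; rw [x.len] at h; omega
          · exact fun _ => hQ
          · intro _; rw [x.res (by omega)]; exact hxQ _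
          · exact fun _ => .inr hA
          · intro m h3 h4
            rw [x.len] at h4
            rw [x.res h4]; exact ih m (by omega) h3
        let p : UPos K N := ⟨x n, Q, R, hl⟩
        have h3 := hdn n (by omega) (turn_true.2 h2) p rfl rfl (fun _ => rfl)
        have h4 : UPos.r (τ p) = R := unravel.child_r (p := p) (τ.2 p) (by
          change _ ≤ T.len (x n); rw [x.len]; omega)
        have h5 := (τ p : UPos K N).legal.r_mem (n + 1) hn (by rw [h3, x.len])
        rwa [h4, h3, x.res le_rfl] at h5
    refine unravel.exists_lift hQ (hxQ _) (.inr hA) hxR fun n ht p hp hq hr => ?_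
    have he := odd_of_turn ht
    rcases lt_or_ge n K with h1 | h1
    · exact ⟨hlow n ht h1 p hp, by omega, by omega⟩
    refine ⟨hdn n (by omega) ht p hp (hq (by omega)) hr, by omega, ?_⟩
    rintro rfl
    rw [show p = p₁ from UPos.ext hp (hq le_rfl) (p.legal.r_eq (by rw [hp, x.len]))]
  · obtain ⟨hU3, hU4⟩ := hU
    obtain ⟨hU1, hU2, hU5, hU6⟩ := aimQ_spec hU4
    rw [x.len] at hU3
    rw [x.res hn] at hU1
    set Q := aimQ τ (x n) with hQdef
    have hQ : IsQuasi K Q := hU1.q_quasi (by rw [x.len])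
    have hxQ : x (K + 1) ∈ Q := by
      have := hU1.q_mem (by rw [x.len])
      rwa [x.res le_rfl] at this
    refine unravel.exists_lift (R := cone (x n)) hQ hxQ
      (.inl ⟨x n, hU6, hU5, by rwa [x.len], rfl⟩) (fun m _ => x.mem_cone m n) fun m ht p hp hq hr => ?_
    have he := odd_of_turn ht
    rcases lt_or_ge m K with h1 | h1
    · exact ⟨hlow m ht h1 p hp, by omega, by omega⟩
    have hlp : T.len p.pos = m := by rw [hp, x.len]
    have hr' : UPos.r (τ p) = cone (x n) := by
      rcases (show K + 1 ≤ m by omega).eq_or_lt with h2 | h2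
      · rw [← secondR_eq (s := x n) (by rw [hp, x.res hn, h2]), hq (by omega), hU2]
      · rw [unravel.child_r (τ.2 p) (by omega), hr (by omega)]
    refine ⟨?_, by omega, fun _ => hr'⟩
    rcases le_or_gt n m with h2 | h2
    · rw [hF m h2 ht, ← hp]
      exact (simulate_apply _ _ _ (by rw [hq (by omega), hr (by omega)])).symm
    · have hl : T.len (UPos.pos (τ p)) = m + 1 := by rw [(unravel.child_pos (τ.2 p)).2, hlp]
      have h5 := (τ p : UPos K N).legal.r_mem (m + 1) (by omega) hl.ge
      rw [hr', res_of_le hl.le] at h5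
      rw [eq_res_of_mem_cone h5 (by rw [hl, x.len]; omega), hl, x.res (by omega)]

theorem unravel.isCov (hK : K % 2 = 0) (N : Set T.Pos) : IsCov K (unravel.proj hK N) := by
  refine ⟨fun s hs => ⟨UPos.base K N s, res_of_le hs, fun p hp => ?_⟩, fun ε => ?_⟩
  · exact UPos.eq_base (Eq.trans hp (res_of_le hs).symm)
  cases ε
  · exact ⟨firstStrat, fun τ τ' n h s hs => firstStrat_congr h s hs,
      fun τ s hs => firstStrat_transport hs, fun τ x hx => firstStrat_lift hx⟩
  · exact ⟨secondStrat, fun τ τ' n h s hs => secondStrat_congr h s hs,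
      fun τ s hs => secondStrat_transport hs, fun τ x hx => secondStrat_lift hx⟩

/-- The second player's commitment decides whether a play avoids `N`. -/
lemma unravel.mem_iff {hK : K % 2 = 0}
    (hN : ∀ (x : T.Play) (m n : ℕ), m ≤ n → x m ∈ N → x n ∈ N) (x : (unravel hK N).Play) :
    (∀ n, (unravel.proj hK N).map x n ∉ N) ↔
      IsAvoiding K N (UPos.q (x (K + 2))) (UPos.r (x (K + 2))) := by
  set y := (unravel.proj hK N).map x with hy
  have hyx : ∀ n, UPos.pos (x n) = y n := fun _ => rfl
  have hQR : ∀ n, K + 2 ≤ n → UPos.q (x n) = UPos.q (x (K + 2)) ∧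
      UPos.r (x n) = UPos.r (x (K + 2)) := by
    intro n hn
    induction n, hn using Nat.le_induction with
    | base => exact ⟨rfl, rfl⟩
    | succ n hn ih =>
      rw [← ih.1, ← ih.2]
      exact ⟨unravel.child_q (x.isChild n) (by rw [hyx, y.len]; omega),
        unravel.child_r (x.isChild n) (by rw [hyx, y.len]; omega)⟩
  have hmem : ∀ n, K + 2 ≤ n → y n ∈ UPos.r (x (K + 2)) := by
    intro n hn
    have := (x n : UPos K N).legal.r_mem n hn (by rw [hyx, y.len])
    rwa [hyx, y.res le_rfl, (hQR n hn).2] at this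
  constructor
  · intro h
    refine ((x (K + 2) : UPos K N).legal.r_or (by rw [hyx, y.len])).resolve_left ?_
    rintro ⟨u, hu1, hu2, hu3, hu4⟩
    refine h (T.len u) ?_
    have h1 := hmem (T.len u) hu3
    rw [hu4] at h1
    have h2 := eq_res_of_mem_cone h1 (by rw [y.len])
    rw [y.len, res_of_le le_rfl] at h2
    rwa [h2]
  · intro hA n hn
    exact (hA _ (hmem (max n (K + 2)) (le_max_right _ _))).2.1
      (hN y n _ (le_max_left _ _) hn)

end Unravel

end GTree

end GaleStewart

namespace GaleStewart

namespace GTree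

section Borel

/-- A set of plays containing all its limits. -/
def Closed {T : GTree} (X : Set T.Play) : Prop :=
  ∀ x : T.Play, (∀ n, ∃ y ∈ X, y.1 n = x n) → x ∈ X

lemma Closed.preimage {T' T : GTree} (f : Hom T' T) {X : Set T.Play} (hX : Closed X) :
    Closed (f.map ⁻¹' X) := fun x hx => hX _ fun n => by
  obtain ⟨y, hy, hyx⟩ := hx n
  exact ⟨f.map y, hy, congrArg f hyx⟩

lemma closed_of_decided {T : GTree} {P : T.Pos → Prop} (n : ℕ) : Closed {x : T.Play | P (x n)} := by
  intro x hx
  obtain ⟨y, hy, hyx⟩ := hx n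
  change P _
  rw [← hyx]
  exact hy

theorem Closed.exists_cover {T : GTree} {X : Set T.Play} (hX : Closed X) (k : ℕ) :
    ∃ (T' : GTree) (π : Hom T' T), IsCov k π ∧ Closed (π.map ⁻¹' X) ∧ Closed (π.map ⁻¹' X)ᶜ := by
  let N : Set T.Pos := {s | ¬ ∃ y ∈ X, y.1 (T.len s) = s}
  have hN : ∀ (x : T.Play) (m n : ℕ), m ≤ n → x m ∈ N → x n ∈ N := by
    rintro x m n hmn hx ⟨y, hy, hyx⟩
    refine hx ⟨y, hy, ?_⟩
    rw [x.len] at hyx ⊢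
    rw [← x.res hmn, ← hyx, Play.res y hmn]
  have hXN : ∀ x : T.Play, x ∈ X ↔ ∀ n, x n ∉ N := by
    refine fun x => ⟨fun hx n hn => hn ⟨x, hx, by rw [x.len]⟩, fun h => hX x fun n => ?_⟩
    have := not_not.1 (h n)
    rwa [x.len] at this
  have hK : (2 * k) % 2 = 0 := by omega
  have heq : (unravel.proj hK N).map ⁻¹' X = {x | IsAvoiding (2 * k) N
      (UPos.q (x.1 (2 * k + 2))) (UPos.r (x.1 (2 * k + 2)))} := by
    ext x
    rw [Set.mem_preimage, hXN, unravel.mem_iff hN]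
    rfl
  refine ⟨unravel hK N, unravel.proj hK N, (unravel.isCov hK N).mono (by omega), ?_, ?_⟩
  · rw [heq]
    exact closed_of_decided (T := unravel hK N)
      (P := fun p => IsAvoiding (2 * k) N (UPos.q p) (UPos.r p)) _
  · rw [heq]
    exact closed_of_decided (T := unravel hK N)
      (P := fun p => ¬ IsAvoiding (2 * k) N (UPos.q p) (UPos.r p)) _

/-- The set `X` becomes clopen in suitable coverings of any tree mapping to `T`. -/
def Unravelable {T : GTree} (X : Set T.Play) : Prop :=
  ∀ (S : GTree) (f : Hom S T) (k : ℕ), ∃ (S' : GTree) (π : Hom S' S), IsCov k π ∧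
    Closed ((f.comp π).map ⁻¹' X) ∧ Closed ((f.comp π).map ⁻¹' X)ᶜ

lemma Closed.unravelable {T : GTree} {X : Set T.Play} (hX : Closed X) : Unravelable X :=
  fun _ f k => (hX.preimage f).exists_cover k

lemma Unravelable.compl {T : GTree} {X : Set T.Play} (hX : Unravelable X) : Unravelable Xᶜ := by
  intro S f k
  obtain ⟨S', π, h1, h2, h3⟩ := hX S f k
  refine ⟨S', π, h1, h3, ?_⟩
  rw [Set.preimage_compl, compl_compl]
  exact h2

lemma Unravelable.iUnion {T : GTree} {X : ℕ → Set T.Play} (hX : ∀ i, Unravelable (X i)) :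
    Unravelable (⋃ i, X i) := by
  intro S f k
  choose nextT nextπ hcov hcl hop using fun i (s : Σ S : GTree, Hom S T) => hX i s.1 s.2 (k + i)
  let st : ℕ → Σ S : GTree, Hom S T :=
    fun i => Nat.rec ⟨S, f⟩ (fun i s => ⟨nextT i s, s.2.comp (nextπ i s)⟩) i
  let π : ∀ i, Hom (st (i + 1)).1 (st i).1 := fun i => nextπ i (st i)
  have hπ : ∀ i, IsCov (k + i) (π i) := fun i => hcov i (st i)
  let L := limit (T := fun i => (st i).1) π k (fun i => (hπ i).bij)
  let pr : ∀ i, Hom L (st i).1 := limit.proj (T := fun i => (st i).1) (π := π) (fun i => (hπ i).bij)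
  let ρ : Hom L S := pr 0
  have hρ : IsCov k ρ := limit.isCov (T := fun i => (st i).1) hπ
  have hmap : ∀ i (s : L.Pos), (st i).2 (s.1 i) = f (s.1 0) := by
    intro i s
    induction i with
    | zero => rfl
    | succ i ih => exact (congrArg (st i).2 (s.2 i)).trans ih
  have hpre : ∀ i, (f.comp ρ).map ⁻¹' (X i) = (pr (i + 1)).map ⁻¹'
      (((st i).2.comp (π i)).map ⁻¹' (X i)) := by
    intro i
    ext x
    have : (f.comp ρ).map x =
        ((st i).2.comp (π i)).map ((pr (i + 1)).map x) :=
      Subtype.ext (funext fun n => (hmap (i + 1) (x n)).symm)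
    rw [Set.mem_preimage, this]
    rfl
  have hcompl : Closed ((f.comp ρ).map ⁻¹' (⋃ i, X i))ᶜ := by
    intro x hx h
    obtain ⟨i, hi⟩ := Set.mem_iUnion.1 h
    have h1 : Closed ((f.comp ρ).map ⁻¹' (X i))ᶜ := by
      rw [hpre]
      exact (hop i (st i)).preimage _
    refine h1 x (fun n => ?_) hi
    obtain ⟨y, hy, hyx⟩ := hx n
    exact ⟨y, fun h => hy (Set.mem_iUnion.2 ⟨i, h⟩), hyx⟩
  obtain ⟨L', σ, h1, h2, h3⟩ := hcompl.exists_cover k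
  refine ⟨L', ρ.comp σ, hρ.comp h1, ?_, h2⟩
  rw [Set.preimage_compl, compl_compl] at h3
  exact h3

end Borel

/-- The tree of finite sequences of natural numbers, with the most recent entry first. -/
def seqTree : GTree where
  Pos := List ℕ
  len := List.length
  pred := List.tail
  len_pred _ := List.length_tail
  exists_child s := ⟨0 :: s, rfl, rfl⟩

end GTree

/-- The first `n` terms of a sequence, the most recent one first. -/
def hist (z : ℕ → ℕ) : ℕ → List ℕ
  | 0 => []
  | n + 1 => z n :: hist z n

lemma hist_congr {z z' : ℕ → ℕ} {n : ℕ} (h : ∀ m < n, z m = z' m) : hist z n = hist z' n := by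
  induction n with
  | zero => rfl
  | succ n ih => rw [hist, hist, h n (by omega), ih fun m hm => h m (by omega)]

lemma length_hist (z : ℕ → ℕ) (n : ℕ) : (hist z n).length = n := by
  induction n with
  | zero => rfl
  | succ n ih => rw [hist, List.length_cons, ih]

namespace GTree

/-- The play of `seqTree` given by a sequence. -/
def seqPlay (z : ℕ → ℕ) : seqTree.Play := ⟨hist z, fun n => ⟨length_hist z n, rfl⟩⟩

/-- The sequence played. -/
def Play.toSeq (x : seqTree.Play) (n : ℕ) : ℕ := List.headI (x (n + 1) : List ℕ)

lemma toSeq_seqPlay (z : ℕ → ℕ) : (seqPlay z).toSeq = z := rfl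

lemma unravelable_of_measurableSet {B : Set (ℕ → ℕ)} (hB : MeasurableSet B) :
    Unravelable (Play.toSeq ⁻¹' B) := by
  let m : MeasurableSpace (ℕ → ℕ) :=
    { MeasurableSet' := fun B => Unravelable (Play.toSeq ⁻¹' B)
      measurableSet_empty := Closed.unravelable fun x hx => (hx 0).choose_spec.1.elim
      measurableSet_compl := fun B hB => hB.compl
      measurableSet_iUnion := fun B hB => by
        rw [Set.preimage_iUnion]
        exact Unravelable.iUnion hB }
  have hle : (MeasurableSpace.pi : MeasurableSpace (ℕ → ℕ)) ≤ m := by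
    refine iSup_le fun n => ?_
    rintro _ ⟨S, -, rfl⟩
    exact (closed_of_decided (T := seqTree) (P := fun p => List.headI (p : List ℕ) ∈ S)
      (n + 1)).unravelable
  exact hle B hB

/-- Every strategy is given by a function. -/
lemma followsFrom_of_eq {ε : Bool} {τ : seqTree.Strat} {z : ℕ → ℕ}
    (h : ∀ n, Turn ε n → z n = List.headI (τ (hist z n) : List ℕ)) :
    FollowsFrom 0 ε τ (seqPlay z) := by
  intro n _ ht
  change z n :: hist z n = (τ (hist z n) : List ℕ)
  rw [h n ht]
  obtain ⟨h1, h2⟩ := τ.2 (hist z n)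
  change List.tail (τ (hist z n)) = hist z n at h1
  change List.length (τ (hist z n)) = (hist z n).length + 1 at h2
  revert h1 h2
  generalize hl : (τ.1 (hist z n) : List ℕ) = l
  rintro h1 h2
  cases l with
  | nil => simp at h2
  | cons a l => rw [← h1]; rfl

end GTree

open GTree in
/-- Borel determinacy. -/
theorem borel_determinacy {B : Set (ℕ → ℕ)} (hB : MeasurableSet B) :
    ∃ (ε : Bool) (τ : List ℕ → ℕ), ∀ z : ℕ → ℕ, (∀ n, Turn ε n → z n = τ (hist z n)) →
      (z ∈ B ↔ ε = false) := by
  obtain ⟨T, π, hπ, -, hcl⟩ := unravelable_of_measurableSet hB seqTree (Hom.id _) 0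
  set P : Set T.Play := ((Hom.id seqTree).comp π).map ⁻¹' (Play.toSeq ⁻¹' B)
  obtain ⟨s, hs1, hs2⟩ := hπ.bij ([] : List ℕ) (le_refl 0)
  have hs : T.len s = 0 := by rw [← π.len_map, hs1]; rfl
  have key : ∀ (ε : Bool) (σ : T.Strat),
      (∀ x : T.Play, x 0 = s → FollowsFrom 0 ε σ x → (x ∈ P ↔ ε = false)) →
      ∃ τ : List ℕ → ℕ, ∀ z : ℕ → ℕ, (∀ n, Turn ε n → z n = τ (hist z n)) →
      (z ∈ B ↔ ε = false) := by
    intro ε σ hσ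
    obtain ⟨φ, -, -, hφ⟩ := hπ.lift ε
    refine ⟨fun l => List.headI (φ σ l : List ℕ), fun z hz => ?_⟩
    obtain ⟨x, hx1, hx2⟩ := hφ σ (seqPlay z) (followsFrom_of_eq hz)
    rw [← hσ x (hs2 _ (congrArg (fun w : seqTree.Play => w.1 0) hx2)) hx1]
    change z ∈ B ↔ (π.map x).toSeq ∈ B
    rw [hx2, toSeq_seqPlay]
  rcases open_determinacy false {p : T.Pos | ∀ y : T.Play, y (T.len p) = p → y ∈ P} s hs with
    ⟨σ, hσ⟩ | ⟨σ, hσ⟩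
  · refine ⟨false, key false σ fun x hx hf => ?_⟩
    obtain ⟨n, hn⟩ := hσ x hx hf
    simpa using hn x (by rw [x.len])
  · refine ⟨true, key true σ fun x hx hf => ?_⟩
    have : x ∈ Pᶜ := hcl x fun n => by
      have h := hσ x hx hf n
      simp only [Set.mem_ofPred_eq, not_forall, x.len] at h
      obtain ⟨y, hy, hyP⟩ := h
      exact ⟨y, hyP, hy⟩
    simpa using this

end GaleStewart

namespace MarksLemma

open MulAction

variable {G X : Type} [Group G] [MulAction G X] {H : Bool → Subgroup G}

/-- Disjoint measurable sets such that the orbits of each of the two subgroups that meet their union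
in points with trivial isotropy meet the set with the same index. -/
structure IsSeed [MeasurableSpace X] (H : Bool → Subgroup G) (O : Bool → Set X) : Prop where
  measurable : ∀ b, MeasurableSet (O b)
  disjoint : ∀ x, x ∈ O false → x ∉ O true
  step : ∀ b, ∀ x ∈ O (!b), (∃ h ∈ H b, h ≠ 1 ∧ h • x = x) ∨ ∃ h ∈ H b, h • x ∈ O b

/-- The points whose `H b`-orbit has distance at most `n` from `O`. -/
def near (H : Bool → Subgroup G) (O : Bool → Set X) : ℕ → Bool → Set X
  | 0, b => {x | ∃ h ∈ H b, ∃ c, h • x ∈ O c}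
  | n + 1, b => {x | ∃ h ∈ H b, h • x ∈ near H O n (!b)}

lemma near_smul {O : Bool → Set X} {n : ℕ} {b : Bool} {x : X} {h : G} (hh : h ∈ H b) :
    h • x ∈ near H O n b ↔ x ∈ near H O n b := by
  have key : ∀ (h : G) (_ : h ∈ H b) (x : X), h • x ∈ near H O n b → x ∈ near H O n b := by
    intro h hh x
    cases n with
    | zero =>
      rintro ⟨k, hk, hx⟩
      rw [smul_smul] at hx
      exact ⟨k * h, mul_mem hk hh, hx⟩
    | succ n =>
      rintro ⟨k, hk, hx⟩
      rw [smul_smul] at hx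
      exact ⟨k * h, mul_mem hk hh, hx⟩
  refine ⟨key h hh x, fun hx => key h⁻¹ (inv_mem hh) _ ?_⟩
  rwa [inv_smul_smul]

lemma exists_near (hH : Subgroup.closure (⋃ b, (H b : Set G)) = ⊤) {O : Bool → Set X} {x : X}
    (hx : ∃ (g : G) (b : Bool), g • x ∈ O b) (b : Bool) : ∃ n, x ∈ near H O n b := by
  let A : Set X := {x | ∃ n b, x ∈ near H O n b}
  have hA : ∀ b, ∀ h ∈ H b, ∀ y ∈ A, h • y ∈ A := by
    rintro b h hh y ⟨n, c, hy⟩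
    by_cases hcb : c = b
    · subst hcb
      exact ⟨n, c, (near_smul hh).2 hy⟩
    · refine ⟨n + 1, b, h⁻¹, inv_mem hh, ?_⟩
      rw [inv_smul_smul, ← Bool.eq_not.2 hcb]
      exact hy
  let S : Subgroup G :=
    { carrier := {g | ∀ y, g • y ∈ A ↔ y ∈ A}
      mul_mem' := fun {a b} ha hb y => by rw [mul_smul, ha, hb]
      one_mem' := fun y => by rw [one_smul]
      inv_mem' := fun {a} ha y => by rw [← ha, smul_inv_smul] }
  have hS : S = ⊤ := by
    rw [eq_top_iff, ← hH, Subgroup.closure_le]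
    intro h hh y
    obtain ⟨b, hb⟩ := Set.mem_iUnion.1 hh
    refine ⟨fun hy => ?_, hA b h hb y⟩
    have := hA b h⁻¹ (inv_mem hb) _ hy
    rwa [inv_smul_smul] at this
  obtain ⟨g, c, hg⟩ := hx
  have h1 : g • x ∈ A := ⟨0, c, 1, one_mem _, c, by rwa [one_smul]⟩
  obtain ⟨n, d, hn⟩ := ((hS ▸ Subgroup.mem_top g : g ∈ S) x).1 h1
  by_cases hdb : d = b
  · exact ⟨n, hdb ▸ hn⟩
  · refine ⟨n + 1, 1, one_mem _, ?_⟩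
    rw [one_smul, ← Bool.eq_not.2 hdb]
    exact hn

variable [MeasurableSpace X]

lemma measurableSet_near [Countable G] (hm : ∀ g : G, Measurable fun x : X => g • x)
    {O : Bool → Set X} (hO : ∀ b, MeasurableSet (O b)) (n : ℕ) (b : Bool) :
    MeasurableSet (near H O n b) := by
  induction n generalizing b with
  | zero =>
    have : near H O 0 b = ⋃ h : H b, ⋃ c, (fun x => (h : G) • x) ⁻¹' O c := by
      ext x; simp [near]
    rw [this]
    exact .iUnion fun h => .iUnion fun c => hm _ (hO c)
  | succ n ih =>
    have : near H O (n + 1) b = ⋃ h : H b, (fun x => (h : G) • x) ⁻¹' near H O n (!b) := by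
      ext x; simp [near]
    rw [this]
    exact .iUnion fun h => hm _ (ih _)

/-- The blame set determined by a seed. -/
theorem IsSeed.exists_blame [Countable G] (hm : ∀ g : G, Measurable fun x : X => g • x)
    (hH : Subgroup.closure (⋃ b, (H b : Set G)) = ⊤) {O : Bool → Set X} (hO : IsSeed H O) :
    ∃ D : Set X, MeasurableSet D ∧ ∀ x, (∃ (g : G) (b : Bool), g • x ∈ O b) →
      ((∀ h ∈ H false, h ≠ 1 → h • x ≠ x) → ∃ h ∈ H false, h • x ∈ D) ∧
      ((∀ h ∈ H true, h ≠ 1 → h • x ≠ x) → ∃ h ∈ H true, h • x ∉ D) := by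
  have hzero : ∀ b x, (∀ h ∈ H b, h ≠ 1 → h • x ≠ x) → x ∈ near H O 0 b →
      ∃ h ∈ H b, h • x ∈ O b := by
    rintro b x hf ⟨h, hh, c, hc⟩
    by_cases hcb : c = b
    · exact ⟨h, hh, hcb ▸ hc⟩
    rw [Bool.eq_not.2 hcb] at hc
    rcases hO.step b _ hc with ⟨k, hk, hk1, hkx⟩ | ⟨k, hk, hkx⟩
    · refine absurd ?_ (hf (h⁻¹ * k * h) (mul_mem (mul_mem (inv_mem hh) hk) hh) fun h1 => hk1 ?_)
      · rw [mul_smul, mul_smul, hkx, inv_smul_smul]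
      · rwa [mul_assoc, inv_mul_eq_one, eq_comm, mul_eq_right] at h1
    · exact ⟨k * h, mul_mem hk hh, by rwa [mul_smul]⟩
  have hmem : ∀ {b c : Bool} {x : X}, x ∈ O c → x ∈ near H O 0 b := fun {b c x} hx =>
    ⟨1, one_mem _, c, by rwa [one_smul]⟩
  refine ⟨{x | x ∈ O false ∨ (x ∉ O true ∧ ∃ n, x ∈ near H O n true ∧
    ∀ m ≤ n, x ∉ near H O m false)}, ?_, fun x hx => ⟨fun hf => ?_, fun hf => ?_⟩⟩
  · have hV := measurableSet_near (H := H) hm hO.measurable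
    have h1 : MeasurableSet {x : X | ∃ n, x ∈ near H O n true ∧ ∀ m ≤ n, x ∉ near H O m false} := by
      rw [show {x : X | ∃ n, x ∈ near H O n true ∧ ∀ m ≤ n, x ∉ near H O m false} =
      ⋃ n, near H O n true ∩ ⋂ m : {m // m ≤ n}, (near H O m false)ᶜ by ext x; simp]
      exact .iUnion fun n => (hV n true).inter (.iInter fun m => (hV m false).compl)
    exact (hO.measurable false).union ((hO.measurable true).compl.inter h1)
  · classical
    have hex := exists_near hH hx false
    have h1 := Nat.find_spec hex
    have h2 := fun m => Nat.find_min hex (m := m)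
    revert h1 h2
    rcases Nat.find hex with _ | n
    · intro h1 _
      obtain ⟨h, hh, hhx⟩ := hzero _ x hf h1
      exact ⟨h, hh, .inl hhx⟩
    · rintro ⟨h, hh, hhx⟩ h2
      refine ⟨h, hh, .inr ⟨fun h3 => h2 0 (by omega) ((near_smul hh).1 (hmem h3)), n, hhx,
        fun m hmn h3 => h2 m (by omega) ((near_smul hh).1 h3)⟩⟩
  · classical
    have hex := exists_near hH hx true
    have h1 := Nat.find_spec hex
    have h2 := fun m => Nat.find_min hex (m := m)
    revert h1 h2
    rcases Nat.find hex with _ | n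
    · intro h1 _
      obtain ⟨h, hh, hhx⟩ := hzero _ x hf h1
      exact ⟨h, hh, by
        rintro (h3 | h3)
        · exact hO.disjoint _ h3 hhx
        · exact h3.1 hhx⟩
    · rintro ⟨h, hh, hhx⟩ h2
      refine ⟨h, hh, ?_⟩
      rintro (h3 | ⟨-, n', h4, h5⟩)
      · exact h2 0 (by omega) ((near_smul hh).1 (hmem h3))
      · refine h5 n ?_ hhx
        by_contra hlt
        exact h2 n' (by omega) ((near_smul hh).1 h4)

/-- Countably many seeds can be combined. -/
theorem exists_seed_of_countable [Countable G] (hm : ∀ g : G, Measurable fun x : X => g • x)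
    {O : ℕ → Bool → Set X} (hO : ∀ j, IsSeed H (O j)) :
    ∃ P : Bool → Set X, IsSeed H P ∧ ∀ x, (∃ (j : ℕ) (g : G) (b : Bool), g • x ∈ O j b) →
      ∃ (g : G) (b : Bool), g • x ∈ P b := by
  classical
  let M : ℕ → Set X := fun j => {x | ∃ (g : G) (b : Bool), g • x ∈ O j b}
  have hM : ∀ j (g : G) x, g • x ∈ M j ↔ x ∈ M j := by
    have key : ∀ j (g : G) x, g • x ∈ M j → x ∈ M j := by
      rintro j g x ⟨k, b, hk⟩
      rw [smul_smul] at hk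
      exact ⟨_, b, hk⟩
    refine fun j g x => ⟨key j g x, fun h => key j g⁻¹ _ ?_⟩
    rwa [inv_smul_smul]
  have hMm : ∀ j, MeasurableSet (M j) := fun j => by
    rw [show M j = ⋃ (g : G) (b : Bool), (fun x => g • x) ⁻¹' O j b by ext x; simp [M]]
    exact .iUnion fun g => .iUnion fun b => hm g ((hO j).measurable b)
  refine ⟨fun b => {x | ∃ j, x ∈ O j b ∧ ∀ i < j, x ∉ M i}, ⟨fun b => ?_, ?_, ?_⟩, ?_⟩
  · rw [show {x : X | ∃ j, x ∈ O j b ∧ ∀ i < j, x ∉ M i} =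
      ⋃ j, O j b ∩ ⋂ i : {i // i < j}, (M i)ᶜ by ext x; simp]
    exact .iUnion fun j => ((hO j).measurable b).inter (.iInter fun i => (hMm i).compl)
  · rintro x ⟨j, h1, h2⟩ ⟨i, h3, h4⟩
    have hMi : ∀ {j b}, x ∈ O j b → x ∈ M j := fun {j b} h => ⟨1, b, by rwa [one_smul]⟩
    rcases lt_trichotomy i j with h | rfl | h
    · exact h2 i h (hMi h3)
    · exact (hO i).disjoint x h1 h3
    · exact h4 j h (hMi h1)
  · rintro b x ⟨j, h1, h2⟩
    rcases (hO j).step b x h1 with h | ⟨h, hh, hx⟩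
    · exact .inl h
    · exact .inr ⟨h, hh, j, hx, fun i hi h3 => h2 i hi ((hM i h x).1 h3)⟩
  · intro x hx
    obtain ⟨g, b, hg⟩ := Nat.find_spec hx
    exact ⟨g, b, Nat.find hx, hg, fun i hi h => Nat.find_min hx hi ((hM i g x).1 h)⟩

end MarksLemma

namespace MarksLemma

open MulAction

variable {G X : Type} [Group G] [MulAction G X] {H : Bool → Subgroup G}

/-- The product `s (n - 1) * ⋯ * s 0`. -/
def word (s : ℕ → G) : ℕ → G
  | 0 => 1
  | n + 1 => s n * word s n

lemma word_congr {s t : ℕ → G} {n : ℕ} (h : ∀ i < n, s i = t i) : word s n = word t n := by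
  induction n with
  | zero => rfl
  | succ n ih => rw [word, word, h n (by omega), ih fun i hi => h i (by omega)]

lemma word_add (s : ℕ → G) (k n : ℕ) :
    word s (k + n) = word (fun i => s (k + i)) n * word s k := by
  induction n with
  | zero => simp [word]
  | succ n ih => rw [← add_assoc, word, ih, word, mul_assoc]

lemma exists_word (hH : Subgroup.closure (⋃ b, (H b : Set G)) = ⊤) (g : G) :
    ∃ (s : ℕ → G) (n : ℕ), (∀ i, ∃ b, s i ∈ H b) ∧ word s n = g := by
  have hg : g ∈ Subgroup.closure (⋃ b, (H b : Set G)) := hH ▸ Subgroup.mem_top g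
  have key : ∀ (a : G) (_ : ∃ b, a ∈ H b) (g : G),
      (∃ (s : ℕ → G) (n : ℕ), (∀ i, ∃ b, s i ∈ H b) ∧ word s n = g) →
      ∃ (s : ℕ → G) (n : ℕ), (∀ i, ∃ b, s i ∈ H b) ∧ word s n = a * g := by
    rintro a ha _ ⟨s, n, hs, rfl⟩
    refine ⟨Function.update s n a, n + 1, fun i => ?_, ?_⟩
    · by_cases hi : i = n
      · subst hi; simpa using ha
      · simpa [hi] using hs i
    · rw [word, Function.update_self, word_congr fun i hi => Function.update_of_ne hi.ne _ _]
  induction hg using Subgroup.closure_induction_left with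
  | one => exact ⟨fun _ => 1, 0, fun _ => ⟨true, one_mem _⟩, rfl⟩
  | mul_left a ha g _ ih => exact key a (Set.mem_iUnion.1 ha) g ih
  | inv_mul_cancel a ha g _ ih =>
    exact key a⁻¹ ((Set.mem_iUnion.1 ha).imp fun b hb => inv_mem hb) g ih

/-- A nontrivial word of length `n` in the two subgroups fixes some point of the orbit of `x`. -/
def FixedByWord (H : Bool → Subgroup G) (x : X) (n : ℕ) : Prop :=
  ∃ (g : G) (s : ℕ → G), (∀ i, ∃ b, s i ∈ H b) ∧ word s n ≠ 1 ∧ word s n • g • x = g • x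

/-- A shortest nontrivial word fixing a point of an orbit has length one or is cyclically
alternating, and moves the point along a path of distinct points. -/
lemma exists_alternating {x : X} {m : ℕ} (h1 : FixedByWord H x m)
    (h2 : ∀ n < m, ¬ FixedByWord H x n) (hm : 2 ≤ m) :
    ∃ (g : G) (s : ℕ → G), Function.Periodic s m ∧ (∀ i, s i ∈ H (decide (i % 2 = 1))) ∧
      m % 2 = 0 ∧ word s m • g • x = g • x ∧
      ∀ i j, i < j → j < i + m → word s i • g • x ≠ word s j • g • x := by
  obtain ⟨g, s, hs, hne, hfix⟩ := h1
  wlog hper : Function.Periodic s m generalizing s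
  · have h3 : word (fun i => s (i % m)) m = word s m :=
      word_congr fun i hi => by rw [Nat.mod_eq_of_lt hi]
    exact this (fun i => s (i % m)) (fun i => hs _) (by rwa [h3]) (by rwa [h3])
      (fun i => by simp)
  have hfun : ∀ s : ℕ → G, Function.Periodic s m → ∀ k,
      word (fun i => s (k + i)) m = word s k * word s m * (word s k)⁻¹ := by
    intro s hper k
    rw [eq_mul_inv_iff_mul_eq, ← word_add, add_comm, word_add]
    congr 2
    funext i
    rw [add_comm, hper]
  have hshift : ∀ k, word (fun i => s (k + i)) m ≠ 1 ∧
      word (fun i => s (k + i)) m • word s k • g • x = word s k • g • x := by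
    intro k
    rw [hfun s hper k]
    refine ⟨fun h => hne ?_, ?_⟩
    · rwa [mul_inv_eq_one, mul_eq_left] at h
    · rw [mul_smul, mul_smul, inv_smul_smul, hfix]
  have hA : ∀ k b, s k ∈ H b → s (k + 1) ∈ H b → False := by
    intro k b hk hk1
    refine h2 (m - 1) (by omega) ⟨word s k * g,
      fun i => if i = 0 then s (k + 1) * s k else s (k + (i + 1)), fun i => ?_, ?_⟩
    · dsimp only
      split_ifs
      · exact ⟨b, mul_mem hk1 hk⟩
      · exact hs _
    · have h3 : ∀ j, word (fun i => if i = 0 then s (k + 1) * s k else s (k + (i + 1))) (j + 1) =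
          word (fun i => s (k + i)) (j + 2) := by
        intro j
        induction j with
        | zero => simp [word]
        | succ j ih => rw [word, ih]; rfl
      obtain ⟨n, rfl⟩ : ∃ n, m = n + 2 := ⟨m - 2, by omega⟩
      rw [show n + 2 - 1 = n + 1 by omega, h3, mul_smul]
      exact hshift k
  have halt : ∀ b, s 0 ∈ H b → ∀ i, s i ∈ H (xor b (decide (i % 2 = 1))) := by
    intro b hb i
    induction i with
    | zero => simpa using hb
    | succ i ih =>
      obtain ⟨c, hc⟩ := hs (i + 1)
      by_cases hcb : c = xor b (decide (i % 2 = 1))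
      · exact (hA i c (hcb ▸ ih) hc).elim
      · convert hc using 2
        rw [Bool.eq_not.2 hcb]
        rcases Nat.mod_two_eq_zero_or_one i with h | h <;> cases b <;> simp [h, Nat.add_mod]
  have heven : m % 2 = 0 := by
    obtain ⟨b, hb⟩ := hs 0
    by_contra hodd
    have h3 := halt b hb (m - 1)
    rw [decide_eq_false (by omega), Bool.xor_false] at h3
    refine hA (m - 1) b h3 ?_
    rw [Nat.sub_add_cancel (by omega), ← zero_add m, hper]
    exact hb
  have hB : ∀ i j, i < j → j < i + m → word s i • g • x ≠ word s j • g • x := by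
    intro i j hij hjm heq
    obtain ⟨d, rfl⟩ : ∃ d, j = i + d := ⟨j - i, by omega⟩
    rw [word_add, mul_smul] at heq
    obtain ⟨h3, h4⟩ := hshift i
    have h5 : word (fun n => s (i + n)) d = 1 := by
      by_contra h6
      exact h2 d (by omega) ⟨word s i * g, _, fun n => hs _, h6, by rw [mul_smul, ← heq]⟩
    obtain ⟨e, rfl⟩ : ∃ e, m = d + e := ⟨m - d, by omega⟩
    rw [word_add, h5, mul_one] at h3 h4
    exact h2 e (by omega) ⟨word s i * g, _, fun n => hs _, h3, by rw [mul_smul]; exact h4⟩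
  obtain ⟨b, hb⟩ := hs 0
  cases b
  · exact ⟨g, s, hper, fun i => by simpa using halt _ hb i, heven, hfix, hB⟩
  · refine ⟨word s 1 * g, fun i => s (1 + i), fun i => ?_, fun i => ?_, heven, ?_, ?_⟩
    · change s (1 + (i + m)) = _
      rw [← add_assoc, hper]
    · convert halt _ hb (1 + i) using 2
      rcases Nat.mod_two_eq_zero_or_one i with h | h <;> simp [h, Nat.add_mod]
    · rw [mul_smul]; exact (hshift 1).2
    · intro i j hij hjm
      rw [mul_smul, ← mul_smul, ← word_add, ← mul_smul _ _ (g • x), ← word_add]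
      exact hB _ _ (by omega) (by omega)

/-- Finite sets of points are separated by finite positive combinations of the sets `B n`. -/
lemma exists_separating {B : ℕ → Set X} (hB : ∀ a b, a ≠ b → ∃ n, a ∈ B n ∧ b ∉ B n)
    (E F : Finset X) (hEF : ∀ a ∈ E, ∀ b ∈ F, a ≠ b) :
    ∃ I : Finset (Finset ℕ), (∀ a ∈ E, ∃ J ∈ I, ∀ n ∈ J, a ∈ B n) ∧
      ∀ b ∈ F, ¬ ∃ J ∈ I, ∀ n ∈ J, b ∈ B n := by
  classical
  choose! f hf1 hf2 using hB
  refine ⟨E.image fun a => F.image fun b => f a b, fun a ha => ?_, fun b hb => ?_⟩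
  · refine ⟨_, Finset.mem_image_of_mem _ ha, fun n hn => ?_⟩
    obtain ⟨b, hb, rfl⟩ := Finset.mem_image.1 hn
    exact hf1 a b (hEF a ha b hb)
  · rintro ⟨J, hJ, h⟩
    obtain ⟨a, ha, rfl⟩ := Finset.mem_image.1 hJ
    exact hf2 a b (hEF a ha b hb) (h _ (Finset.mem_image_of_mem _ hb))

variable [MeasurableSpace X]

lemma isSeed_empty : IsSeed H (fun _ => (∅ : Set X)) :=
  ⟨fun _ => .empty, fun _ h => h.elim, fun _ _ h => h.elim⟩

lemma isSeed_fixed {B : ℕ → Set X} (hBm : ∀ n, MeasurableSet (B n))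
    (hB : ∀ a b, a ≠ b → ∃ n, a ∈ B n ∧ b ∉ B n)
    (hm : ∀ g : G, Measurable fun x : X => g • x) {b : Bool} {h : G} (hh : h ∈ H b) (h1 : h ≠ 1) :
    IsSeed H (fun c => {x : X | c = !b ∧ h • x = x}) := by
  refine ⟨fun c => ?_, fun x h3 h4 => ?_, fun c x hx => .inl ⟨h, ?_, h1, hx.2⟩⟩
  · have h3 : MeasurableSet {x : X | h • x = x} := by
      have h4 : {x : X | h • x = x}ᶜ = ⋃ n, (fun x => h • x) ⁻¹' B n ∩ (B n)ᶜ := by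
        ext x
        simp only [Set.mem_compl_iff, Set.mem_iUnion]
        refine ⟨fun hx => hB _ _ hx, ?_⟩
        rintro ⟨n, h5, h6⟩ (h7 : h • x = x)
        exact h6 (h7 ▸ h5)
      rw [← compl_compl {x : X | h • x = x}, h4]
      exact (MeasurableSet.iUnion fun n => (hm h (hBm n)).inter (hBm n).compl).compl
    exact (MeasurableSet.const _).inter h3
  · have := h3.1.trans h4.1.symm
    simp at this
  · have := hx.1
    rw [Bool.not_inj_iff] at this
    rwa [this]

lemma isSeed_alternating (hm : ∀ g : G, Measurable fun x : X => g • x) {s : ℕ → G}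
    (hs : ∀ i, s i ∈ H (decide (i % 2 = 1))) {U : Set X} (hU : MeasurableSet U) :
    IsSeed H (fun c => {x : X | ∃ (i : ℕ) (z : X), (decide (i % 2 = 0) = c) ∧ word s i • z = x ∧
      ∀ j, word s j • z ∈ U ↔ j % 2 = 0}) := by
  refine ⟨fun c => ?_, ?_, ?_⟩
  · have h1 : ∀ i : ℕ, {x : X | ∃ z : X, (decide (i % 2 = 0) = c) ∧ word s i • z = x ∧
        ∀ j, word s j • z ∈ U ↔ j % 2 = 0} = {x : X | decide (i % 2 = 0) = c} ∩
        ⋂ j, (fun x => (word s j * (word s i)⁻¹) • x) ⁻¹' {x | x ∈ U ↔ j % 2 = 0} := by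
      intro i
      ext x
      simp only [Set.mem_inter_iff, Set.mem_iInter]
      constructor
      · rintro ⟨z, hc, rfl, hz⟩
        refine ⟨hc, fun j => ?_⟩
        change (_ * _) • _ ∈ U ↔ _
        rw [mul_smul, inv_smul_smul]; exact hz j
      · rintro ⟨hc, hj⟩
        refine ⟨(word s i)⁻¹ • x, hc, smul_inv_smul _ _, fun j => ?_⟩
        rw [← mul_smul]; exact hj j
    have h2 := MeasurableSet.iUnion fun i : ℕ =>
      ((MeasurableSet.const (decide (i % 2 = 0) = c)).inter (.iInter fun j : ℕ =>
        hm (word s j * (word s i)⁻¹) (hU.iff (MeasurableSet.const (j % 2 = 0)))) : MeasurableSet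
        ({x : X | decide (i % 2 = 0) = c} ∩
        ⋂ j, (fun x => (word s j * (word s i)⁻¹) • x) ⁻¹' {x | x ∈ U ↔ j % 2 = 0}))
    convert h2 using 1
    ext x
    rw [Set.mem_iUnion]
    exact exists_congr fun i => by rw [← h1]; rfl
  · rintro x ⟨i, z, hi, rfl, hz⟩ ⟨j, w, hj, hx, hw⟩
    have h1 := (hw j).2 (by simpa using hj)
    rw [hx, hz i] at h1
    simp [h1] at hi
  · rintro c x ⟨i, z, hi, rfl, hz⟩
    refine .inr ⟨s i, ?_, i + 1, z, ?_, by rw [word, mul_smul], hz⟩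
    · convert hs i using 2
      rcases Nat.mod_two_eq_zero_or_one i with h | h <;> cases c <;> simp_all
    · rcases Nat.mod_two_eq_zero_or_one i with h | h <;> cases c <;> simp_all [Nat.add_mod]

theorem exists_blame [Countable G] (hm : ∀ g : G, Measurable fun x : X => g • x)
    (hH : Subgroup.closure (⋃ b, (H b : Set G)) = ⊤) {B : ℕ → Set X}
    (hBm : ∀ n, MeasurableSet (B n)) (hB : ∀ a b, a ≠ b → ∃ n, a ∈ B n ∧ b ∉ B n) :
    ∃ D : Set X, MeasurableSet D ∧ ∀ x, (∃ g : G, g ≠ 1 ∧ g • x = x) →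
      ((∀ h ∈ H false, h ≠ 1 → h • x ≠ x) → ∃ h ∈ H false, h • x ∈ D) ∧
      ((∀ h ∈ H true, h ≠ 1 → h • x ≠ x) → ∃ h ∈ H true, h • x ∉ D) := by
  classical
  let ι := (Bool × G) ⊕ ((Σ m : ℕ, Fin (m + 1) → G) × Finset (Finset ℕ))
  let raw : ι → Bool → Set X := Sum.elim (fun p c => {x : X | c = !p.1 ∧ p.2 • x = x})
    (fun p c => {x : X | ∃ (i : ℕ) (z : X), (decide (i % 2 = 0) = c) ∧
      word (fun n => p.1.2 (Fin.ofNat _ n)) i • z = x ∧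
      ∀ j, word (fun n => p.1.2 (Fin.ofNat _ n)) j • z ∈ {y | ∃ J ∈ p.2, ∀ n ∈ J, y ∈ B n} ↔
        j % 2 = 0})
  obtain ⟨e, he⟩ := exists_surjective_nat ι
  obtain ⟨P, hP, hcov⟩ := exists_seed_of_countable (H := H) hm
    (O := fun j => if IsSeed H (raw (e j)) then raw (e j) else fun _ => ∅) (fun j => by
      split_ifs with h
      · exact h
      · exact isSeed_empty)
  have hcov' : ∀ x, (∃ i : ι, IsSeed H (raw i) ∧ ∃ (g : G) (b : Bool), g • x ∈ raw i b) →
      ∃ (g : G) (b : Bool), g • x ∈ P b := by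
    rintro x ⟨i, hi, hx⟩
    obtain ⟨j, rfl⟩ := he i
    exact hcov x ⟨j, by rwa [if_pos hi]⟩
  obtain ⟨D, hD, hDx⟩ := hP.exists_blame hm hH
  refine ⟨D, hD, fun x hx => hDx x (hcov' x ?_)⟩
  have hex : ∃ n, FixedByWord H x n := by
    obtain ⟨g, hg1, hgx⟩ := hx
    obtain ⟨s, n, hs, rfl⟩ := exists_word hH g
    exact ⟨n, 1, s, hs, hg1, by rwa [one_smul]⟩
  have h1 := Nat.find_spec hex
  have h2 := fun m => Nat.find_min hex (m := m)
  revert h1 h2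
  generalize Nat.find hex = m
  intro h1 h2
  rcases lt_or_ge m 2 with hm2 | hm2
  · obtain ⟨g, s, hs, hne, hfix⟩ := h1
    interval_cases m
    · exact (hne rfl).elim
    · obtain ⟨b, hb⟩ := hs 0
      simp only [word, mul_one] at hne hfix
      exact ⟨.inl (b, s 0), isSeed_fixed hBm hB hm hb hne, g, !b, rfl, hfix⟩
  · obtain ⟨g, s, hper, hs, heven, hfix, hdist⟩ := exists_alternating h1 h2 hm2
    have hz : Function.Periodic (fun i => word s i • g • x) m := by
      intro i
      dsimp only
      rw [add_comm, word_add, mul_smul, hfix]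
      congr 2
      funext j
      rw [add_comm, hper]
    have hmod : ∀ i, (i % m) % 2 = i % 2 := fun i => Nat.mod_mod_of_dvd i (by omega)
    obtain ⟨I, hI1, hI2⟩ := exists_separating hB
      (((Finset.range m).filter (· % 2 = 0)).image fun i => word s i • g • x)
      (((Finset.range m).filter (· % 2 = 1)).image fun i => word s i • g • x) (by
        intro a ha b hb
        simp only [Finset.mem_image, Finset.mem_filter, Finset.mem_range] at ha hb
        obtain ⟨i, ⟨hi1, hi2⟩, rfl⟩ := ha
        obtain ⟨j, ⟨hj1, hj2⟩, rfl⟩ := hb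
        rcases lt_trichotomy i j with h | h | h
        · exact hdist i j h (by omega)
        · omega
        · exact (hdist j i h (by omega)).symm)
    obtain ⟨n, rfl⟩ : ∃ n, m = n + 1 := ⟨m - 1, by omega⟩
    have hsn : (fun i => s ((Fin.ofNat (n + 1) i : Fin (n + 1)) : ℕ)) = s := by
      funext i
      exact hper.map_mod_nat i
    refine ⟨.inr (⟨n, fun i => s i⟩, I), ?_, g, true, 0, g • x, by simp, by simp [word], ?_⟩
    · refine isSeed_alternating hm (fun i => ?_) ?_
      · change (fun i => s ((Fin.ofNat (n + 1) i : Fin (n + 1)) : ℕ)) i ∈ _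
        rw [hsn]; exact hs i
      · rw [show {y | ∃ J ∈ I, ∀ n ∈ J, y ∈ B n} = ⋃ J : I, ⋂ n : (J : Finset ℕ), B n by
          ext y; simp]
        exact .iUnion fun J => .iInter fun n => hBm n
    · intro j
      dsimp only
      rw [hsn]
      have h3 : word s j • g • x = word s (j % (n + 1)) • g • x := (hz.map_mod_nat j).symm
      have hlt := Nat.mod_lt j (Nat.succ_pos n)
      have h4 := hmod j
      rw [h3]
      constructor
      · intro h5
        by_contra h6
        refine hI2 _ (Finset.mem_image_of_mem _ ?_) h5
        simp only [Finset.mem_filter, Finset.mem_range]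
        exact ⟨hlt, by omega⟩
      · intro h5
        refine hI1 _ (Finset.mem_image_of_mem _ ?_)
        simp only [Finset.mem_filter, Finset.mem_range]
        exact ⟨hlt, by omega⟩

end MarksLemma

/-- The data of a normal form for a group generated by two free factors `M false` and `M true`:
`g = ι b (head b g) * tail b g`, where `tail b g` does not start in `M b`, together with an
enumeration `rank` of the group that is compatible with the parity and with taking tails. -/
structure FreeSplitting {M : Bool → Type} [∀ b, Group (M b)] {G : Type} [Group G]
    (ι : ∀ b, M b →* G) where
  head : ∀ b, G → M b
  tail : Bool → G → G
  rank : G → ℕ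
  head_one : ∀ b, head b 1 = 1
  tail_one : ∀ b, tail b 1 = 1
  head_mul : ∀ b m g, head b (ι b m * g) = m * head b g
  tail_mul : ∀ b m g, tail b (ι b m * g) = tail b g
  head_mul_tail : ∀ b g, ι b (head b g) * tail b g = g
  rank_injective : Function.Injective rank
  turn_rank : ∀ b g, g ≠ 1 → (GaleStewart.Turn b (rank g) ↔ head b g = 1)
  rank_tail : ∀ b g, head b g ≠ 1 → rank (tail b g) < rank g

namespace FreeSplitting

open Monoid

open scoped Classical in
theorem nonempty_of_mulEquiv {M : Bool → Type} [∀ b, Group (M b)] [∀ b, Countable (M b)]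
    {G : Type} [Group G] (e : G ≃* CoprodI M) :
    Nonempty (FreeSplitting fun b => e.symm.toMonoidHom.comp (CoprodI.of : M b →* CoprodI M)) := by
  let : Encodable (Σ b, M b) := Encodable.ofCountable _
  let ω : G ≃ CoprodI.Word M := e.toEquiv.trans CoprodI.Word.equiv
  have ω_one : ω 1 = CoprodI.Word.empty := by simp [ω, CoprodI.Word.equiv]
  have ω_mul : ∀ b (m : M b) g, ω (e.symm (CoprodI.of m) * g) = CoprodI.of m • ω g := by
    intro b m g
    simp [ω, CoprodI.Word.equiv, mul_smul]
  have hhead : ∀ b g, (CoprodI.Word.equivPair b (ω g)).head = 1 ↔ (ω g).fstIdx ≠ some b := by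
    intro b g
    refine ⟨fun h => ?_, fun h => by rw [CoprodI.Word.equivPair_eq_of_fstIdx_ne h]⟩
    have h2 := CoprodI.Word.equivPair_head_smul_equivPair_tail (i := b) (ω g)
    rw [h, map_one, one_smul] at h2
    rw [← h2]
    exact (CoprodI.Word.equivPair b (ω g)).fstIdx_ne
  have hempty : ∀ b, (CoprodI.Word.empty : CoprodI.Word M).fstIdx ≠ some b := by
    intro b; simp [CoprodI.Word.fstIdx, CoprodI.Word.empty]
  refine ⟨{
    head := fun b g => (CoprodI.Word.equivPair b (ω g)).head
    tail := fun b g => ω.symm (CoprodI.Word.equivPair b (ω g)).tail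
    rank := fun g => 2 * Encodable.encode (ω g).toList +
      if (CoprodI.Word.equivPair false (ω g)).head = 1 then 0 else 1
    head_one := fun b => by
      rw [hhead, ω_one]; exact hempty b
    tail_one := fun b => by
      rw [ω_one, CoprodI.Word.equivPair_eq_of_fstIdx_ne (hempty b), Equiv.symm_apply_eq, ω_one]
    head_mul := fun b m g => by
      change (CoprodI.Word.equivPair b (ω (e.symm (CoprodI.of m) * g))).head = _
      rw [ω_mul, CoprodI.Word.equivPair_smul_same]
    tail_mul := fun b m g => by
      change ω.symm (CoprodI.Word.equivPair b (ω (e.symm (CoprodI.of m) * g))).tail = _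
      rw [ω_mul, CoprodI.Word.equivPair_smul_same]
    head_mul_tail := fun b g => by
      apply ω.injective
      change ω (e.symm (CoprodI.of _) * _) = _
      rw [ω_mul, Equiv.apply_symm_apply, CoprodI.Word.equivPair_head_smul_equivPair_tail]
    rank_injective := fun g g' h => by
      have h2 : Encodable.encode (ω g).toList = Encodable.encode (ω g').toList := by
        dsimp only at h
        split_ifs at h <;> omega
      exact ω.injective (CoprodI.Word.ext (Encodable.encode_injective h2))
    turn_rank := fun b g hg => ?_
    rank_tail := fun b g hg => ?_ }⟩
  · have hne : ω g ≠ CoprodI.Word.empty := fun h => hg (ω.injective (h.trans ω_one.symm))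
    have h1 : (ω g).fstIdx ≠ some true ↔ ¬ (ω g).fstIdx ≠ some false := by
      have : (ω g).fstIdx ≠ none := by
        intro h
        apply hne
        ext1
        simpa [CoprodI.Word.fstIdx] using h
      cases h : (ω g).fstIdx with
      | none => exact (this h).elim
      | some b => cases b <;> simp
    cases b
    · rw [GaleStewart.GTree.turn_false]
      split_ifs with h
      · simp [h]
      · simp only [h, iff_false]; omega
    · rw [GaleStewart.GTree.turn_true, hhead true, h1, ← hhead]
      split_ifs with h
      · simp [h]
      · simp only [h, not_false_iff, iff_true]; omega
  · have h1 : Encodable.encode (CoprodI.Word.equivPair b (ω g)).tail.toList <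
        Encodable.encode (ω g).toList := by
      have h2 := (CoprodI.Word.equivPair b).symm_apply_apply (ω g)
      rw [CoprodI.Word.equivPair_symm, CoprodI.Word.rcons, dif_neg hg] at h2
      conv_rhs => rw [← h2]
      simp only [CoprodI.Word.cons, Encodable.encode_list_cons]
      exact Nat.lt_succ_of_le (Nat.right_le_pair _ _)
    simp only [Equiv.apply_symm_apply]
    split_ifs <;> omega

end FreeSplitting

section FreeProduct

open GaleStewart

/-- The left shift as an action of `G` on `G → X`. -/
@[reducible] def shiftAction (G X : Type) [Group G] : MulAction G (G → X) where
  smul := shift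
  one_smul y := by funext g; simp [shift, HSMul.hSMul]
  mul_smul a b y := by
    funext g
    change y ((a * b)⁻¹ * g) = y (b⁻¹ * (a⁻¹ * g))
    rw [mul_inv_rev, mul_assoc]

lemma measurable_shift {G X : Type} [Group G] [MeasurableSpace X] (g : G) :
    Measurable (shift g : (G → X) → G → X) :=
  measurable_pi_iff.2 fun _ => measurable_pi_apply _

lemma measurableSet_freePart (G : Type) [Group G] [Countable G] :
    MeasurableSet (freePart G ℕ) := by
  rw [show freePart G ℕ = ⋂ γ : G, ⋂ _ : γ ≠ 1, {y | shift γ y = y}ᶜ by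
    ext y; simp [freePart]]
  exact .iInter fun γ => .iInter fun _ =>
    (measurableSet_eq_fun (measurable_shift γ) measurable_id).compl

/-- Blame sets for the shift action: the elements outside the free part can be split
measurably so that each piece is avoidable by one of two generating subgroups. -/
lemma exists_blame_shift {G : Type} [Group G] [Countable G] {H : Bool → Subgroup G}
    (hH : Subgroup.closure (⋃ b, (H b : Set G)) = ⊤) :
    ∃ D : Set (G → ℕ), MeasurableSet D ∧ ∀ y ∉ freePart G ℕ,
      ((∀ h ∈ H false, h ≠ 1 → shift h y ≠ y) → ∃ h ∈ H false, shift h y ∈ D) ∧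
      ((∀ h ∈ H true, h ≠ 1 → shift h y ≠ y) → ∃ h ∈ H true, shift h y ∉ D) := by
  let := shiftAction G ℕ
  obtain ⟨e, he⟩ := exists_surjective_nat (G × ℕ)
  obtain ⟨D, hD, hD'⟩ := MarksLemma.exists_blame (X := G → ℕ) (H := H)
    (fun g => measurable_shift g) hH
    (B := fun n => {y | y (e n).1 = (e n).2})
    (fun n => measurable_pi_apply _ (measurableSet_singleton _)) (fun a b hab => by
      obtain ⟨g, hg⟩ := Function.ne_iff.1 hab
      obtain ⟨n, hn⟩ := he (g, a g)
      exact ⟨n, by simp [hn], by simpa [hn] using hg.symm⟩)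
  refine ⟨D, hD, fun y hy => hD' y ?_⟩
  have h : ∃ g, g ≠ 1 ∧ shift g y = y := by simpa [freePart] using hy
  exact h

/-- Well-founded recursion on `ℕ` for functionals which only depend on previous values. -/
lemma exists_recursive {α : Type*} [Inhabited α] (F : ℕ → (ℕ → α) → α)
    (hF : ∀ n Z Z', (∀ m < n, Z m = Z' m) → F n Z = F n Z') : ∃ Z, ∀ n, Z n = F n Z := by
  classical
  let Z : ℕ → α := Nat.lt_wfRel.wf.fix fun n rec =>
    F n fun m => if h : m < n then rec m h else default
  refine ⟨Z, fun n => ?_⟩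
  have h := Nat.lt_wfRel.wf.fix_eq (C := fun _ => α) (fun n rec =>
    F n fun m => if h : m < n then rec m h else default) n
  refine h.trans (hF n _ _ fun m hm => ?_)
  rw [dif_pos hm]

namespace FreeSplitting

variable {M : Bool → Type} [∀ b, Group (M b)] {G : Type} [Group G] {ι : ∀ b, M b →* G}

section Play

variable (σ : FreeSplitting ι) (c : Bool)

open scoped Classical in
/-- The point of `G → ℕ` described by its value `k` at `1` and a run `z` of the game. -/
noncomputable def play (k : ℕ) (z : ℕ → ℕ) (g : G) : ℕ := if g = 1 then k else z (σ.rank g)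

open scoped Classical in
/-- The point of `G → ℕ` whose value at `ι c γ * w` is given by `Z (rank w) γ`,
where `w` does not start in `M c`. -/
noncomputable def assemble (κ : M c → ℕ) (Z : ℕ → M c → ℕ) (g : G) : ℕ :=
  if σ.tail c g = 1 then κ (σ.head c g) else Z (σ.rank (σ.tail c g)) (σ.head c g)

open scoped Classical in
/-- The rule for the `n`th moves in a family of runs indexed by `M c`, in all of which the
player `c` uses the strategy `τ`, while the other player copies moves from earlier positions
of other runs. -/
noncomputable def rule (τ : ℕ → List ℕ → ℕ) (κ : M c → ℕ) (n : ℕ) (Z : ℕ → M c → ℕ)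
    (γ : M c) : ℕ :=
  if Turn c n then τ (κ γ) (hist (fun m => Z m γ) n)
  else if h : ∃ g, g ≠ 1 ∧ σ.rank g = n then σ.assemble c κ Z (ι c γ * h.choose) else 0

variable {σ c}

lemma assemble_congr {κ : M c → ℕ} {Z Z' : ℕ → M c → ℕ} {g : G} (hg : σ.head c g ≠ 1)
    (h : ∀ m < σ.rank g, Z m = Z' m) (γ : M c) :
    σ.assemble c κ Z (ι c γ * g) = σ.assemble c κ Z' (ι c γ * g) := by
  unfold assemble
  rw [σ.tail_mul, h _ (σ.rank_tail c g hg)]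

lemma rule_congr {τ : ℕ → List ℕ → ℕ} {κ : M c → ℕ} {n : ℕ} {Z Z' : ℕ → M c → ℕ}
    (h : ∀ m < n, Z m = Z' m) : σ.rule c τ κ n Z = σ.rule c τ κ n Z' := by
  funext γ
  unfold rule
  split_ifs with h1 h2
  · rw [hist_congr fun m hm => congrFun (h m hm) γ]
  · obtain ⟨h3, h4⟩ := h2.choose_spec
    refine assemble_congr (fun h5 => h1 ?_) (by rwa [h4]) γ
    rw [← h4]
    exact (σ.turn_rank c _ h3).2 h5
  · rfl

variable (σ c) in
lemma exists_runs (τ : ℕ → List ℕ → ℕ) (κ : M c → ℕ) :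
    ∃ Z, ∀ n, Z n = σ.rule c τ κ n Z :=
  exists_recursive _ fun _ _ _ => rule_congr

/-- The simultaneous solution of the rules. -/
noncomputable def runs (σ : FreeSplitting ι) (c : Bool) (τ : ℕ → List ℕ → ℕ) (κ : M c → ℕ) :
    ℕ → M c → ℕ :=
  (σ.exists_runs c τ κ).choose

lemma runs_eq (τ : ℕ → List ℕ → ℕ) (κ : M c → ℕ) (n : ℕ) :
    σ.runs c τ κ n = σ.rule c τ κ n (σ.runs c τ κ) :=
  (σ.exists_runs c τ κ).choose_spec n

lemma runs_of_turn (τ : ℕ → List ℕ → ℕ) (κ : M c → ℕ) {n : ℕ} (hn : Turn c n) (γ : M c) :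
    σ.runs c τ κ n γ = τ (κ γ) (hist (fun m => σ.runs c τ κ m γ) n) := by
  rw [runs_eq, rule, if_pos hn]

lemma runs_rank (τ : ℕ → List ℕ → ℕ) (κ : M c → ℕ) {g : G} (hg : σ.head c g ≠ 1) (γ : M c) :
    σ.runs c τ κ (σ.rank g) γ = σ.assemble c κ (σ.runs c τ κ) (ι c γ * g) := by
  have hg1 : g ≠ 1 := fun h => hg (h ▸ σ.head_one c)
  have h : ∃ g', g' ≠ 1 ∧ σ.rank g' = σ.rank g := ⟨g, hg1, rfl⟩
  rw [runs_eq, rule, if_neg (fun h => hg ((σ.turn_rank c g hg1).1 h)), dif_pos h,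
    σ.rank_injective h.choose_spec.2]

lemma runs_of_not_mem (τ : ℕ → List ℕ → ℕ) (κ : M c → ℕ) {n : ℕ} (hn : ¬ Turn c n)
    (h : ¬ ∃ g, g ≠ 1 ∧ σ.rank g = n) (γ : M c) : σ.runs c τ κ n γ = 0 := by
  rw [runs_eq, rule, if_neg hn, dif_neg h]

lemma tail_eq_self {g : G} (hg : σ.head c g = 1) : σ.tail c g = g := by
  simpa [hg] using σ.head_mul_tail c g

/-- Translates of the assembled point are plays of the game. -/
lemma shift_assemble (τ : ℕ → List ℕ → ℕ) (κ : M c → ℕ) (γ : M c) :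
    shift (ι c γ)⁻¹ (σ.assemble c κ (σ.runs c τ κ)) =
      σ.play (κ γ) (fun n => σ.runs c τ κ n γ) := by
  funext g
  rw [shift, inv_inv, play]
  split_ifs with hg
  · rw [hg, assemble, σ.tail_mul, σ.tail_one, if_pos rfl, σ.head_mul, σ.head_one, mul_one]
  · by_cases h : σ.head c g = 1
    · rw [assemble, σ.tail_mul, σ.head_mul, tail_eq_self h, if_neg hg, h, mul_one]
    · exact (runs_rank τ κ h γ).symm

lemma assemble_equivariant {κ : M c → ℕ} {Z Z' : ℕ → M c → ℕ} {δ : M c} {g : G}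
    (h : ∀ γ, Z (σ.rank (σ.tail c g)) γ = Z' (σ.rank (σ.tail c g)) (δ⁻¹ * γ)) :
    σ.assemble c (shift δ κ) Z g = σ.assemble c κ Z' (ι c δ⁻¹ * g) := by
  rw [assemble, assemble, σ.tail_mul, σ.head_mul, h, shift]

lemma runs_shift (τ : ℕ → List ℕ → ℕ) (κ : M c → ℕ) (δ : M c) (n : ℕ) (γ : M c) :
    σ.runs c τ (shift δ κ) n γ = σ.runs c τ κ n (δ⁻¹ * γ) := by
  induction n using Nat.strong_induction_on generalizing γ with
  | _ n ih =>
    by_cases hn : Turn c n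
    · rw [runs_of_turn _ _ hn, runs_of_turn _ _ hn, hist_congr fun m hm => ih m hm γ]
      rfl
    by_cases h : ∃ g, g ≠ 1 ∧ σ.rank g = n
    · obtain ⟨g, hg, rfl⟩ := h
      have hg' : σ.head c g ≠ 1 := fun h => hn ((σ.turn_rank c g hg).2 h)
      rw [runs_rank _ _ hg', runs_rank _ _ hg', map_mul, mul_assoc]
      refine assemble_equivariant fun γ' => ?_
      rw [σ.tail_mul]
      exact ih _ (σ.rank_tail c g hg') γ'
    · rw [runs_of_not_mem _ _ hn h, runs_of_not_mem _ _ hn h]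

lemma measurable_assemble {X : Type*} [MeasurableSpace X] {κ : X → M c → ℕ}
    {Z : X → ℕ → M c → ℕ} (hκ : ∀ γ, Measurable fun x => κ x γ) {g : G}
    (hZ : ∀ γ, Measurable fun x => Z x (σ.rank (σ.tail c g)) γ) :
    Measurable fun x => σ.assemble c (κ x) (Z x) g := by
  unfold assemble
  split_ifs
  · exact hκ _
  · exact hZ _

lemma measurable_runs {X : Type*} [MeasurableSpace X] {κ : X → M c → ℕ} (τ : ℕ → List ℕ → ℕ)
    (hκ : ∀ γ, Measurable fun x => κ x γ) (n : ℕ) (γ : M c) :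
    Measurable fun x => σ.runs c τ (κ x) n γ := by
  induction n using Nat.strong_induction_on generalizing γ with
  | _ n ih =>
    by_cases hn : Turn c n
    · simp only [runs_of_turn _ _ hn]
      let : MeasurableSpace (List ℕ) := ⊤
      have : DiscreteMeasurableSpace (List ℕ) := ⟨fun _ => trivial⟩
      have h : ∀ m ≤ n, Measurable fun x => hist (fun m => σ.runs c τ (κ x) m γ) m := by
        intro m hm
        induction m with
        | zero => exact measurable_const
        | succ m ih' =>
          exact (Measurable.of_discrete (f := fun p : ℕ × List ℕ => p.1 :: p.2)).comp
            ((ih m (by omega) γ).prodMk (ih' (by omega)))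
      exact (Measurable.of_discrete (f := fun p : ℕ × List ℕ => τ p.1 p.2)).comp
        ((hκ γ).prodMk (h n le_rfl))
    by_cases h : ∃ g, g ≠ 1 ∧ σ.rank g = n
    · obtain ⟨g, hg, rfl⟩ := h
      have hg' : σ.head c g ≠ 1 := fun h => hn ((σ.turn_rank c g hg).2 h)
      simp only [runs_rank _ _ hg']
      refine measurable_assemble hκ fun γ' => ?_
      rw [σ.tail_mul]
      exact ih _ (σ.rank_tail c g hg') γ'
    · simp only [runs_of_not_mem _ _ hn h]
      exact measurable_const

lemma measurable_play (σ : FreeSplitting ι) (k : ℕ) : Measurable (σ.play k) := by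
  refine measurable_pi_iff.2 fun g => ?_
  unfold play
  split_ifs
  · exact measurable_const
  · exact measurable_pi_apply _

end Play

/-- Marks' lemma: for each measurable set `A`, one of the two factors admits a measurable
equivariant map from its free part into the free part of the whole group, which takes values
in `A` or in the complement of `A`, according to the factor. -/
theorem exists_equivariant [Countable G] (σ : FreeSplitting ι)
    (hι : Subgroup.closure (⋃ b, ((ι b).range : Set G)) = ⊤) {A : Set (G → ℕ)}
    (hA : MeasurableSet A) :
    ∃ (c : Bool) (f : (M c → ℕ) → G → ℕ), Measurable f ∧
      (∀ γ x, f (shift γ x) = shift (ι c γ) (f x)) ∧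
      ∀ x ∈ freePart (M c) ℕ, f x ∈ freePart G ℕ ∧ (f x ∈ A ↔ c = false) := by
  obtain ⟨D, hD, hblame⟩ := exists_blame_shift hι
  let W : Set (G → ℕ) := {y | (y ∈ freePart G ℕ ∧ y ∈ A) ∨ (y ∉ freePart G ℕ ∧ y ∉ D)}
  have hF := measurableSet_freePart G
  have hW : MeasurableSet W := (hF.inter hA).union (hF.compl.inter hD.compl)
  have hdet := fun k => borel_determinacy (measurable_play σ k hW)
  choose ε τ hτ using hdet
  obtain ⟨c, hc⟩ := Finite.exists_infinite_fiber ε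
  let e : ℕ ↪ (ε ⁻¹' {c} : Set ℕ) := Infinite.natEmbedding _
  let κ : (M c → ℕ) → M c → ℕ := fun x γ => e (x γ)
  let f : (M c → ℕ) → G → ℕ := fun x => σ.assemble c (κ x) (σ.runs c τ (κ x))
  have hf : ∀ γ x, f (shift γ x) = shift (ι c γ) (f x) := by
    intro γ x
    funext g
    change σ.assemble c (shift γ (κ x)) (σ.runs c τ (shift γ (κ x))) g = _
    rw [assemble_equivariant (fun γ' => runs_shift τ (κ x) γ _ γ'), map_inv]
    rfl
  have hwin : ∀ x γ, shift (ι c γ)⁻¹ (f x) ∈ W ↔ c = false := by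
    intro x γ
    have h1 : ε (κ x γ) = c := (e (x γ)).2
    rw [shift_assemble]
    have h2 := hτ (κ x γ) (fun n => σ.runs c τ (κ x) n γ) fun n hn => by
      rw [h1] at hn
      exact runs_of_turn τ (κ x) hn γ
    rw [h1] at h2
    exact h2
  have hmem : ∀ x, ∀ h ∈ (ι c).range, shift h (f x) ∈ W ↔ c = false := by
    rintro x _ ⟨γ, rfl⟩
    have h := hwin x γ⁻¹
    rwa [map_inv, inv_inv] at h
  have hfree : ∀ x ∈ freePart (M c) ℕ, ∀ h ∈ (ι c).range, h ≠ 1 → shift h (f x) ≠ f x := by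
    rintro x hx _ ⟨γ, rfl⟩ h1 h2
    rw [← hf] at h2
    refine hx γ (fun h => h1 (by rw [h, map_one])) (funext fun m => ?_)
    have h3 := congrFun (congrArg (shift (ι c m)⁻¹) h2) 1
    simp only [f, shift_assemble, play, if_true] at h3
    exact e.injective (Subtype.ext h3)
  have hshift_free : ∀ y ∉ freePart G ℕ, ∀ h : G, shift h y ∉ freePart G ℕ := by
    intro y hy h hh
    simp only [freePart, Set.mem_ofPred_eq, not_forall, not_not] at hy
    obtain ⟨g, hg, hgy⟩ := hy
    refine hh (h * g * h⁻¹) (by simpa [conj_eq_one_iff] using hg) ?_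
    let := shiftAction G ℕ
    change (h * g * h⁻¹) • h • y = h • y
    have hgy : g • y = y := hgy
    simp [mul_smul, hgy]
  have hfy : ∀ x ∈ freePart (M c) ℕ, f x ∈ freePart G ℕ := by
    intro x hx
    by_contra hy
    have h1 := hmem x
    have h2 := hfree x hx
    have h3 : ∀ h, shift h (f x) ∈ W ↔ shift h (f x) ∉ D := fun h => by
      simp [W, hshift_free _ hy h]
    simp only [h3] at h1
    cases c
    · obtain ⟨h, hh, hhD⟩ := (hblame _ hy).1 h2
      exact (h1 h hh).2 rfl hhD
    · obtain ⟨h, hh, hhD⟩ := (hblame _ hy).2 h2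
      exact absurd ((h1 h hh).1 hhD) (by simp)
  refine ⟨c, f, ?_, hf, fun x hx => ⟨hfy x hx, ?_⟩⟩
  · have hκ : ∀ γ, Measurable fun x => κ x γ := fun γ =>
      (Measurable.of_discrete (f := fun n => (e n : ℕ))).comp (measurable_pi_apply γ)
    exact measurable_pi_iff.2 fun g => measurable_assemble hκ (measurable_runs τ hκ _)
  · have h := hwin x 1
    have h1 : shift (ι c 1)⁻¹ (f x) = f x := by funext g; simp [shift]
    rw [h1] at h
    simpa [W, hfy x hx] using h

end FreeSplitting

end FreeProduct

section Coloring

open Monoid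

section BorelChromaticNumber

variable {G : Type} [Group G]

lemma freePart_nonempty [Countable G] : (freePart G ℕ).Nonempty := by
  obtain ⟨y, hy⟩ := Countable.exists_injective_nat G
  refine ⟨y, fun γ hγ h => hγ ?_⟩
  have h1 : γ⁻¹ * 1 = 1 := hy (congrFun h 1)
  simpa using h1

lemma borelChromaticNumber_le {X : Type} [MeasurableSpace X] {R : X → X → Prop} {Y : Type}
    [MeasurableSpace Y] [StandardBorelSpace Y] {c : X → Y} (hc : Measurable c)
    (h : ∀ x y, R x y → c x ≠ c y) : borelChromaticNumber R ≤ Cardinal.mk Y :=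
  csInf_le' ⟨Y, _, inferInstance, rfl, c, hc, h⟩

lemma exists_coloring [Countable G] {S : Set G} (hS : (1 : G) ∉ S) :
    ∃ (Y : Type) (mY : MeasurableSpace Y),
      @StandardBorelSpace Y mY ∧ Cardinal.mk Y = borelChromaticNumber (cayleyAdj S ℕ) ∧
      ∃ c : freePart G ℕ → Y, @Measurable _ Y _ mY c ∧ ∀ x y, cayleyAdj S ℕ x y → c x ≠ c y := by
  refine csInf_mem (s := {κ : Cardinal | ∃ (Y : Type) (mY : MeasurableSpace Y),
    @StandardBorelSpace Y mY ∧ Cardinal.mk Y = κ ∧ ∃ c : freePart G ℕ → Y,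
      @Measurable _ Y _ mY c ∧ ∀ x y, cayleyAdj S ℕ x y → c x ≠ c y})
    ⟨_, G → ℕ, inferInstance, inferInstance, rfl, Subtype.val, measurable_subtype_coe, ?_⟩
  rintro x y ⟨γ, hγ, h⟩ hxy
  have hγ1 : γ ≠ 1 := fun h => hS (h ▸ hγ)
  rcases h with h | h
  · exact x.2 γ hγ1 (h.trans hxy.symm)
  · exact y.2 γ hγ1 (h.trans hxy)

lemma borelChromaticNumber_pos [Countable G] {S : Set G} (hS : (1 : G) ∉ S) :
    0 < borelChromaticNumber (cayleyAdj S ℕ) := by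
  obtain ⟨Y, mY, -, hY, c, -⟩ := exists_coloring hS
  rw [← hY, pos_iff_ne_zero, Cardinal.mk_ne_zero_iff]
  exact freePart_nonempty.to_subtype.map c

variable {M : Bool → Type} [∀ b, Group (M b)] {ι : ∀ b, M b →* G}

/-- Whenever a coloring of the free part for `G` is divided into two sets of colors, one of the
two sets suffices to color the free part for the corresponding factor. -/
theorem FreeSplitting.borelChromaticNumber_le_or [Countable G] (σ : FreeSplitting ι)
    (hι : Subgroup.closure (⋃ b, ((ι b).range : Set G)) = ⊤) {S : ∀ b, Set (M b)} {U : Set G}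
    (hU : ∀ b, ∀ s ∈ S b, ι b s ∈ U) {Y : Type} [MeasurableSpace Y] [StandardBorelSpace Y]
    {c : freePart G ℕ → Y} (hc : Measurable c) (hcU : ∀ x y, cayleyAdj U ℕ x y → c x ≠ c y)
    {R : Set Y} (hR : MeasurableSet R) :
    borelChromaticNumber (cayleyAdj (S false) ℕ) ≤ Cardinal.mk R ∨
      borelChromaticNumber (cayleyAdj (S true) ℕ) ≤ Cardinal.mk (Rᶜ : Set Y) := by
  obtain ⟨b, f, hf, hfs, hff⟩ := σ.exists_equivariant hι
    ((measurableSet_freePart G).subtype_image (hc hR))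
  have hfR : ∀ x : freePart (M b) ℕ, c ⟨f x, (hff x x.2).1⟩ ∈ R ↔ b = false := by
    intro x
    refine Iff.trans ?_ (hff x x.2).2
    simp [(hff x x.2).1]
  have hadj : ∀ x y : freePart (M b) ℕ, cayleyAdj (S b) ℕ x y →
      c ⟨f x, (hff x x.2).1⟩ ≠ c ⟨f y, (hff y y.2).1⟩ := by
    rintro x y ⟨s, hs, h⟩
    refine hcU _ _ ⟨ι b s, hU b s hs, ?_⟩
    simpa only [← hfs] using h.imp (congrArg f) (congrArg f)
  have hmeas : Measurable fun x : freePart (M b) ℕ => c ⟨f x, (hff x x.2).1⟩ :=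
    hc.comp ((hf.comp measurable_subtype_coe).subtype_mk)
  cases b
  · left
    have := hR.standardBorel
    refine borelChromaticNumber_le (hmeas.subtype_mk (h := fun x => (hfR x).2 rfl))
      fun x y hxy h => hadj x y hxy (congrArg Subtype.val h)
  · right
    have := hR.compl.standardBorel
    refine borelChromaticNumber_le
      (hmeas.subtype_mk (p := (· ∈ Rᶜ)) (h := fun x h => by simpa using (hfR x).1 h))
      fun x y hxy h => hadj x y hxy (congrArg Subtype.val h)

lemma add_le_mk_add_one {a b : Cardinal} {Y : Type} [MeasurableSpace Y] [StandardBorelSpace Y]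
    (ha : 0 < a) (hb : 0 < b)
    (h : ∀ R : Set Y, MeasurableSet R → a ≤ Cardinal.mk R ∨ b ≤ Cardinal.mk (Rᶜ : Set Y)) :
    a + b ≤ Cardinal.mk Y + 1 := by
  have haY : a ≤ Cardinal.mk Y := by simpa [hb.not_ge] using h Set.univ .univ
  have hbY : b ≤ Cardinal.mk Y := by simpa [ha.not_ge] using h ∅ .empty
  rcases finite_or_infinite Y with hY | hY
  · have := Fintype.ofFinite Y
    have hYlt := Cardinal.mk_lt_aleph0 (α := Y)
    obtain ⟨a, rfl⟩ := Cardinal.lt_aleph0.1 (haY.trans_lt hYlt)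
    obtain ⟨b, rfl⟩ := Cardinal.lt_aleph0.1 (hbY.trans_lt hYlt)
    rw [Cardinal.mk_fintype] at *
    norm_cast at *
    by_contra! hlt
    obtain ⟨R, -, hR⟩ := Finset.exists_subset_card_eq
      (s := (Finset.univ : Finset Y)) (n := a - 1) (by rw [Finset.card_univ]; omega)
    classical
    rcases h R R.measurableSet with h1 | h1
    · rw [Finset.coe_sort_coe, Cardinal.mk_coe_finset, Nat.cast_le] at h1
      omega
    · rw [← Finset.coe_compl, Finset.coe_sort_coe, Cardinal.mk_coe_finset, Nat.cast_le,
        Finset.card_compl] at h1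
      omega
  · calc a + b ≤ Cardinal.mk Y + Cardinal.mk Y := add_le_add haY hbY
      _ = Cardinal.mk Y := Cardinal.add_eq_self (Cardinal.aleph0_le_mk Y)
      _ ≤ _ := le_self_add

end BorelChromaticNumber

lemma countable_of_closure_eq_top {G : Type*} [Group G] {S : Set G} (hS : S.Countable)
    (h : Subgroup.closure S = ⊤) : Countable G := by
  have := hS.to_subtype
  have : Countable (FreeGroup S) := inferInstanceAs (Countable (Quot _))
  have h1 : (FreeGroup.lift (Subtype.val : S → G)).range = ⊤ := by
    rw [FreeGroup.range_lift_eq_closure, Subtype.range_coe, h]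
  exact (MonoidHom.range_eq_top.1 h1).countable

/-- The binary coproduct of monoids as an indexed one. -/
def coprodEquivCoprodI (M : Bool → Type) [∀ b, Group (M b)] :
    Coprod (M false) (M true) ≃* CoprodI M :=
  MonoidHom.toMulEquiv (Coprod.lift CoprodI.of CoprodI.of)
    (CoprodI.lift fun b => match b with
      | false => Coprod.inl
      | true => Coprod.inr)
    (by ext <;> simp) (by ext b; cases b <;> simp)

theorem borelChromaticNumber_add_le (M : Bool → Type) [∀ b, Group (M b)] [∀ b, Countable (M b)]
    (S : ∀ b, Set (M b)) (hS : ∀ b, (1 : M b) ∉ S b) :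
    borelChromaticNumber (cayleyAdj (S false) ℕ) + borelChromaticNumber (cayleyAdj (S true) ℕ) ≤
      borelChromaticNumber (cayleyAdj ((fun γ => Coprod.inl γ) '' S false ∪
        (fun δ => Coprod.inr δ) '' S true : Set (Coprod (M false) (M true))) ℕ) + 1 := by
  have : Countable (FreeMonoid (M false ⊕ M true)) := inferInstanceAs (Countable (List _))
  have : Countable (Coprod (M false) (M true)) := Coprod.mk_surjective.countable
  obtain ⟨σ⟩ := FreeSplitting.nonempty_of_mulEquiv (coprodEquivCoprodI M)
  have h_false : ∀ m, (coprodEquivCoprodI M).symm (CoprodI.of (i := false) m) = Coprod.inl m :=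
    fun m => by simp [coprodEquivCoprodI]
  have h_true : ∀ m, (coprodEquivCoprodI M).symm (CoprodI.of (i := true) m) = Coprod.inr m :=
    fun m => by simp [coprodEquivCoprodI]
  have hU1 : (1 : Coprod (M false) (M true)) ∉ (fun γ => Coprod.inl γ) '' S false ∪
      (fun δ => Coprod.inr δ) '' S true := by
    rintro (⟨s, hs, h⟩ | ⟨s, hs, h⟩)
    · rw [← map_one Coprod.inl] at h
      exact hS _ (Coprod.inl_injective h ▸ hs)
    · rw [← map_one Coprod.inr] at h
      exact hS _ (Coprod.inr_injective h ▸ hs)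
  obtain ⟨Y, mY, hY, hYc, c, hc, hcU⟩ := exists_coloring hU1
  rw [← hYc]
  refine add_le_mk_add_one (borelChromaticNumber_pos (hS _)) (borelChromaticNumber_pos (hS _))
    fun R hR => σ.borelChromaticNumber_le_or ?_ ?_ hc hcU hR
  · rw [eq_top_iff, ← Coprod.closure_range_inl_union_inr]
    refine Subgroup.closure_mono (Set.union_subset ?_ ?_)
    · rintro _ ⟨m, rfl⟩
      exact Set.mem_iUnion.2 ⟨false, m, h_false m⟩
    · rintro _ ⟨m, rfl⟩
      exact Set.mem_iUnion.2 ⟨true, m, h_true m⟩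
  · rintro (_ | _) s hs
    · exact .inl ⟨s, hs, (h_false s).symm⟩
    · exact .inr ⟨s, hs, (h_true s).symm⟩

end Coloring

/-- If `Γ` and `Δ` are finitely generated marked groups, then
`χ_B(G(Γ*Δ, ℕ)) ≥ χ_B(G(Γ, ℕ)) + χ_B(G(Δ, ℕ)) − 1`, where `Γ*Δ` is marked by the union
of the generators of `Γ` and `Δ`. (The inequality is stated as
`χ_B(G(Γ,ℕ)) + χ_B(G(Δ,ℕ)) ≤ χ_B(G(Γ*Δ,ℕ)) + 1`.) -/
theorem stmt_2 (Γ Δ : Type) [Group Γ] [Group Δ]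
    (S : Set Γ) (T : Set Δ)
    (hSfin : S.Finite) (hTfin : T.Finite)
    (hS1 : (1 : Γ) ∉ S) (hT1 : (1 : Δ) ∉ T)
    (hSgen : Subgroup.closure S = ⊤) (hTgen : Subgroup.closure T = ⊤) :
    borelChromaticNumber (cayleyAdj S ℕ) + borelChromaticNumber (cayleyAdj T ℕ) ≤
      borelChromaticNumber
        (cayleyAdj ((fun γ => Monoid.Coprod.inl γ) '' S ∪ (fun δ => Monoid.Coprod.inr δ) '' T :
          Set (Monoid.Coprod Γ Δ)) ℕ) + 1 := by
  have hΓ := countable_of_closure_eq_top hSfin.countable hSgen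
  have hΔ := countable_of_closure_eq_top hTfin.countable hTgen
  let M : Bool → Type := fun b => match b with
    | false => Γ
    | true => Δ
  let _ : ∀ b, Group (M b) := fun b => match b with
    | false => ‹Group Γ›
    | true => ‹Group Δ›
  have : ∀ b, Countable (M b) := Bool.rec hΓ hΔ
  exact borelChromaticNumber_add_le M (fun b => match b with
    | false => S
    | true => T) (Bool.rec hS1 hT1)
end
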